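/- Let n ≥ 2, fix signs ε_1,…,ε_n ∈ {1,−1}, and let (q,r) be an admissible pair with q > 2 and r > 2; let q', r' denote the conjugate exponents (1/q + 1/q' = 1, 1/r + 1/r' = 1). There is a constant C > 0 such that for every F ∈ 𝒮(ℝ×ℝⁿ), every j ∈ ℤ, and every unit vector e ∈ S^{n−1}, 2^{j/2} ‖P_j Q^{e_±}_{j,20} ∫_0^t W_±(t−s)F(s)ds‖_{L^{∞,2}_e} ≤ C ‖P_j F‖_{L^{q'}_t L^{r'}_x}. -/

import Mathlib

open MeasureTheory Complex Filter
open scoped FourierTransform RealInnerProductSpace ENNReal NNReal Topology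

noncomputable section

namespace DNLS

/-- Euclidean space ℝⁿ. -/
abbrev Eucl (n : ℕ) := EuclideanSpace ℝ (Fin n)

/-- The quadratic symbol `|ξ|²_± = Σ εᵢ ξᵢ²`. -/
def quadSym {n : ℕ} (ε : Fin n → ℝ) (ξ : Eucl n) : ℝ := ∑ i, ε i * (ξ i) ^ 2

/-- The signed vector `e_± = (ε₁e₁, …, εₙeₙ)`. -/
def epm {n : ℕ} (ε : Fin n → ℝ) (e : Eucl n) : Eucl n := WithLp.toLp 2 (fun i => ε i * e i)

/-- Fourier multiplier operator with symbol `m`. -/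
def mulOp {n : ℕ} (m : Eucl n → ℂ) (f : Eucl n → ℂ) : Eucl n → ℂ :=
  𝓕⁻ (fun ξ => m ξ * 𝓕 f ξ)

/-- The propagator `W_±(t)`, with `(W_±(t)φ)^(ξ) = e^{-it|ξ|²_±} φ̂(ξ)`. -/
def prop {n : ℕ} (ε : Fin n → ℝ) (t : ℝ) (φ : Eucl n → ℂ) : Eucl n → ℂ :=
  mulOp (fun ξ => Complex.exp (-Complex.I * t * quadSym ε ξ)) φ

/-- Fourier multiplier operator acting in the space variable of a space-time function. -/
def mulOpT {n : ℕ} (m : Eucl n → ℂ) (u : ℝ × Eucl n → ℂ) : ℝ × Eucl n → ℂ :=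
  fun p => mulOp m (fun y => u (p.1, y)) p.2

/-- Hypotheses on the bump function χ : even, smooth, compactly supported in (-2,2),
equal to one on [-1,1]. -/
structure IsBump (χ : ℝ → ℝ) : Prop where
  smooth : ∀ k : ℕ, ContDiff ℝ k χ
  even : ∀ s, χ (-s) = χ s
  supp : ∀ s, 2 ≤ |s| → χ s = 0
  one : ∀ s, |s| ≤ 1 → χ s = 1

/-- `ψ(s) = χ(|s|) - χ(2|s|)`. -/
def psiR (χ : ℝ → ℝ) (s : ℝ) : ℝ := χ |s| - χ (2 * |s|)

/-- `ψ_{≥k}(s) = Σ_{m ≥ k} ψ(2^{-m} s)`. -/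
def psiGe (χ : ℝ → ℝ) (k : ℤ) (s : ℝ) : ℝ :=
  ∑' m : ℤ, if k ≤ m then psiR χ ((2 : ℝ) ^ (-m) * s) else 0

/-- Littlewood–Paley projection `P_j`. -/
def proj {n : ℕ} (χ : ℝ → ℝ) (j : ℤ) (f : Eucl n → ℂ) : Eucl n → ℂ :=
  mulOp (fun ξ => (psiR χ ((2 : ℝ) ^ (-j) * ‖ξ‖) : ℂ)) f

/-- Low-frequency projection `P_{≤0} = I - Σ_{j≥1} P_j`. -/
def lowProj {n : ℕ} (χ : ℝ → ℝ) (f : Eucl n → ℂ) : Eucl n → ℂ :=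
  mulOp (fun ξ => ((1 - psiGe χ 1 ‖ξ‖ : ℝ) : ℂ)) f

/-- Directional frequency cutoff `Q^{e}_{j,l}` with symbol `ψ_{≥ j-l}(ξ·e)`. -/
def qproj {n : ℕ} (χ : ℝ → ℝ) (e : Eucl n) (j l : ℤ) (f : Eucl n → ℂ) : Eucl n → ℂ :=
  mulOp (fun ξ => ((psiGe χ (j - l) (inner ℝ ξ e : ℝ) : ℝ) : ℂ)) f

/-- `P_j` acting in the space variable of a space-time function. -/
def projT {n : ℕ} (χ : ℝ → ℝ) (j : ℤ) (u : ℝ × Eucl n → ℂ) : ℝ × Eucl n → ℂ :=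
  fun p => proj χ j (fun y => u (p.1, y)) p.2

/-- `P_{≤0}` acting in the space variable of a space-time function. -/
def lowProjT {n : ℕ} (χ : ℝ → ℝ) (u : ℝ × Eucl n → ℂ) : ℝ × Eucl n → ℂ :=
  fun p => lowProj χ (fun y => u (p.1, y)) p.2

/-- `Q^{e}_{j,l}` acting in the space variable of a space-time function. -/
def qprojT {n : ℕ} (χ : ℝ → ℝ) (e : Eucl n) (j l : ℤ) (u : ℝ × Eucl n → ℂ) :
    ℝ × Eucl n → ℂ :=
  fun p => qproj χ e j l (fun y => u (p.1, y)) p.2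

/-- The hyperplane `P_e = {ξ : ξ·e = 0}`. -/
def hyperplane {n : ℕ} (e : Eucl n) : Submodule ℝ (Eucl n) := (ℝ ∙ e)ᗮ

/-- Inner part of the anisotropic norm: the `L^q` norm over `P_e × ℝ` of
`(t,v) ↦ u(t, re + v)`. -/
def innerQ {n : ℕ} (q : ℝ≥0∞) (e : Eucl n) (u : ℝ × Eucl n → ℂ) (r : ℝ) : ℝ≥0∞ :=
  eLpNorm (fun tv : ℝ × (hyperplane e) => u (tv.1, r • e + (tv.2 : Eucl n))) q volume

/-- The anisotropic norm `‖u‖_{L^{p,q}_e}`. -/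
def aniNorm {n : ℕ} (p q : ℝ≥0∞) (e : Eucl n) (u : ℝ × Eucl n → ℂ) : ℝ≥0∞ :=
  if p = ∞ then essSup (innerQ q e u) volume
  else (∫⁻ r : ℝ, innerQ q e u r ^ p.toReal) ^ (1 / p.toReal)

/-- The mixed space-time norm `‖u‖_{L^q_t L^r_x}`. -/
def mixNorm {n : ℕ} (q r : ℝ≥0∞) (u : ℝ × Eucl n → ℂ) : ℝ≥0∞ :=
  if q = ∞ then essSup (fun t => eLpNorm (fun x => u (t, x)) r volume) volume
  else (∫⁻ t : ℝ, eLpNorm (fun x => u (t, x)) r volume ^ q.toReal) ^ (1 / q.toReal)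

/-- `2^a` as an extended nonnegative real. -/
def tp (a : ℝ) : ℝ≥0∞ := ENNReal.ofReal ((2 : ℝ) ^ a)

/-- Homogeneous Besov norm `‖φ‖_{Ḃ^s_{2,1}}`. -/
def homBesov {n : ℕ} (χ : ℝ → ℝ) (s : ℝ) (φ : Eucl n → ℂ) : ℝ≥0∞ :=
  ∑' j : ℤ, tp (s * j) * eLpNorm (proj χ j φ) 2 volume

/-- Inhomogeneous Besov norm `‖φ‖_{B^s_{2,1}}`. -/
def besov {n : ℕ} (χ : ℝ → ℝ) (s : ℝ) (φ : Eucl n → ℂ) : ℝ≥0∞ :=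
  eLpNorm (lowProj χ φ) 2 volume
    + ∑' j : ℕ, tp (s * (j + 1)) * eLpNorm (proj χ (j + 1) φ) 2 volume

/-- The supremum over unit vectors, auxiliary notation. -/
def sphSup {n : ℕ} (g : Eucl n → ℝ≥0∞) : ℝ≥0∞ := ⨆ (e : Eucl n) (_ : ‖e‖ = 1), g e

/-- `‖P_j u‖_{M^m_j} = 2^{-(n/2-1/(m-1))j} sup_e ‖P_j u‖_{L^{m-1,∞}_e}`. -/
def MmJ {n : ℕ} (χ : ℝ → ℝ) (m : ℕ) (j : ℤ) (u : ℝ × Eucl n → ℂ) : ℝ≥0∞ :=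
  tp (-((n : ℝ) / 2 - 1 / ((m : ℝ) - 1)) * j)
    * sphSup (fun e => aniNorm ((m : ℝ≥0∞) - 1) ∞ e (projT χ j u))

/-- `‖P_j u‖_{S_j} = 2^{j/2} sup_e ‖P_j Q^{e_±}_{j,20} u‖_{L^{∞,2}_e}`. -/
def SJ {n : ℕ} (ε : Fin n → ℝ) (χ : ℝ → ℝ) (j : ℤ) (u : ℝ × Eucl n → ℂ) : ℝ≥0∞ :=
  tp ((j : ℝ) / 2)
    * sphSup (fun e => aniNorm ∞ 2 e (projT χ j (qprojT χ (epm ε e) j 20 u)))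

/-- `‖P_j u‖_{T_j} = ‖P_j u‖_{L^∞_t L²_x}`. -/
def TJ {n : ℕ} (χ : ℝ → ℝ) (j : ℤ) (u : ℝ × Eucl n → ℂ) : ℝ≥0∞ :=
  mixNorm ∞ 2 (projT χ j u)

/-- `‖P_j u‖_{Y^m_j}`. -/
def YmJ {n : ℕ} (ε : Fin n → ℝ) (χ : ℝ → ℝ) (m : ℕ) (j : ℤ) (u : ℝ × Eucl n → ℂ) : ℝ≥0∞ :=
  MmJ χ m j u + SJ ε χ j u + TJ χ j u

/-- The homogeneous resolution norm `‖u‖_{Ż^σ_{2,1}}`. -/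
def Zhom {n : ℕ} (ε : Fin n → ℝ) (χ : ℝ → ℝ) (m : ℕ) (σ : ℝ) (u : ℝ × Eucl n → ℂ) : ℝ≥0∞ :=
  ∑' j : ℤ, tp (σ * j) * YmJ ε χ m j u

/-- `N_j`-norm of a function: `2^{-j/2} sup_e ‖f‖_{L^{1,2}_e}`. -/
def NJraw {n : ℕ} (j : ℤ) (f : ℝ × Eucl n → ℂ) : ℝ≥0∞ :=
  tp (-(j : ℝ) / 2) * sphSup (fun e => aniNorm 1 2 e f)

/-- `‖P_j u‖_{N_j}`. -/
def NJ {n : ℕ} (χ : ℝ → ℝ) (j : ℤ) (u : ℝ × Eucl n → ℂ) : ℝ≥0∞ :=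
  NJraw j (projT χ j u)

/-- The homogeneous nonlinear norm `‖F‖_{Ṅ^σ_{2,1}}`. -/
def Nhom {n : ℕ} (χ : ℝ → ℝ) (σ : ℝ) (F : ℝ × Eucl n → ℂ) : ℝ≥0∞ :=
  ∑' j : ℤ, tp (σ * j) * NJ χ j F

/-- `‖P_j u‖_{T̃_j} = ‖P_j u‖_{L^∞_t L²_x} + ‖P_j u‖_{L^{2+4/n}_{t,x}}`. -/
def TtilJ {n : ℕ} (χ : ℝ → ℝ) (j : ℤ) (u : ℝ × Eucl n → ℂ) : ℝ≥0∞ :=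
  mixNorm ∞ 2 (projT χ j u)
    + eLpNorm (projT χ j u) (ENNReal.ofReal (2 + 4 / (n : ℝ))) volume

/-- `‖P_j u‖_{M̃_j} = sup_{p ∈ ℤ, p ≥ 2, np ≥ 6} sup_e 2^{(n/2-1/p)j}‖P_j u‖_{L^{p,∞}_e}`. -/
def MtilJ {n : ℕ} (χ : ℝ → ℝ) (j : ℤ) (u : ℝ × Eucl n → ℂ) : ℝ≥0∞ :=
  ⨆ (p : ℕ) (_ : 2 ≤ p ∧ 6 ≤ n * p),
    sphSup (fun e => tp (((n : ℝ) / 2 - 1 / (p : ℝ)) * j) * aniNorm (p : ℝ≥0∞) ∞ e (projT χ j u))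

/-- `‖P_j u‖_{Ỹ_j}`. -/
def YtilJ {n : ℕ} (ε : Fin n → ℝ) (χ : ℝ → ℝ) (j : ℤ) (u : ℝ × Eucl n → ℂ) : ℝ≥0∞ :=
  MtilJ χ j u + SJ ε χ j u + TtilJ χ j u

/-- The inhomogeneous resolution norm `‖u‖_{Z̃^σ_{2,1}}`. -/
def Ztil {n : ℕ} (ε : Fin n → ℝ) (χ : ℝ → ℝ) (σ : ℝ) (u : ℝ × Eucl n → ℂ) : ℝ≥0∞ :=
  (∑' j : ℤ, if j ≤ 0 then YtilJ ε χ j u ^ 2 else 0) ^ ((1 : ℝ) / 2)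
    + ∑' j : ℤ, if 1 ≤ j then tp (σ * j) * YtilJ ε χ j u else 0

/-- `‖f‖_{Ñ_j}`: infimum over decompositions `f = v + w`. -/
def NtilJraw {n : ℕ} (j : ℤ) (f : ℝ × Eucl n → ℂ) : ℝ≥0∞ :=
  ⨅ (vw : (ℝ × Eucl n → ℂ) × (ℝ × Eucl n → ℂ)) (_ : f = vw.1 + vw.2),
    NJraw j vw.1 + eLpNorm vw.2 (ENNReal.ofReal ((2 * (n : ℝ) + 4) / ((n : ℝ) + 4))) volume

/-- The inhomogeneous nonlinear norm `‖F‖_{Ñ^σ_{2,1}}`. -/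
def Ntil {n : ℕ} (χ : ℝ → ℝ) (σ : ℝ) (F : ℝ × Eucl n → ℂ) : ℝ≥0∞ :=
  (∑' j : ℤ, if j ≤ 0 then NtilJraw j (projT χ j F) ^ 2 else 0) ^ ((1 : ℝ) / 2)
    + ∑' j : ℤ, if 1 ≤ j then tp (σ * j) * NtilJraw j (projT χ j F) else 0

/-- `k`-th spatial partial derivative of a space-time function. -/
def pd {n : ℕ} (k : ℕ) (u : ℝ × Eucl n → ℂ) (p : ℝ × Eucl n) : ℂ :=
  if h : k < n then fderiv ℝ (fun y => u (p.1, y)) p.2 (EuclideanSpace.single ⟨k, h⟩ (1 : ℝ))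
  else 0

/-- The retarded Duhamel integral `∫_0^t W_±(t-s) G(s) ds`. -/
def duhamel {n : ℕ} (ε : Fin n → ℝ) (G : ℝ × Eucl n → ℂ) (p : ℝ × Eucl n) : ℂ :=
  ∫ s in (0 : ℝ)..p.1, prop ε (p.1 - s) (fun y => G (s, y)) p.2

/-- Admissible Strichartz pair: `2/q = n(1/2 - 1/r)`, `q, r ≥ 2`, and `q ≠ 2` when `n = 2`. -/
def Admissible (n : ℕ) (q r : ℝ) : Prop :=
  2 / q = (n : ℝ) * (1 / 2 - 1 / r) ∧ 2 ≤ q ∧ 2 ≤ r ∧ (n = 2 → q ≠ 2)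

/-- Value of a power series with coefficients `c` at `z`. -/
def polyVal {d : ℕ} (c : (Fin d →₀ ℕ) → ℂ) (z : Fin d → ℂ) : ℂ :=
  ∑' β : Fin d →₀ ℕ, c β * ∏ i, z i ^ β i

/-- The argument vector `(u, ū, ∇u, ∇ū)` of the general nonlinearity. -/
def nlArg {n : ℕ} (u : ℝ × Eucl n → ℂ) (p : ℝ × Eucl n) (i : Fin (2 * n + 2)) : ℂ :=
  if (i : ℕ) = 0 then u p
  else if (i : ℕ) = 1 then starRingEnd ℂ (u p)
  else if (i : ℕ) < n + 2 then pd ((i : ℕ) - 2) u p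
  else pd ((i : ℕ) - (n + 2)) (fun q => starRingEnd ℂ (u q)) p

/-- The argument vector `(∇u, ∇ū)` of a nonlinearity in `2n` variables. -/
def gradArg {n : ℕ} (u : ℝ × Eucl n → ℂ) (p : ℝ × Eucl n) (i : Fin (2 * n)) : ℂ :=
  if (i : ℕ) < n then pd (i : ℕ) u p
  else pd ((i : ℕ) - n) (fun q => starRingEnd ℂ (u q)) p

end DNLS
open DNLS

namespace DNLS

set_option linter.unusedSectionVars false

section GaussianBessel

variable {V : Type*} [NormedAddCommGroup V] [InnerProductSpace ℝ V] [FiniteDimensional ℝ V]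
  [MeasurableSpace V] [BorelSpace V]

/-- The Fourier transform of `v ↦ exp (-δ ‖v‖²)`, an approximate identity as `δ → 0`. -/
def gaussKernel (δ : ℝ) (w : V) : ℝ :=
  (Real.pi / δ) ^ ((Module.finrank ℝ V : ℝ) / 2) * Real.exp (-(Real.pi ^ 2 / δ) * ‖w‖ ^ 2)

theorem gaussKernel_nonneg {δ : ℝ} (hδ : 0 < δ) (w : V) : 0 ≤ gaussKernel δ w := by
  unfold gaussKernel; positivity

theorem measurable_gaussKernel (δ : ℝ) : Measurable (gaussKernel δ : V → ℝ) := by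
  unfold gaussKernel; fun_prop

theorem integral_cexp_neg_mul_sq_norm_eq_gaussKernel {δ : ℝ} (hδ : 0 < δ) (w : V) :
    ∫ v : V, cexp (-(δ : ℂ) * (‖v‖ : ℂ) ^ 2) * cexp (2 * Real.pi * ⟪v, w⟫ * I)
      = (gaussKernel δ w : ℂ) := by
  have h := GaussianFourier.integral_cexp_neg_mul_sq_norm_add (V := V) (b := (δ : ℂ))
    (by simpa using hδ) (2 * Real.pi * I) w
  have e1 : ∀ v : V, cexp (-(δ : ℂ) * (‖v‖ : ℂ) ^ 2) * cexp (2 * Real.pi * ⟪v, w⟫ * I)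
      = cexp (-(δ : ℂ) * (‖v‖ : ℂ) ^ 2 + 2 * Real.pi * I * (⟪w, v⟫ : ℝ)) := by
    intro v
    rw [← Complex.exp_add, real_inner_comm]
    congr 1; ring
  simp_rw [e1, h]
  unfold gaussKernel
  push_cast
  congr 1
  · rw [← Complex.ofReal_div, Complex.ofReal_cpow (by positivity)]
    push_cast; rfl
  · congr 1
    have : (δ : ℂ) ≠ 0 := by exact_mod_cast hδ.ne'
    field_simp
    rw [I_sq]; ring

theorem lintegral_gaussKernel {δ : ℝ} (hδ : 0 < δ) :
    ∫⁻ x : V, ENNReal.ofReal (gaussKernel δ x) = 1 := by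
  have hb : 0 < Real.pi ^ 2 / δ := by positivity
  have h := GaussianFourier.integral_rexp_neg_mul_sq_norm (V := V) hb
  have hInt : Integrable (fun v : V => Real.exp (-(Real.pi ^ 2 / δ) * ‖v‖ ^ 2)) := by
    have := GaussianFourier.integrable_cexp_neg_mul_sq_norm_add (V := V)
      (b := ((Real.pi ^ 2 / δ : ℝ) : ℂ)) (by rw [Complex.ofReal_re]; exact hb) 0 0
    refine this.norm.congr (Eventually.of_forall fun v => ?_)
    simp only [zero_mul, add_zero, Complex.norm_exp]
    congr 1
    norm_cast
  rw [← ofReal_integral_eq_lintegral_ofReal]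
  · unfold gaussKernel
    rw [integral_const_mul, h, ← Real.mul_rpow (by positivity) (by positivity)]
    have : Real.pi / δ * (Real.pi / (Real.pi ^ 2 / δ)) = 1 := by
      field_simp
    rw [this, Real.one_rpow, ENNReal.ofReal_one]
  · exact hInt.const_mul _
  · exact Eventually.of_forall fun v => gaussKernel_nonneg hδ v

theorem lintegral_gaussKernel_sub {δ : ℝ} (hδ : 0 < δ) (w : V) :
    ∫⁻ x : V, ENNReal.ofReal (gaussKernel δ (w - x)) = 1 := by
  rw [lintegral_sub_left_eq_self (fun x : V => ENNReal.ofReal (gaussKernel δ x)) w,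
    lintegral_gaussKernel hδ]

theorem gaussKernel_neg (δ : ℝ) (w : V) : gaussKernel δ (-w) = gaussKernel δ w := by
  simp [gaussKernel]

/-- Schur's test for a symmetric nonnegative kernel. -/
theorem lintegral_schur {X : Type*} [MeasurableSpace X] {μ : Measure X} [SFinite μ]
    {k : X → X → ℝ≥0∞} (hk : Measurable (Function.uncurry k)) (hsymm : ∀ x y, k x y = k y x)
    {M : ℝ≥0∞} (hM : ∀ x, ∫⁻ y, k x y ∂μ ≤ M) {a : X → ℝ≥0∞} (ha : AEMeasurable a μ) :
    ∫⁻ x, ∫⁻ y, a x * a y * k x y ∂μ ∂μ ≤ M * ∫⁻ x, a x ^ 2 ∂μ := by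
  have amgm : ∀ s t : ℝ≥0∞, s * t ≤ s ^ 2 / 2 + t ^ 2 / 2 := by
    intro s t
    have := ENNReal.young_inequality s t Real.HolderConjugate.two_two
    simpa using this
  have hkx : ∀ x, Measurable (k x) := fun x => hk.comp measurable_prodMk_left
  have h2 : ∀ x, ∫⁻ y, a x ^ 2 / 2 * k x y ∂μ ≤ M * (a x ^ 2 / 2) := by
    intro x
    rw [lintegral_const_mul _ (hkx x), mul_comm]
    gcongr
    exact hM x
  have hm : AEMeasurable (fun p : X × X => a p.2 ^ 2 / 2 * k p.1 p.2) (μ.prod μ) :=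
    ((ha.comp_snd.pow_const 2).div_const 2).mul hk.aemeasurable
  have hm' : AEMeasurable (fun p : X × X => a p.1 ^ 2 / 2 * k p.1 p.2) (μ.prod μ) :=
    ((ha.comp_fst.pow_const 2).div_const 2).mul hk.aemeasurable
  calc ∫⁻ x, ∫⁻ y, a x * a y * k x y ∂μ ∂μ
      ≤ ∫⁻ x, ∫⁻ y, (a x ^ 2 / 2 * k x y + a y ^ 2 / 2 * k x y) ∂μ ∂μ := by
        gcongr with x y
        rw [← add_mul]
        gcongr
        exact amgm _ _
    _ = ∫⁻ x, (∫⁻ y, a x ^ 2 / 2 * k x y ∂μ) + (∫⁻ y, a y ^ 2 / 2 * k x y ∂μ) ∂μ := by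
        refine lintegral_congr fun x => ?_
        rw [lintegral_add_left ((hkx x).const_mul _)]
    _ = (∫⁻ x, ∫⁻ y, a x ^ 2 / 2 * k x y ∂μ ∂μ) + ∫⁻ x, ∫⁻ y, a y ^ 2 / 2 * k x y ∂μ ∂μ := by
        rw [lintegral_add_left' hm'.lintegral_prod_right']
    _ = (∫⁻ x, ∫⁻ y, a x ^ 2 / 2 * k x y ∂μ ∂μ) + ∫⁻ y, ∫⁻ x, a y ^ 2 / 2 * k y x ∂μ ∂μ := by
        congr 1
        rw [lintegral_lintegral_swap hm]
        simp_rw [hsymm]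
    _ ≤ (∫⁻ x, M * (a x ^ 2 / 2) ∂μ) + ∫⁻ x, M * (a x ^ 2 / 2) ∂μ := by
        gcongr with x x
        · exact h2 x
        · exact h2 x
    _ = M * ∫⁻ x, a x ^ 2 ∂μ := by
        rw [← lintegral_add_left' (((ha.pow_const 2).div_const 2).const_mul M),
          ← lintegral_const_mul'' M (ha.pow_const 2)]
        refine lintegral_congr fun x => ?_
        rw [← mul_add, ENNReal.add_halves]

/-- The integral of `exp (2πi⟨v, θ x⟩) G x` over `x`, as a function of `v`. -/
def expTransform {X : Type*} [MeasurableSpace X] (μ : Measure X) (θ : X → V) (G : X → ℂ)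
    (v : V) : ℂ :=
  ∫ x, cexp (2 * Real.pi * ⟪v, θ x⟫ * I) * G x ∂μ

theorem norm_cexp_two_pi_mul_I (x : ℝ) : ‖cexp (2 * Real.pi * x * I)‖ = 1 := by
  have : (2 * Real.pi * x * I : ℂ) = ((2 * Real.pi * x : ℝ) : ℂ) * I := by push_cast; ring
  rw [this, Complex.norm_exp_ofReal_mul_I]

theorem conj_cexp_two_pi_mul_I (x : ℝ) :
    (starRingEnd ℂ) (cexp (2 * Real.pi * x * I)) = cexp (2 * Real.pi * (-x : ℝ) * I) := by
  rw [← Complex.exp_conj]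
  congr 1
  simp [Complex.conj_ofNat]

section

variable {X : Type*} [MeasurableSpace X] {μ : Measure X} [SFinite μ] {θ : X → V} {G : X → ℂ}

theorem aestronglyMeasurable_expTransform (hθ : Measurable θ) (hG : AEStronglyMeasurable G μ) :
    AEStronglyMeasurable (expTransform μ θ G) volume := by
  have : AEStronglyMeasurable
      (fun p : V × X => cexp (2 * Real.pi * ⟪p.1, θ p.2⟫ * I) * G p.2) (volume.prod μ) := by
    refine AEStronglyMeasurable.mul ?_ hG.comp_snd
    refine Measurable.aestronglyMeasurable ?_
    fun_prop
  exact this.integral_prod_right'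

theorem norm_expTransform_le (v : V) : ‖expTransform μ θ G v‖ ≤ ∫ x, ‖G x‖ ∂μ := by
  refine (norm_integral_le_integral_norm _).trans (le_of_eq ?_)
  simp only [norm_mul, norm_cexp_two_pi_mul_I, one_mul]

theorem integrable_cexp_neg_mul_sq_norm {δ : ℝ} (hδ : 0 < δ) :
    Integrable (fun v : V => cexp (-(δ : ℂ) * (‖v‖ : ℂ) ^ 2)) := by
  simpa using GaussianFourier.integrable_cexp_neg_mul_sq_norm_add (V := V)
    (b := (δ : ℂ)) (by simpa using hδ) 0 0

theorem norm_cexp_neg_mul_sq_norm (δ : ℝ) (v : V) :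
    ‖cexp (-(δ : ℂ) * (‖v‖ : ℂ) ^ 2)‖ = Real.exp (-δ * ‖v‖ ^ 2) := by
  rw [Complex.norm_exp]
  congr 1
  norm_cast

theorem integral_gaussian_expTransform (hθ : Measurable θ) (hG : Integrable G μ) {δ : ℝ}
    (hδ : 0 < δ) :
    ∫ v, cexp (-(δ : ℂ) * (‖v‖ : ℂ) ^ 2)
        * (expTransform μ θ G v * starRingEnd ℂ (expTransform μ θ G v))
      = ∫ p : X × X, G p.1 * starRingEnd ℂ (G p.2) * gaussKernel δ (θ p.1 - θ p.2)
          ∂(μ.prod μ) := by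
  have hGG : Integrable (fun p : X × X => G p.1 * starRingEnd ℂ (G p.2)) (μ.prod μ) :=
    hG.mul_prod (f := G) (g := fun x => starRingEnd ℂ (G x))
      ((Complex.conjLIE.toContinuousLinearEquiv.toContinuousLinearMap).integrable_comp hG)
  have e1 : ∀ v, cexp (-(δ : ℂ) * (‖v‖ : ℂ) ^ 2)
        * (expTransform μ θ G v * starRingEnd ℂ (expTransform μ θ G v))
      = ∫ p : X × X, cexp (-(δ : ℂ) * (‖v‖ : ℂ) ^ 2) *
          (cexp (2 * Real.pi * ⟪v, θ p.1 - θ p.2⟫ * I) *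
          (G p.1 * starRingEnd ℂ (G p.2))) ∂(μ.prod μ) := by
    intro v
    rw [integral_const_mul]
    congr 1
    unfold expTransform
    rw [← integral_conj, ← integral_prod_mul]
    refine integral_congr_ae (Eventually.of_forall fun p => ?_)
    simp only [map_mul, conj_cexp_two_pi_mul_I, inner_sub_right]
    have : cexp (2 * Real.pi * ((⟪v, θ p.1⟫ - ⟪v, θ p.2⟫ : ℝ) : ℂ) * I)
        = cexp (2 * Real.pi * (⟪v, θ p.1⟫ : ℝ) * I)
          * cexp (2 * Real.pi * ((-⟪v, θ p.2⟫ : ℝ) : ℂ) * I) := by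
      rw [← Complex.exp_add]; congr 1; push_cast; ring
    rw [this]; ring
  simp_rw [e1]
  rw [integral_integral_swap]
  · refine integral_congr_ae (Eventually.of_forall fun p => ?_)
    simp only
    rw [← integral_cexp_neg_mul_sq_norm_eq_gaussKernel hδ, ← integral_const_mul]
    refine integral_congr_ae (Eventually.of_forall fun v => ?_)
    simp only; ring
  · have := (integrable_cexp_neg_mul_sq_norm (V := V) hδ).mul_prod hGG
    refine this.mono ?_ ?_
    · have hm : AEStronglyMeasurable
          (fun p : V × (X × X) => cexp (2 * Real.pi * ⟪p.1, θ p.2.1 - θ p.2.2⟫ * I))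
          (volume.prod (μ.prod μ)) := by
        refine Measurable.aestronglyMeasurable ?_
        fun_prop
      refine (this.1.mul hm).congr (Eventually.of_forall fun p => ?_)
      simp [Function.uncurry]; ring
    · refine Eventually.of_forall fun p => ?_
      simp only [Function.uncurry, norm_mul, norm_cexp_two_pi_mul_I, one_mul]
      exact le_rfl

theorem lintegral_gaussian_expTransform_le (hθ : Measurable θ) (hG : Integrable G μ) {δ : ℝ}
    (hδ : 0 < δ) {M : ℝ≥0∞}
    (hM : ∀ w : V, ∫⁻ x, ENNReal.ofReal (gaussKernel δ (w - θ x)) ∂μ ≤ M) :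
    ∫⁻ v, ENNReal.ofReal (Real.exp (-δ * ‖v‖ ^ 2)) * ‖expTransform μ θ G v‖ₑ ^ 2
      ≤ M * ∫⁻ x, ‖G x‖ₑ ^ 2 ∂μ := by
  set T := expTransform μ θ G with hT
  have hTm := aestronglyMeasurable_expTransform hθ hG.1
  have hreal : ∀ v, cexp (-(δ : ℂ) * (‖v‖ : ℂ) ^ 2) * (T v * starRingEnd ℂ (T v))
      = ((Real.exp (-δ * ‖v‖ ^ 2) * ‖T v‖ ^ 2 : ℝ) : ℂ) := by
    intro v
    rw [Complex.mul_conj, Complex.normSq_eq_norm_sq]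
    push_cast; rfl
  have hInt : Integrable (fun v => Real.exp (-δ * ‖v‖ ^ 2) * ‖T v‖ ^ 2) := by
    have h1 := (integrable_cexp_neg_mul_sq_norm (V := V) hδ).norm
    simp only [norm_cexp_neg_mul_sq_norm] at h1
    refine h1.mul_bdd (c := (∫ x, ‖G x‖ ∂μ) ^ 2) (hTm.norm.pow 2) ?_
    refine Eventually.of_forall fun v => ?_
    rw [norm_pow, norm_norm]
    gcongr
    exact norm_expTransform_le v
  have h1 : ∫⁻ v, ENNReal.ofReal (Real.exp (-δ * ‖v‖ ^ 2)) * ‖T v‖ₑ ^ 2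
      = ‖∫ p : X × X, G p.1 * starRingEnd ℂ (G p.2) * gaussKernel δ (θ p.1 - θ p.2)
          ∂(μ.prod μ)‖ₑ := by
    rw [← integral_gaussian_expTransform hθ hG hδ, ← hT]
    simp_rw [hreal]
    rw [integral_complex_ofReal]
    have : ‖((∫ v, Real.exp (-δ * ‖v‖ ^ 2) * ‖T v‖ ^ 2 : ℝ) : ℂ)‖ₑ
        = ENNReal.ofReal (∫ v, Real.exp (-δ * ‖v‖ ^ 2) * ‖T v‖ ^ 2) := by
      rw [← ofReal_norm, Complex.norm_real, Real.norm_of_nonneg]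
      exact integral_nonneg fun v => by positivity
    rw [this, ofReal_integral_eq_lintegral_ofReal hInt
      (Eventually.of_forall fun v => by positivity)]
    refine lintegral_congr fun v => ?_
    rw [ENNReal.ofReal_mul (by positivity), ENNReal.ofReal_pow (norm_nonneg _),
      ofReal_norm]
  rw [h1]
  refine (enorm_integral_le_lintegral_enorm _).trans ?_
  refine (lintegral_prod_le _).trans ?_
  refine le_trans (le_of_eq ?_) (lintegral_schur
    (k := fun x y => ENNReal.ofReal (gaussKernel δ (θ x - θ y))) ?_ ?_ (fun x => hM (θ x))
    hG.1.enorm)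
  · refine lintegral_congr fun x => lintegral_congr fun y => ?_
    rw [enorm_mul, enorm_mul]
    congr 1
    · rw [RCLike.enorm_conj]
    · rw [← ofReal_norm, Complex.norm_real,
        Real.norm_of_nonneg (gaussKernel_nonneg hδ _)]
  · exact ((measurable_gaussKernel δ).comp
      ((hθ.comp measurable_fst).sub (hθ.comp measurable_snd))).ennreal_ofReal
  · intro x y
    rw [← gaussKernel_neg, neg_sub]

/-- A Bessel-type inequality for exponential integrals, whose constant is controlled by the
density of the push-forward measure of `θ`. -/
theorem lintegral_expTransform_sq_le (hθ : Measurable θ) (hG : Integrable G μ) {M : ℝ≥0∞}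
    (hM : ∀ δ : ℝ, 0 < δ →
      ∀ w : V, ∫⁻ x, ENNReal.ofReal (gaussKernel δ (w - θ x)) ∂μ ≤ M) :
    ∫⁻ v, ‖expTransform μ θ G v‖ₑ ^ 2 ≤ M * ∫⁻ x, ‖G x‖ₑ ^ 2 ∂μ := by
  set T := expTransform μ θ G with hT
  have hTm := aestronglyMeasurable_expTransform hθ hG.1
  let δ : ℕ → ℝ := fun k => 1 / ((k : ℝ) + 1)
  have hδ : ∀ k, 0 < δ k := fun k => by positivity
  have hlim : ∀ v : V, Tendsto (fun k => ENNReal.ofReal (Real.exp (-δ k * ‖v‖ ^ 2)) *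
      ‖T v‖ₑ ^ 2) atTop (𝓝 (‖T v‖ₑ ^ 2)) := by
    intro v
    have h0 : Tendsto δ atTop (𝓝 0) := tendsto_one_div_add_atTop_nhds_zero_nat
    have h1 : Tendsto (fun k => Real.exp (-δ k * ‖v‖ ^ 2)) atTop (𝓝 1) := by
      have : Tendsto (fun k => Real.exp (-δ k * ‖v‖ ^ 2)) atTop
          (𝓝 (Real.exp (-0 * ‖v‖ ^ 2))) :=
        (Real.continuous_exp.tendsto _).comp ((h0.neg).mul_const _)
      simpa using this
    have h2 := ENNReal.Tendsto.mul_const (b := ‖T v‖ₑ ^ 2) (ENNReal.tendsto_ofReal h1)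
      (Or.inr (by finiteness))
    simpa using h2
  calc ∫⁻ v, ‖T v‖ₑ ^ 2
      = ∫⁻ v, liminf (fun k => ENNReal.ofReal (Real.exp (-δ k * ‖v‖ ^ 2)) * ‖T v‖ₑ ^ 2) atTop :=
        lintegral_congr fun v => (hlim v).liminf_eq.symm
    _ ≤ liminf (fun k => ∫⁻ v, ENNReal.ofReal (Real.exp (-δ k * ‖v‖ ^ 2)) * ‖T v‖ₑ ^ 2) atTop := by
        refine lintegral_liminf_le' fun k => ?_
        refine AEMeasurable.mul ?_ (hTm.enorm.pow_const 2)
        fun_prop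
    _ ≤ liminf (fun _ : ℕ => M * ∫⁻ x, ‖G x‖ₑ ^ 2 ∂μ) atTop := by
        refine liminf_le_liminf (Eventually.of_forall fun k => ?_)
        exact lintegral_gaussian_expTransform_le hθ hG (hδ k) (hM _ (hδ k))
    _ = M * ∫⁻ x, ‖G x‖ₑ ^ 2 ∂μ := by simp

end

theorem fourierInv_eq_expTransform (f : V → ℂ) :
    𝓕⁻ f = expTransform volume (fun x : V => x) f := by
  ext v
  rw [Real.fourierInv_eq']
  unfold expTransform
  refine integral_congr_ae (Eventually.of_forall fun x => ?_)
  simp only [smul_eq_mul, real_inner_comm]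
  push_cast; rfl

theorem lintegral_fourierInv_sq_le {f : V → ℂ} (hf : Integrable f) :
    ∫⁻ v, ‖𝓕⁻ f v‖ₑ ^ 2 ≤ ∫⁻ x, ‖f x‖ₑ ^ 2 := by
  rw [fourierInv_eq_expTransform]
  simpa using lintegral_expTransform_sq_le (M := 1) (θ := fun x : V => x) measurable_id hf
    (fun δ hδ w => (lintegral_gaussKernel_sub hδ w).le)

theorem lintegral_fourier_sq_le {f : V → ℂ} (hf : Integrable f) :
    ∫⁻ v, ‖𝓕 f v‖ₑ ^ 2 ≤ ∫⁻ x, ‖f x‖ₑ ^ 2 := by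
  refine le_trans (le_of_eq ?_) (lintegral_fourierInv_sq_le hf)
  rw [← lintegral_neg_eq_self (fun v => ‖𝓕⁻ f v‖ₑ ^ 2)]
  simp [Real.fourierInv_eq_fourier_neg]

end GaussianBessel

section Smoothing

theorem lintegral_comp_le_of_le_abs_deriv {S : Set ℝ} (hS : MeasurableSet S) {h h' : ℝ → ℝ}
    (hd : ∀ ρ ∈ S, HasDerivWithinAt h (h' ρ) S ρ) (hinj : Set.InjOn h S) {c : ℝ} (hc : 0 < c)
    (hle : ∀ ρ ∈ S, c ≤ |h' ρ|) (k : ℝ → ℝ≥0∞) :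
    ∫⁻ ρ in S, k (h ρ) ≤ ENNReal.ofReal c⁻¹ * ∫⁻ x, k x := by
  have h1 := lintegral_image_eq_lintegral_abs_deriv_mul hS hd hinj k
  have h2 : ENNReal.ofReal c * ∫⁻ ρ in S, k (h ρ) ≤ ∫⁻ x, k x := by
    rw [← lintegral_const_mul' _ _ ENNReal.ofReal_ne_top]
    calc ∫⁻ ρ in S, ENNReal.ofReal c * k (h ρ)
        ≤ ∫⁻ ρ in S, ENNReal.ofReal |h' ρ| * k (h ρ) := by
          refine setLIntegral_mono' hS fun ρ hρ => ?_
          gcongr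
          exact hle ρ hρ
      _ = ∫⁻ x in h '' S, k x := h1.symm
      _ ≤ ∫⁻ x, k x := setLIntegral_le_lintegral _ _
  calc ∫⁻ ρ in S, k (h ρ) = ENNReal.ofReal c⁻¹ * (ENNReal.ofReal c * ∫⁻ ρ in S, k (h ρ)) := by
        rw [← mul_assoc, ← ENNReal.ofReal_mul (by positivity), inv_mul_cancel₀ hc.ne']
        simp
    _ ≤ _ := by gcongr

/-- Change of variables for a quadratic phase, away from its critical point. -/
theorem lintegral_quadratic_le (a b c : ℝ) {κ : ℝ} (hκ : 0 < κ) (k : ℝ → ℝ≥0∞) :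
    ∫⁻ ρ in {ρ | κ ≤ |a * ρ + b|}, k (-(a * ρ ^ 2 + 2 * b * ρ + c) / (2 * Real.pi))
      ≤ ENNReal.ofReal (2 * Real.pi / κ) * ∫⁻ x, k x := by
  set h : ℝ → ℝ := fun ρ => -(a * ρ ^ 2 + 2 * b * ρ + c) / (2 * Real.pi) with hh
  have hd : ∀ ρ, HasDerivAt h (-(a * ρ + b) / Real.pi) ρ := by
    intro ρ
    have h2 : HasDerivAt (fun ρ : ℝ => a * ρ ^ 2 + 2 * b * ρ + c) (a * (2 * ρ) + 2 * b) ρ :=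
      ((((hasDerivAt_pow 2 ρ).const_mul a).fun_add
        ((hasDerivAt_id' ρ).const_mul (2 * b))).add_const c).congr_deriv (by norm_num)
    exact (h2.fun_neg.div_const (2 * Real.pi)).congr_deriv (by field_simp)
  have key : ∀ S : Set ℝ, MeasurableSet S → (∀ ρ ∈ S, κ ≤ |a * ρ + b|) →
      (∀ ρ ∈ S, ∀ ρ' ∈ S, (a * ρ + b) + (a * ρ' + b) ≠ 0) →
      ∫⁻ ρ in S, k (h ρ) ≤ ENNReal.ofReal (Real.pi / κ) * ∫⁻ x, k x := by
    intro S hS h1 h2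
    have := lintegral_comp_le_of_le_abs_deriv hS (fun ρ _ => (hd ρ).hasDerivWithinAt)
      (c := κ / Real.pi) ?_ (by positivity) ?_ k
    · simpa using this
    · intro ρ hρ ρ' hρ' heq
      have hpi := Real.pi_pos
      simp only [hh] at heq
      field_simp at heq
      have h3 : (ρ - ρ') * ((a * ρ + b) + (a * ρ' + b)) = 0 := by linarith
      rcases mul_eq_zero.1 h3 with h4 | h4
      · linarith
      · exact absurd h4 (h2 ρ hρ ρ' hρ')
    · intro ρ hρ
      rw [abs_div, abs_neg, abs_of_pos Real.pi_pos]
      gcongr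
      exact h1 ρ hρ
  have hu : {ρ | κ ≤ |a * ρ + b|} = {ρ | κ ≤ a * ρ + b} ∪ {ρ | a * ρ + b ≤ -κ} := by
    ext ρ
    simp only [Set.mem_ofPred_eq, Set.mem_union, le_abs]
    constructor <;> rintro (h | h) <;> [left; right; left; right] <;> linarith
  rw [hu]
  refine (lintegral_union_le _ _ _).trans ?_
  have e : ENNReal.ofReal (2 * Real.pi / κ)
      = ENNReal.ofReal (Real.pi / κ) + ENNReal.ofReal (Real.pi / κ) := by
    rw [← ENNReal.ofReal_add (by positivity) (by positivity)]
    congr 1; ring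
  rw [e, add_mul]
  refine add_le_add (key _ ?_ ?_ ?_) (key _ ?_ ?_ ?_)
  · exact measurableSet_le (by fun_prop) (by fun_prop)
  · intro ρ hρ; exact (show κ ≤ a * ρ + b from hρ).trans (le_abs_self _)
  · intro ρ hρ ρ' hρ'; simp only [Set.mem_ofPred_eq] at hρ hρ'; linarith
  · exact measurableSet_le (by fun_prop) (by fun_prop)
  · intro ρ hρ; simp only [Set.mem_ofPred_eq] at hρ; exact le_abs.2 (Or.inr (by linarith))
  · intro ρ hρ ρ' hρ'; simp only [Set.mem_ofPred_eq] at hρ hρ'; linarith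

variable {n : ℕ}

theorem inner_of_mem_hyperplane {e : Eucl n} (v : hyperplane e) : ⟪e, (v : Eucl n)⟫ = 0 :=
  Submodule.mem_orthogonal_singleton_iff_inner_right.1 v.2

/-- The isometric identification of `ℝ × P_e` with `ℝⁿ`. -/
def hyperplaneEquiv (e : Eucl n) (he : ‖e‖ = 1) : WithLp 2 (ℝ × hyperplane e) ≃ₗᵢ[ℝ] Eucl n :=
  LinearIsometryEquiv.ofSurjective
    { toFun := fun p => p.fst • e + (p.snd : Eucl n)
      map_add' := fun p q => by simp [add_smul]; abel
      map_smul' := fun c p => by simp [mul_smul]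
      norm_map' := fun p => by
        have h1 : ‖p.fst • e + (p.snd : Eucl n)‖ ^ 2 = ‖p‖ ^ 2 := by
          rw [norm_add_sq_real, WithLp.prod_norm_sq_eq_of_L2, norm_smul, he, inner_smul_left,
            inner_of_mem_hyperplane]
          simp
        exact (sq_eq_sq₀ (norm_nonneg _) (norm_nonneg _)).1 h1 }
    (by
      intro ξ
      have hmem : ξ - ⟪e, ξ⟫ • e ∈ hyperplane e := by
        refine Submodule.mem_orthogonal_singleton_iff_inner_right.2 ?_
        rw [inner_sub_right, inner_smul_right, real_inner_self_eq_norm_sq, he]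
        ring
      exact ⟨WithLp.toLp 2 (⟪e, ξ⟫, ⟨_, hmem⟩), by simp⟩)

theorem measurePreserving_hyperplane {e : Eucl n} (he : ‖e‖ = 1) :
    MeasurePreserving (fun p : ℝ × hyperplane e => p.1 • e + (p.2 : Eucl n)) :=
  (hyperplaneEquiv e he).measurePreserving.comp (WithLp.volume_preserving_toLp ℝ (hyperplane e))

theorem measurableEmbedding_hyperplane {e : Eucl n} (he : ‖e‖ = 1) :
    MeasurableEmbedding (fun p : ℝ × hyperplane e => p.1 • e + (p.2 : Eucl n)) :=
  (hyperplaneEquiv e he).toHomeomorph.measurableEmbedding.comp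
    (MeasurableEquiv.toLp 2 (ℝ × hyperplane e)).measurableEmbedding

theorem measurable_quadSym (ε : Fin n → ℝ) : Measurable (quadSym ε) := by
  unfold quadSym; fun_prop

theorem continuous_quadSym (ε : Fin n → ℝ) : Continuous (quadSym ε) := by
  unfold quadSym; fun_prop

theorem quadSym_smul_add (ε : Fin n → ℝ) (e η : Eucl n) (ρ : ℝ) :
    quadSym ε (ρ • e + η)
      = ⟪e, epm ε e⟫ * ρ ^ 2 + 2 * ⟪η, epm ε e⟫ * ρ + quadSym ε η := by
  simp only [quadSym, PiLp.inner_apply, epm, Finset.sum_mul, Finset.mul_sum,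
    ← Finset.sum_add_distrib]
  refine Finset.sum_congr rfl fun i _ => ?_
  simp
  ring

theorem gaussKernel_prod {P : Type*} [NormedAddCommGroup P] [InnerProductSpace ℝ P]
    [FiniteDimensional ℝ P] {δ : ℝ} (hδ : 0 < δ) (w : WithLp 2 (ℝ × P)) :
    gaussKernel δ w = gaussKernel δ w.fst * gaussKernel δ w.snd := by
  unfold gaussKernel
  have hf : Module.finrank ℝ (WithLp 2 (ℝ × P)) = 1 + Module.finrank ℝ P := by
    rw [(WithLp.linearEquiv 2 ℝ (ℝ × P)).finrank_eq]
    simp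
  rw [WithLp.prod_norm_sq_eq_of_L2, hf, mul_mul_mul_comm, ← Real.exp_add,
    ← Real.rpow_add (by positivity)]
  congr 2
  · simp; ring
  · ring

theorem fourierInv_hyperplane {e : Eucl n} (he : ‖e‖ = 1) (φ : Eucl n → ℂ) (r : ℝ)
    (v : hyperplane e) :
    𝓕⁻ φ (r • e + (v : Eucl n))
      = ∫ p : ℝ × hyperplane e, cexp (2 * Real.pi * ⟪v, p.2⟫ * I)
          * (cexp (2 * Real.pi * (r * p.1 : ℝ) * I) * φ (p.1 • e + (p.2 : Eucl n))) := by
  rw [Real.fourierInv_eq', ← (measurePreserving_hyperplane he).integral_comp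
    (measurableEmbedding_hyperplane he)]
  refine integral_congr_ae (Eventually.of_forall fun p => ?_)
  have h1 : ⟪p.1 • e + (p.2 : Eucl n), r • e + (v : Eucl n)⟫ = r * p.1 + ⟪v, p.2⟫ := by
    simp only [inner_add_left, inner_add_right, inner_smul_left, inner_smul_right,
      inner_of_mem_hyperplane, real_inner_self_eq_norm_sq, he]
    rw [real_inner_comm e, inner_of_mem_hyperplane, real_inner_comm (v : Eucl n)]
    simp
  simp only [h1, smul_eq_mul]
  rw [← mul_assoc, ← Complex.exp_add]
  congr 2
  push_cast; ring

/-- Local smoothing for the free evolution: on frequencies with `κ ≤ |⟪ξ, e_±⟫|` the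
restriction of the evolution to the hyperplane `re + P_e` is square integrable. -/
theorem lintegral_hyperplane_evolution_le (ε : Fin n → ℝ) {e : Eucl n} (he : ‖e‖ = 1) {κ : ℝ}
    (hκ : 0 < κ) {φ : Eucl n → ℂ} (hφ : Integrable φ)
    (hsupp : ∀ ξ, |⟪ξ, epm ε e⟫| < κ → φ ξ = 0) (r : ℝ) :
    ∫⁻ p : ℝ × hyperplane e,
        ‖𝓕⁻ (fun ξ => cexp (-I * p.1 * quadSym ε ξ) * φ ξ) (r • e + (p.2 : Eucl n))‖ₑ ^ 2
      ≤ ENNReal.ofReal (2 * Real.pi / κ) * ∫⁻ ξ, ‖φ ξ‖ₑ ^ 2 := by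
  set Φ : ℝ × hyperplane e → Eucl n := fun p => p.1 • e + (p.2 : Eucl n) with hΦ
  have hmp := measurePreserving_hyperplane he
  have hΦm : Measurable Φ := hmp.measurable
  set S : Set (ℝ × hyperplane e) := {p | κ ≤ |⟪Φ p, epm ε e⟫|} with hS
  have hSm : MeasurableSet S := measurableSet_le measurable_const (by fun_prop)
  set θ : ℝ × hyperplane e → WithLp 2 (ℝ × hyperplane e) := fun p =>
    WithLp.toLp 2 (-quadSym ε (Φ p) / (2 * Real.pi), p.2) with hθ
  have hθm : Measurable θ := by
    refine (WithLp.measurable_toLp 2 _).comp ?_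
    exact ((((measurable_quadSym ε).comp hΦm).neg).div_const _).prodMk measurable_snd
  set G : ℝ × hyperplane e → ℂ := fun p => cexp (2 * Real.pi * (r * p.1 : ℝ) * I) * φ (Φ p)
    with hG
  have hφΦ : Integrable (fun p => φ (Φ p)) :=
    (hmp.integrable_comp_emb (measurableEmbedding_hyperplane he)).2 hφ
  have hGint : Integrable G := by
    refine hφΦ.bdd_mul (c := 1) ?_ ?_
    · exact Measurable.aestronglyMeasurable (by fun_prop)
    · exact Eventually.of_forall fun p => (norm_cexp_two_pi_mul_I _).le
  have hT : ∀ p : ℝ × hyperplane e,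
      𝓕⁻ (fun ξ => cexp (-I * p.1 * quadSym ε ξ) * φ ξ) (r • e + (p.2 : Eucl n))
        = expTransform (volume.restrict S) θ G (WithLp.toLp 2 p) := by
    intro p
    rw [fourierInv_hyperplane he]
    unfold expTransform
    rw [setIntegral_eq_integral_of_forall_compl_eq_zero]
    · refine integral_congr_ae (Eventually.of_forall fun x => ?_)
      simp only [hθ, hG, WithLp.prod_inner_apply, hΦ]
      rw [mul_left_comm (cexp (2 * Real.pi * (r * x.1 : ℝ) * I)), ← mul_assoc, ← Complex.exp_add]
      congr 2
      simp
      field_simp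
      ring
    · intro x hx
      have : φ (Φ x) = 0 := hsupp _ (not_le.1 hx)
      simp [hG, this]
  have hM : ∀ δ : ℝ, 0 < δ → ∀ w : WithLp 2 (ℝ × hyperplane e),
      ∫⁻ x, ENNReal.ofReal (gaussKernel δ (w - θ x)) ∂(volume.restrict S)
        ≤ ENNReal.ofReal (2 * Real.pi / κ) := by
    intro δ hδ w
    rw [← lintegral_indicator hSm]
    have hmeas : Measurable (S.indicator fun x => ENNReal.ofReal (gaussKernel δ (w - θ x))) :=
      (((measurable_gaussKernel δ).comp (measurable_const.sub hθm)).ennreal_ofReal).indicator hSm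
    rw [Measure.volume_eq_prod, lintegral_prod_symm _ hmeas.aemeasurable]
    have hin : ∀ η : hyperplane e,
        ∫⁻ ρ : ℝ, S.indicator (fun x => ENNReal.ofReal (gaussKernel δ (w - θ x))) (ρ, η)
          ≤ ENNReal.ofReal (gaussKernel δ (w.snd - η)) * ENNReal.ofReal (2 * Real.pi / κ) := by
      intro η
      have h1 : ∀ ρ : ℝ,
          S.indicator (fun x => ENNReal.ofReal (gaussKernel δ (w - θ x))) (ρ, η)
          = ENNReal.ofReal (gaussKernel δ (w.snd - η)) *
            {ρ : ℝ | κ ≤ |⟪e, epm ε e⟫ * ρ + ⟪(η : Eucl n), epm ε e⟫|}.indicator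
              (fun ρ => ENNReal.ofReal (gaussKernel δ (w.fst -
                (-(⟪e, epm ε e⟫ * ρ ^ 2 + 2 * ⟪(η : Eucl n), epm ε e⟫ * ρ + quadSym ε η)
                  / (2 * Real.pi))))) ρ := by
        intro ρ
        have h2 : (ρ, η) ∈ S ↔ ρ ∈ {ρ : ℝ | κ ≤ |⟪e, epm ε e⟫ * ρ + ⟪(η : Eucl n), epm ε e⟫|} := by
          simp only [hS, hΦ, Set.mem_ofPred_eq, inner_add_left, real_inner_smul_left,
            mul_comm ρ]
        by_cases h3 : (ρ, η) ∈ S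
        · rw [Set.indicator_of_mem h3, Set.indicator_of_mem (h2.1 h3), gaussKernel_prod hδ,
            mul_comm, ENNReal.ofReal_mul (gaussKernel_nonneg hδ _)]
          simp only [hθ, hΦ, quadSym_smul_add]
          rfl
        · rw [Set.indicator_of_notMem h3, Set.indicator_of_notMem (fun h => h3 (h2.2 h)),
            mul_zero]
      simp_rw [h1]
      rw [lintegral_const_mul' _ _ ENNReal.ofReal_ne_top, lintegral_indicator
        (measurableSet_le measurable_const (by fun_prop))]
      gcongr
      refine (lintegral_quadratic_le _ _ _ hκ
        (fun x => ENNReal.ofReal (gaussKernel δ (w.fst - x)))).trans ?_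
      rw [lintegral_gaussKernel_sub hδ, mul_one]
    refine (lintegral_mono hin).trans ?_
    rw [lintegral_mul_const' _ _ ENNReal.ofReal_ne_top, lintegral_gaussKernel_sub hδ, one_mul]
  have h1 := lintegral_expTransform_sq_le hθm hGint.restrict hM
  simp_rw [hT]
  have h2 := (WithLp.volume_preserving_toLp ℝ (hyperplane e)).lintegral_comp_emb
    (MeasurableEquiv.toLp 2 (ℝ × hyperplane e)).measurableEmbedding
    (fun v => ‖expTransform (volume.restrict S) θ G v‖ₑ ^ 2)
  rw [h2]
  refine h1.trans ?_
  gcongr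
  refine (setLIntegral_le_lintegral _ _).trans (le_of_eq ?_)
  rw [← hmp.lintegral_comp_emb (measurableEmbedding_hyperplane he)]
  refine lintegral_congr fun p => ?_
  rw [hG]
  simp only [enorm_mul]
  rw [← ofReal_norm (cexp _), norm_cexp_two_pi_mul_I]
  simp [hΦ]

/-- Trace estimate on a hyperplane for functions with compactly supported Fourier transform. -/
theorem lintegral_hyperplane_fourierInv_le {e : Eucl n} (he : ‖e‖ = 1) {R : ℝ}
    {φ : Eucl n → ℂ} (hφ : Integrable φ) (hsupp : ∀ ξ, R < ‖ξ‖ → φ ξ = 0) (r : ℝ) :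
    ∫⁻ v : hyperplane e, ‖𝓕⁻ φ (r • e + (v : Eucl n))‖ₑ ^ 2
      ≤ ENNReal.ofReal (2 * R) * ∫⁻ ξ, ‖φ ξ‖ₑ ^ 2 := by
  set Φ : ℝ × hyperplane e → Eucl n := fun p => p.1 • e + (p.2 : Eucl n) with hΦ
  have hmp := measurePreserving_hyperplane he
  set S : Set (ℝ × hyperplane e) := {p | p.1 ∈ Set.Icc (-R) R} with hS
  have hSm : MeasurableSet S := measurable_fst measurableSet_Icc
  set G : ℝ × hyperplane e → ℂ := fun p => cexp (2 * Real.pi * (r * p.1 : ℝ) * I) * φ (Φ p)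
    with hG
  have hφΦ : Integrable (fun p => φ (Φ p)) :=
    (hmp.integrable_comp_emb (measurableEmbedding_hyperplane he)).2 hφ
  have hGint : Integrable G := by
    refine hφΦ.bdd_mul (c := 1) ?_ ?_
    · exact Measurable.aestronglyMeasurable (by fun_prop)
    · exact Eventually.of_forall fun p => (norm_cexp_two_pi_mul_I _).le
  have hT : ∀ v : hyperplane e, 𝓕⁻ φ (r • e + (v : Eucl n))
        = expTransform (volume.restrict S) (fun p => p.2) G v := by
    intro v
    rw [fourierInv_hyperplane he]
    unfold expTransform
    rw [setIntegral_eq_integral_of_forall_compl_eq_zero]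
    intro x hx
    have h1 : R < ‖Φ x‖ := by
      have h2 : R < |x.1| := by
        by_contra hcon
        exact hx (abs_le.1 (not_lt.1 hcon))
      refine h2.trans_le ?_
      have h3 : ⟪e, Φ x⟫ = x.1 := by
        simp [hΦ, inner_add_right, inner_smul_right, inner_of_mem_hyperplane, he]
      rw [← h3]
      simpa [he] using abs_real_inner_le_norm e (Φ x)
    have : φ (Φ x) = 0 := hsupp _ h1
    simp [hG, this]
  have hM : ∀ δ : ℝ, 0 < δ → ∀ w : hyperplane e,
      ∫⁻ x, ENNReal.ofReal (gaussKernel δ (w - x.2)) ∂(volume.restrict S)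
        ≤ ENNReal.ofReal (2 * R) := by
    intro δ hδ w
    have hSprod : S = Set.Icc (-R) R ×ˢ Set.univ := by ext; simp [hS]
    rw [hSprod, Measure.volume_eq_prod, ← Measure.prod_restrict, Measure.restrict_univ,
      lintegral_prod_symm _ (by
        exact (((measurable_gaussKernel δ).comp (by fun_prop)).ennreal_ofReal).aemeasurable)]
    simp only [lintegral_const, Measure.restrict_apply_univ, Real.volume_Icc]
    rw [lintegral_mul_const' _ _ ENNReal.ofReal_ne_top, lintegral_gaussKernel_sub hδ, one_mul]
    exact ENNReal.ofReal_le_ofReal (by linarith)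
  have h1 := lintegral_expTransform_sq_le measurable_snd hGint.restrict hM
  simp_rw [hT]
  refine h1.trans ?_
  gcongr
  refine (setLIntegral_le_lintegral _ _).trans (le_of_eq ?_)
  rw [← hmp.lintegral_comp_emb (measurableEmbedding_hyperplane he)]
  refine lintegral_congr fun p => ?_
  rw [hG]
  simp only [enorm_mul]
  rw [← ofReal_norm (cexp _), norm_cexp_two_pi_mul_I]
  simp [hΦ]

end Smoothing

section HardyLittlewoodSobolev

theorem lintegral_comp_abs_le (f : ℝ → ℝ≥0∞) (hf : Measurable f) :
    ∫⁻ x, f |x| ≤ 2 * ∫⁻ x in Set.Ioi 0, f x := by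
  have h0 : ∫⁻ x in Set.Ioi (0 : ℝ), f |x| = ∫⁻ x in Set.Ioi 0, f x :=
    setLIntegral_congr_fun measurableSet_Ioi fun x hx => by
      rw [abs_of_pos (show 0 < x from hx)]
  have h1 : ∫⁻ x in Set.Iic (0 : ℝ), f |x| = ∫⁻ x in Set.Ioi (0 : ℝ), f |x| := by
    have h2 := (Measure.measurePreserving_neg (volume : Measure ℝ)).setLIntegral_comp_preimage
      (measurableSet_Iic (a := (0 : ℝ))) (f := fun x => f |x|) (by fun_prop)
    rw [← h2]
    simp only [abs_neg]
    have h3 : (Neg.neg ⁻¹' Set.Iic 0 : Set ℝ) = Set.Ici 0 := by ext; simp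
    rw [h3]
    exact setLIntegral_congr Ioi_ae_eq_Ici.symm
  rw [← lintegral_add_compl _ (measurableSet_Iic (a := (0 : ℝ))), Set.compl_Iic, h1, h0, two_mul]

theorem lintegral_rpow_near_le {α : ℝ} (hα1 : α < 1) {b : ℝ} (hb : 0 < b) :
    ∫⁻ u : ℝ, {u : ℝ | |u| * b ≤ 1}.indicator (fun u => ENNReal.ofReal (|u| ^ (-α))) u
      ≤ ENNReal.ofReal (2 / (1 - α) * b ^ (α - 1)) := by
  have hm : Measurable ((Set.Iic (1 / b)).indicator fun u : ℝ => ENNReal.ofReal (u ^ (-α))) :=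
    (by fun_prop : Measurable fun u : ℝ => ENNReal.ofReal (u ^ (-α))).indicator measurableSet_Iic
  have h1 : ∀ u : ℝ, {u : ℝ | |u| * b ≤ 1}.indicator (fun u => ENNReal.ofReal (|u| ^ (-α))) u
      = (Set.Iic (1 / b)).indicator (fun u : ℝ => ENNReal.ofReal (u ^ (-α))) |u| := by
    intro u
    by_cases h : u ∈ {u : ℝ | |u| * b ≤ 1}
    · rw [Set.indicator_of_mem h, Set.indicator_of_mem]
      exact (le_div_iff₀ hb).2 h
    · rw [Set.indicator_of_notMem h, Set.indicator_of_notMem]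
      exact fun h' => h ((le_div_iff₀ hb).1 h')
  simp_rw [h1]
  refine (lintegral_comp_abs_le _ hm).trans ?_
  rw [lintegral_indicator measurableSet_Iic, Measure.restrict_restrict measurableSet_Iic,
    Set.inter_comm, Set.Ioi_inter_Iic]
  have hInt : IntegrableOn (fun u : ℝ => u ^ (-α)) (Set.Ioc 0 (1 / b)) :=
    (intervalIntegrable_iff_integrableOn_Ioc_of_le (by positivity)).1
      (intervalIntegral.intervalIntegrable_rpow' (by linarith))
  rw [← ofReal_integral_eq_lintegral_ofReal hInt
    ((ae_restrict_iff' measurableSet_Ioc).2 (Eventually.of_forall fun u hu =>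
      Real.rpow_nonneg hu.1.le _)), ← intervalIntegral.integral_of_le (by positivity),
    integral_rpow (Or.inl (by linarith)), Real.zero_rpow (by linarith)]
  rw [show (2 : ℝ≥0∞) = ENNReal.ofReal 2 by simp, ← ENNReal.ofReal_mul (by norm_num)]
  refine ENNReal.ofReal_le_ofReal (le_of_eq ?_)
  rw [one_div, Real.inv_rpow hb.le, ← Real.rpow_neg hb.le, show -(-α + 1) = α - 1 by ring,
    show -α + 1 = 1 - α by ring]
  ring

theorem lintegral_rpow_far_le {b : ℝ} (hb : 0 < b) :
    ∫⁻ u : ℝ, {u : ℝ | 1 < |u| * b}.indicator (fun u => ENNReal.ofReal (|u| ^ (-2 : ℝ))) u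
      ≤ ENNReal.ofReal (2 * b) := by
  have hm : Measurable ((Set.Ioi (1 / b)).indicator
      fun u : ℝ => ENNReal.ofReal (u ^ (-2 : ℝ))) :=
    (by fun_prop : Measurable fun u : ℝ => ENNReal.ofReal (u ^ (-2 : ℝ))).indicator
      measurableSet_Ioi
  have h1 : ∀ u : ℝ, {u : ℝ | 1 < |u| * b}.indicator
        (fun u => ENNReal.ofReal (|u| ^ (-2 : ℝ))) u
      = (Set.Ioi (1 / b)).indicator (fun u : ℝ => ENNReal.ofReal (u ^ (-2 : ℝ))) |u| := by
    intro u
    by_cases h : u ∈ {u : ℝ | 1 < |u| * b}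
    · rw [Set.indicator_of_mem h, Set.indicator_of_mem]
      exact (div_lt_iff₀ hb).2 h
    · rw [Set.indicator_of_notMem h, Set.indicator_of_notMem]
      exact fun h' => h ((div_lt_iff₀ hb).1 h')
  simp_rw [h1]
  refine (lintegral_comp_abs_le _ hm).trans ?_
  have hbi : 0 < 1 / b := by positivity
  rw [lintegral_indicator measurableSet_Ioi, Measure.restrict_restrict measurableSet_Ioi,
    Set.inter_eq_left.2 (Set.Ioi_subset_Ioi hbi.le),
    ← ofReal_integral_eq_lintegral_ofReal (integrableOn_Ioi_rpow_of_lt (by norm_num) hbi)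
    ((ae_restrict_iff' measurableSet_Ioi).2 (Eventually.of_forall fun u hu =>
      Real.rpow_nonneg (hbi.trans hu).le _)),
    integral_Ioi_rpow_of_lt (by norm_num) hbi,
    show (2 : ℝ≥0∞) = ENNReal.ofReal 2 by simp, ← ENNReal.ofReal_mul (by norm_num)]
  refine ENNReal.ofReal_le_ofReal (le_of_eq ?_)
  rw [show (-2 + 1 : ℝ) = -1 by norm_num, Real.rpow_neg_one]
  field_simp

/-- The one-dimensional Hardy–Littlewood–Sobolev inequality on the diagonal, in normalized
form. -/
theorem lintegral_hls_le_of_le_one {α : ℝ} (hα0 : 0 < α) (hα1 : α < 1) {a : ℝ → ℝ}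
    (ha : Measurable a) (ha0 : ∀ s, 0 ≤ a s)
    (hA : ∫⁻ s, ENNReal.ofReal (a s ^ (2 / (2 - α))) ≤ 1) :
    ∫⁻ s, ∫⁻ s', ENNReal.ofReal (a s) * ENNReal.ofReal (a s') *
        ENNReal.ofReal (|s' - s| ^ (-α))
      ≤ ENNReal.ofReal (2 / (1 - α)) + 4 := by
  set p : ℝ := 2 / (2 - α) with hp
  have hp1 : 1 < p := by rw [hp, lt_div_iff₀] <;> linarith
  have h2α : 2 - α ≠ 0 := by linarith
  set k : ℝ → ℝ≥0∞ := fun u => ENNReal.ofReal (|u| ^ (-α)) with hk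
  have hkm : Measurable k := by fun_prop
  have hkneg : ∀ u, k (-u) = k u := fun u => by simp [hk]
  have hMS1 : MeasurableSet {x : ℝ × ℝ | |x.2 - x.1| * a x.1 ^ p ≤ 1} :=
    measurableSet_le (by fun_prop) measurable_const
  have hMS2 : MeasurableSet {x : ℝ × ℝ | 1 < |x.2 - x.1| * a x.1 ^ p} :=
    measurableSet_lt measurable_const (by fun_prop)
  set g₁ : ℝ → ℝ → ℝ≥0∞ := fun s s' => ENNReal.ofReal (a s) ^ 2 *
    {u : ℝ | |u| * a s ^ p ≤ 1}.indicator k (s' - s) with hg₁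
  set g₂ : ℝ → ℝ → ℝ≥0∞ := fun s s' => ENNReal.ofReal (a s) * (ENNReal.ofReal (a s') *
    {u : ℝ | 1 < |u| * a s ^ p}.indicator k (s' - s)) with hg₂
  have hg₁m : Measurable (Function.uncurry g₁) := by
    have : Function.uncurry g₁ = fun x : ℝ × ℝ => ENNReal.ofReal (a x.1) ^ 2 *
        {x : ℝ × ℝ | |x.2 - x.1| * a x.1 ^ p ≤ 1}.indicator (fun x => k (x.2 - x.1)) x := by
      ext x; rfl
    rw [this]
    exact Measurable.mul (by fun_prop)
      ((hkm.comp (measurable_snd.sub measurable_fst)).indicator hMS1)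
  have hg₂m : Measurable (Function.uncurry g₂) := by
    have : Function.uncurry g₂ = fun x : ℝ × ℝ => ENNReal.ofReal (a x.1) *
        (ENNReal.ofReal (a x.2) *
        {x : ℝ × ℝ | 1 < |x.2 - x.1| * a x.1 ^ p}.indicator (fun x => k (x.2 - x.1)) x) := by
      ext x; rfl
    rw [this]
    exact Measurable.mul (by fun_prop) (Measurable.mul (by fun_prop)
      ((hkm.comp (measurable_snd.sub measurable_fst)).indicator hMS2))
  have hpt : ∀ s s', ENNReal.ofReal (a s) * ENNReal.ofReal (a s') * k (s' - s)
      ≤ ((g₁ s s' + g₁ s' s) / 2 + g₂ s s') + g₂ s' s := by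
    intro s s'
    have hsw : k (s - s') = k (s' - s) := by rw [← hkneg, neg_sub]
    by_cases h1 : 1 < |s' - s| * a s ^ p
    · refine le_trans (le_of_eq ?_) (le_add_right le_add_self)
      simp only [hg₂]
      rw [Set.indicator_of_mem (show s' - s ∈ {u : ℝ | 1 < |u| * a s ^ p} from h1), mul_assoc]
    by_cases h2 : 1 < |s - s'| * a s' ^ p
    · refine le_trans (le_of_eq ?_) le_add_self
      simp only [hg₂]
      rw [Set.indicator_of_mem (show s - s' ∈ {u : ℝ | 1 < |u| * a s' ^ p} from h2), hsw]
      ring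
    · refine le_trans ?_ (le_add_right (le_add_right le_rfl))
      simp only [hg₁]
      rw [Set.indicator_of_mem (show s' - s ∈ {u : ℝ | |u| * a s ^ p ≤ 1} from not_lt.1 h1),
        Set.indicator_of_mem (show s - s' ∈ {u : ℝ | |u| * a s' ^ p ≤ 1} from not_lt.1 h2),
        hsw, ← add_mul, ENNReal.mul_div_right_comm]
      gcongr
      rw [ENNReal.add_div]
      simpa using ENNReal.young_inequality (ENNReal.ofReal (a s)) (ENNReal.ofReal (a s'))
        Real.HolderConjugate.two_two
  have hI1 : ∫⁻ s, ∫⁻ s', g₁ s s' ≤ ENNReal.ofReal (2 / (1 - α)) := by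
    calc ∫⁻ s, ∫⁻ s', g₁ s s'
        ≤ ∫⁻ s, ENNReal.ofReal (2 / (1 - α)) * ENNReal.ofReal (a s ^ p) := by
          refine lintegral_mono fun s => ?_
          simp only [hg₁]
          rw [lintegral_const_mul' _ _ (by finiteness), lintegral_sub_right_eq_self
            (fun u => {u : ℝ | |u| * a s ^ p ≤ 1}.indicator k u)]
          rcases (ha0 s).eq_or_lt with h0 | h0
          · simp [← h0]
          refine (mul_le_mul_right (lintegral_rpow_near_le hα1
            (Real.rpow_pos_of_pos h0 p)) _).trans (le_of_eq ?_)
          rw [← ENNReal.ofReal_pow h0.le, ← ENNReal.ofReal_mul (by positivity),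
            ← ENNReal.ofReal_mul (div_nonneg (by norm_num) (by linarith)), ← Real.rpow_mul h0.le,
            mul_left_comm, ← Real.rpow_natCast, ← Real.rpow_add h0]
          congr 3
          rw [hp]; push_cast; field_simp; ring
      _ = ENNReal.ofReal (2 / (1 - α)) * ∫⁻ s, ENNReal.ofReal (a s ^ p) :=
          lintegral_const_mul' _ _ (by finiteness)
      _ ≤ ENNReal.ofReal (2 / (1 - α)) * 1 := by gcongr
      _ = _ := mul_one _
  have hI2 : ∫⁻ s, ∫⁻ s', g₂ s s' ≤ 2 := by
    have hpq : p.HolderConjugate (p / (p - 1)) := Real.HolderConjugate.conjExponent hp1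
    calc ∫⁻ s, ∫⁻ s', g₂ s s'
        ≤ ∫⁻ s, 2 * ENNReal.ofReal (a s ^ p) := by
          refine lintegral_mono fun s => ?_
          simp only [hg₂]
          rw [lintegral_const_mul' _ _ (by finiteness)]
          rcases (ha0 s).eq_or_lt with h0 | h0
          · simp [← h0]
          have hS : MeasurableSet {u : ℝ | 1 < |u| * a s ^ p} :=
            measurableSet_lt measurable_const (by fun_prop)
          have hH := ENNReal.lintegral_mul_le_Lp_mul_Lq volume hpq
            (f := fun s' => ENNReal.ofReal (a s'))
            (g := fun s' => {u : ℝ | 1 < |u| * a s ^ p}.indicator k (s' - s))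
            (by fun_prop) (((hkm.indicator hS).comp (measurable_sub_const s)).aemeasurable)
          have hA' : (∫⁻ s', ENNReal.ofReal (a s') ^ p) ^ (1 / p) ≤ 1 := by
            refine ENNReal.rpow_le_one ?_ (by positivity)
            refine le_trans (le_of_eq (lintegral_congr fun s' => ?_)) hA
            rw [ENNReal.ofReal_rpow_of_nonneg (ha0 _) (by linarith)]
          have hq0 : 0 < p / (p - 1) := div_pos (by linarith) (by linarith)
          have hB : ∫⁻ s', ({u : ℝ | 1 < |u| * a s ^ p}.indicator k (s' - s)) ^ (p / (p - 1))
              ≤ ENNReal.ofReal (2 * a s ^ p) := by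
            rw [lintegral_sub_right_eq_self
              (fun u => ({u : ℝ | 1 < |u| * a s ^ p}.indicator k u) ^ (p / (p - 1)))]
            refine le_trans (le_of_eq (lintegral_congr fun u => ?_))
              (lintegral_rpow_far_le (Real.rpow_pos_of_pos h0 p))
            by_cases hu : u ∈ {u : ℝ | 1 < |u| * a s ^ p}
            · rw [Set.indicator_of_mem hu, Set.indicator_of_mem hu]
              simp only [hk]
              rw [ENNReal.ofReal_rpow_of_nonneg (by positivity) hq0.le,
                ← Real.rpow_mul (abs_nonneg _)]
              congr 2
              have hα' : α = 2 - 2 / p := by rw [hp]; field_simp; ring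
              have : p - 1 ≠ 0 := by linarith
              rw [hα']
              field_simp
            · rw [Set.indicator_of_notMem hu, Set.indicator_of_notMem hu,
                ENNReal.zero_rpow_of_pos hq0]
          have hC : (∫⁻ s', ({u : ℝ | 1 < |u| * a s ^ p}.indicator k (s' - s))
              ^ (p / (p - 1))) ^ (1 / (p / (p - 1))) ≤ ENNReal.ofReal (2 * a s ^ (p - 1)) := by
            refine (ENNReal.rpow_le_rpow hB (by positivity)).trans ?_
            rw [ENNReal.ofReal_rpow_of_nonneg (by positivity) (by positivity)]
            refine ENNReal.ofReal_le_ofReal ?_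
            rw [Real.mul_rpow (by norm_num) (by positivity), ← Real.rpow_mul h0.le]
            have e1 : p * (1 / (p / (p - 1))) = p - 1 := by field_simp
            rw [e1]
            gcongr
            calc (2 : ℝ) ^ (1 / (p / (p - 1))) ≤ 2 ^ (1 : ℝ) := by
                  refine Real.rpow_le_rpow_of_exponent_le (by norm_num) ?_
                  rw [one_div_div, div_le_one (by linarith)]
                  linarith
              _ = 2 := by simp
          calc ENNReal.ofReal (a s) * ∫⁻ s', ENNReal.ofReal (a s') *
                {u : ℝ | 1 < |u| * a s ^ p}.indicator k (s' - s)
              ≤ ENNReal.ofReal (a s) * (1 * ENNReal.ofReal (2 * a s ^ (p - 1))) := by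
                gcongr
                exact hH.trans (mul_le_mul' hA' hC)
            _ = 2 * ENNReal.ofReal (a s ^ p) := by
                rw [one_mul, ← ENNReal.ofReal_mul h0.le,
                  show (2 : ℝ≥0∞) = ENNReal.ofReal 2 by simp, ← ENNReal.ofReal_mul (by norm_num)]
                congr 1
                rw [mul_left_comm]
                congr 1
                nth_rewrite 1 [← Real.rpow_one (a s)]
                rw [← Real.rpow_add h0]
                congr 1; ring
      _ = 2 * ∫⁻ s, ENNReal.ofReal (a s ^ p) := lintegral_const_mul' _ _ (by finiteness)
      _ ≤ 2 * 1 := by gcongr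
      _ = _ := mul_one _
  have sw : ∀ {g : ℝ → ℝ → ℝ≥0∞}, Measurable (Function.uncurry g) →
      ∫⁻ s, ∫⁻ s', g s' s = ∫⁻ s, ∫⁻ s', g s s' := fun {g} hg =>
    (lintegral_lintegral_swap (f := g) hg.aemeasurable).symm
  have hsec : ∀ {g : ℝ → ℝ → ℝ≥0∞}, Measurable (Function.uncurry g) →
      ∀ s, Measurable (g s) := fun hg s => hg.comp measurable_prodMk_left
  have hsec' : ∀ {g : ℝ → ℝ → ℝ≥0∞}, Measurable (Function.uncurry g) →
      ∀ s, Measurable (fun s' => g s' s) := fun hg s => hg.comp measurable_prodMk_right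
  have hmi : ∀ {g : ℝ → ℝ → ℝ≥0∞}, Measurable (Function.uncurry g) →
      Measurable (fun s => ∫⁻ s', g s s') := fun hg => hg.lintegral_prod_right'
  have hmi' : ∀ {g : ℝ → ℝ → ℝ≥0∞}, Measurable (Function.uncurry g) →
      Measurable (fun s => ∫⁻ s', g s' s) := fun hg => hg.lintegral_prod_left'
  calc ∫⁻ s, ∫⁻ s', ENNReal.ofReal (a s) * ENNReal.ofReal (a s') * k (s' - s)
      ≤ ∫⁻ s, ∫⁻ s', (((g₁ s s' + g₁ s' s) / 2 + g₂ s s') + g₂ s' s) :=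
        lintegral_mono fun s => lintegral_mono fun s' => hpt s s'
    _ = ∫⁻ s, (((∫⁻ s', g₁ s s') + ∫⁻ s', g₁ s' s) * 2⁻¹ + ∫⁻ s', g₂ s s')
          + ∫⁻ s', g₂ s' s := by
        refine lintegral_congr fun s => ?_
        simp only [div_eq_mul_inv]
        rw [lintegral_add_right _ (hsec' hg₂m s), lintegral_add_right _ (hsec hg₂m s),
          lintegral_mul_const' _ _ (by finiteness), lintegral_add_right _ (hsec' hg₁m s)]
    _ = ((∫⁻ s, ∫⁻ s', g₁ s s') + ∫⁻ s, ∫⁻ s', g₁ s s') * 2⁻¹ + (∫⁻ s, ∫⁻ s', g₂ s s')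
          + ∫⁻ s, ∫⁻ s', g₂ s s' := by
        rw [lintegral_add_right _ (hmi' hg₂m), lintegral_add_right _ (hmi hg₂m),
          lintegral_mul_const' _ _ (by finiteness), lintegral_add_right _ (hmi' hg₁m),
          sw hg₁m, sw hg₂m]
    _ = (∫⁻ s, ∫⁻ s', g₁ s s') + (∫⁻ s, ∫⁻ s', g₂ s s') + ∫⁻ s, ∫⁻ s', g₂ s s' := by
        rw [← two_mul, mul_right_comm, ENNReal.mul_inv_cancel (by norm_num) (by norm_num),
          one_mul]
    _ ≤ ENNReal.ofReal (2 / (1 - α)) + 2 + 2 := by gcongr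
    _ = _ := by rw [add_assoc]; norm_num

theorem lintegral_hls_le {α : ℝ} (hα0 : 0 < α) (hα1 : α < 1) {a : ℝ → ℝ}
    (ha : Measurable a) (ha0 : ∀ s, 0 ≤ a s) {A : ℝ} (hA0 : 0 < A)
    (hA : ∫⁻ s, ENNReal.ofReal (a s ^ (2 / (2 - α))) ≤ ENNReal.ofReal (A ^ (2 / (2 - α)))) :
    ∫⁻ s, ∫⁻ s', ENNReal.ofReal (a s) * ENNReal.ofReal (a s') *
        ENNReal.ofReal (|s' - s| ^ (-α))
      ≤ ENNReal.ofReal ((2 / (1 - α) + 4) * A ^ 2) := by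
  have hnn : 0 ≤ 2 / (1 - α) := div_nonneg (by norm_num) (by linarith)
  have h := lintegral_hls_le_of_le_one hα0 hα1 (a := fun s => a s / A) (ha.div_const A)
    (fun s => div_nonneg (ha0 s) hA0.le) ?_
  · have e : ∀ s, ENNReal.ofReal (a s) = ENNReal.ofReal A * ENNReal.ofReal (a s / A) := by
      intro s
      rw [← ENNReal.ofReal_mul hA0.le]
      congr 1; field_simp
    calc _ = ENNReal.ofReal A ^ 2 * ∫⁻ s, ∫⁻ s', ENNReal.ofReal (a s / A) *
            ENNReal.ofReal (a s' / A) * ENNReal.ofReal (|s' - s| ^ (-α)) := by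
          rw [← lintegral_const_mul' _ _ (by finiteness)]
          refine lintegral_congr fun s => ?_
          rw [← lintegral_const_mul' _ _ (by finiteness)]
          refine lintegral_congr fun s' => ?_
          rw [e s, e s']; ring
      _ ≤ ENNReal.ofReal A ^ 2 * (ENNReal.ofReal (2 / (1 - α)) + 4) := by gcongr
      _ = _ := by
          rw [show (4 : ℝ≥0∞) = ENNReal.ofReal 4 by simp, ← ENNReal.ofReal_add hnn (by norm_num),
            ← ENNReal.ofReal_pow hA0.le, ← ENNReal.ofReal_mul (by positivity), mul_comm]
  · have hp0 : 0 < A ^ (2 / (2 - α)) := by positivity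
    have e : ∀ s, ENNReal.ofReal ((a s / A) ^ (2 / (2 - α)))
        = ENNReal.ofReal (A ^ (2 / (2 - α)))⁻¹ * ENNReal.ofReal (a s ^ (2 / (2 - α))) := by
      intro s
      rw [Real.div_rpow (ha0 s) hA0.le, div_eq_inv_mul, ENNReal.ofReal_mul (by positivity)]
    simp_rw [e]
    rw [lintegral_const_mul' _ _ (by finiteness)]
    refine (mul_le_mul_right hA _).trans (le_of_eq ?_)
    rw [← ENNReal.ofReal_mul (by positivity), inv_mul_cancel₀ hp0.ne', ENNReal.ofReal_one]

end HardyLittlewoodSobolev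

section Interpolation

variable {X Y : Type*} [MeasurableSpace X] [MeasurableSpace Y] {μ : Measure X} {ν : Measure Y}
  [SFinite μ]

/-- Marcinkiewicz-type interpolation between `L¹ → L^∞` and `L² → L²`. -/
theorem lintegral_interpolation_le {T : (X → ℂ) → Y → ℂ} {A r r' N : ℝ} (hA : 0 < A)
    (hr : 2 < r) (hr' : 1 / r + 1 / r' = 1) (hN : 0 < N)
    (hadd : ∀ f g, Integrable f μ → Integrable g μ → T (f + g) = T f + T g)
    (hmeas : ∀ f, Integrable f μ → AEStronglyMeasurable (T f) ν)
    (h1 : ∀ f, Integrable f μ → ∀ y, ‖T f y‖ₑ ≤ ENNReal.ofReal A * ∫⁻ x, ‖f x‖ₑ ∂μ)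
    (h2 : ∀ f, Integrable f μ → ∫⁻ y, ‖T f y‖ₑ ^ 2 ∂ν ≤ ∫⁻ x, ‖f x‖ₑ ^ 2 ∂μ)
    {f : X → ℂ} (hf : Integrable f μ) (hfm : Measurable f)
    (hfN : ∫⁻ x, ENNReal.ofReal (‖f x‖ ^ r') ∂μ ≤ ENNReal.ofReal (N ^ r')) :
    ∫⁻ y, ENNReal.ofReal (‖T f y‖ ^ r) ∂ν
      ≤ ENNReal.ofReal (r * (8 / (r - 2) * (2 * A) ^ (r - 2)) * N ^ r) := by
  have hr0 : r ≠ 0 := by linarith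
  have hr1 : r - 1 ≠ 0 := by linarith
  have hr'e : r' = r / (r - 1) := by
    have : 1 / r' = (r - 1) / r := by rw [sub_div, div_self hr0]; linarith
    rw [← one_div_one_div r', this, one_div_div]
  have hr'1 : r' - 1 = 1 / (r - 1) := by rw [hr'e]; field_simp; ring
  have hr'pos : 0 < r' - 1 := by rw [hr'1]; exact one_div_pos.2 (by linarith)
  set B : ℝ := 2 * (A * N ^ r') with hB
  have hBpos : 0 < B := by positivity
  set D : Set (ℝ × X) := {p | |p.1| * (‖f p.2‖ ^ (r' - 1) / B) ≤ 1} with hD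
  have hDm : MeasurableSet D := measurableSet_le (by fun_prop) measurable_const
  have hdist : ∀ t : ℝ, 0 < t → ν {y | t < ‖T f y‖} * ENNReal.ofReal (t ^ (r - 1))
      ≤ ∫⁻ x, D.indicator
          (fun p => ENNReal.ofReal (4 * |p.1| ^ (-(3 - r))) * ‖f p.2‖ₑ ^ 2) (t, x) ∂μ := by
    intro t ht
    set S : Set X := {x | |t| * (‖f x‖ ^ (r' - 1) / B) ≤ 1} with hS
    have hSm : MeasurableSet S := measurableSet_le (by fun_prop) measurable_const
    have hf2 : Integrable (S.indicator f) μ := hf.indicator hSm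
    have hf1 : Integrable (Sᶜ.indicator f) μ := hf.indicator hSm.compl
    have hsum : T f = T (Sᶜ.indicator f) + T (S.indicator f) := by
      rw [← hadd _ _ hf1 hf2, Set.indicator_compl_add_self]
    have hbig : ∀ y, ‖T (Sᶜ.indicator f) y‖ₑ ≤ ENNReal.ofReal (t / 2) := by
      intro y
      refine (h1 _ hf1 y).trans ?_
      have h3 : ∀ x, ‖Sᶜ.indicator f x‖ₑ
          ≤ ENNReal.ofReal (t / B) * ENNReal.ofReal (‖f x‖ ^ r') := by
        intro x
        by_cases hx : x ∈ S
        · rw [Set.indicator_of_notMem (by simpa using hx)]; simp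
        · rw [Set.indicator_of_mem (show x ∈ Sᶜ from hx), ← ofReal_norm,
            ← ENNReal.ofReal_mul (by positivity)]
          refine ENNReal.ofReal_le_ofReal ?_
          have hx' : 1 < |t| * (‖f x‖ ^ (r' - 1) / B) := not_le.1 hx
          rw [abs_of_pos ht] at hx'
          have hfx : 0 < ‖f x‖ := by
            rcases (norm_nonneg (f x)).eq_or_lt with h0 | h0
            · rw [← h0, Real.zero_rpow hr'pos.ne'] at hx'; norm_num at hx'
            · exact h0
          have e : ‖f x‖ ^ r' = ‖f x‖ ^ (r' - 1) * ‖f x‖ := by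
            rw [Real.rpow_sub_one hfx.ne']; field_simp
          rw [e]
          calc ‖f x‖ = 1 * ‖f x‖ := (one_mul _).symm
            _ ≤ (t * (‖f x‖ ^ (r' - 1) / B)) * ‖f x‖ := by gcongr
            _ = _ := by ring
      calc ENNReal.ofReal A * ∫⁻ x, ‖Sᶜ.indicator f x‖ₑ ∂μ
          ≤ ENNReal.ofReal A * (ENNReal.ofReal (t / B) * ENNReal.ofReal (N ^ r')) := by
            gcongr
            refine (lintegral_mono h3).trans ?_
            rw [lintegral_const_mul' _ _ (by finiteness)]
            gcongr
        _ = ENNReal.ofReal (t / 2) := by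
            rw [← ENNReal.ofReal_mul (by positivity), ← ENNReal.ofReal_mul (by positivity)]
            congr 1
            rw [hB]; field_simp
    have hsub : {y | t < ‖T f y‖} ⊆
        {y | ENNReal.ofReal ((t / 2) ^ 2) ≤ ‖T (S.indicator f) y‖ₑ ^ 2} := by
      intro y hy
      have hy' : t < ‖T f y‖ := hy
      have h3 : ‖T (Sᶜ.indicator f) y‖ ≤ t / 2 := by
        have := hbig y
        rw [← ofReal_norm] at this
        exact (ENNReal.ofReal_le_ofReal_iff (by positivity)).1 this
      have h4 : ‖T f y‖ ≤ ‖T (Sᶜ.indicator f) y‖ + ‖T (S.indicator f) y‖ := by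
        rw [hsum]; exact norm_add_le _ _
      show ENNReal.ofReal ((t / 2) ^ 2) ≤ ‖T (S.indicator f) y‖ₑ ^ 2
      rw [← ofReal_norm, ENNReal.ofReal_pow (by positivity)]
      gcongr
      linarith
    have hcheb := mul_meas_ge_le_lintegral₀ ((hmeas _ hf2).enorm.pow_const 2)
      (ENNReal.ofReal ((t / 2) ^ 2))
    have hmeasle : ENNReal.ofReal ((t / 2) ^ 2) * ν {y | t < ‖T f y‖}
        ≤ ∫⁻ x, S.indicator (fun x => ‖f x‖ₑ ^ 2) x ∂μ := by
      refine (mul_le_mul_right (measure_mono hsub) _).trans (hcheb.trans ((h2 _ hf2).trans ?_))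
      refine lintegral_mono fun x => ?_
      by_cases hx : x ∈ S
      · rw [Set.indicator_of_mem hx, Set.indicator_of_mem hx]
      · rw [Set.indicator_of_notMem hx]; simp
    have e1 : ∀ x, D.indicator
          (fun p => ENNReal.ofReal (4 * |p.1| ^ (-(3 - r))) * ‖f p.2‖ₑ ^ 2) (t, x)
        = ENNReal.ofReal (4 * t ^ (r - 3)) * S.indicator (fun x => ‖f x‖ₑ ^ 2) x := by
      intro x
      by_cases hx : x ∈ S
      · rw [Set.indicator_of_mem hx, Set.indicator_of_mem (show (t, x) ∈ D from hx)]
        simp only [abs_of_pos ht, neg_sub]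
      · rw [Set.indicator_of_notMem hx, Set.indicator_of_notMem (show (t, x) ∉ D from hx),
          mul_zero]
    simp_rw [e1]
    rw [lintegral_const_mul' _ _ (by finiteness)]
    refine le_trans (le_of_eq ?_) (mul_le_mul_right hmeasle _)
    rw [← mul_assoc, ← ENNReal.ofReal_mul (by positivity), mul_comm]
    congr 2
    rw [show r - 1 = (r - 3) + 2 by ring, Real.rpow_add ht]
    norm_num
    ring
  have hDt : ∀ x, ∫⁻ t : ℝ, D.indicator
        (fun p => ENNReal.ofReal (4 * |p.1| ^ (-(3 - r))) * ‖f p.2‖ₑ ^ 2) (t, x)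
      ≤ ENNReal.ofReal (8 / (r - 2) * B ^ (r - 2)) * ENNReal.ofReal (‖f x‖ ^ r') := by
    intro x
    rcases (norm_nonneg (f x)).eq_or_lt with h0 | h0
    · have hx0 : f x = 0 := norm_eq_zero.1 h0.symm
      have : ∀ t : ℝ, D.indicator
          (fun p => ENNReal.ofReal (4 * |p.1| ^ (-(3 - r))) * ‖f p.2‖ₑ ^ 2) (t, x) = 0 := by
        intro t
        simp [Set.indicator_apply, hx0]
      simp_rw [this]
      simp
    have e1 : ∀ t : ℝ, D.indicator
          (fun p => ENNReal.ofReal (4 * |p.1| ^ (-(3 - r))) * ‖f p.2‖ₑ ^ 2) (t, x)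
        = ENNReal.ofReal (4 * ‖f x‖ ^ 2) * {u : ℝ | |u| * (‖f x‖ ^ (r' - 1) / B) ≤ 1}.indicator
            (fun u => ENNReal.ofReal (|u| ^ (-(3 - r)))) t := by
      intro t
      by_cases ht : (t, x) ∈ D
      · rw [Set.indicator_of_mem ht, Set.indicator_of_mem
          (show t ∈ {u : ℝ | |u| * (‖f x‖ ^ (r' - 1) / B) ≤ 1} from ht), ← ofReal_norm,
          ← ENNReal.ofReal_pow (norm_nonneg _), ← ENNReal.ofReal_mul (by positivity),
          ← ENNReal.ofReal_mul (by positivity)]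
        congr 1; ring
      · rw [Set.indicator_of_notMem ht, Set.indicator_of_notMem
          (show t ∉ {u : ℝ | |u| * (‖f x‖ ^ (r' - 1) / B) ≤ 1} from ht), mul_zero]
    simp_rw [e1]
    rw [lintegral_const_mul' _ _ (by finiteness)]
    refine (mul_le_mul_right (lintegral_rpow_near_le (by linarith) (by positivity)) _).trans
      (le_of_eq ?_)
    have hr2 : 0 < r - 2 := by linarith
    rw [← ENNReal.ofReal_mul (by positivity), ← ENNReal.ofReal_mul (by positivity)]
    congr 1
    have e2 : (‖f x‖ ^ (r' - 1) / B) ^ (3 - r - 1) = ‖f x‖ ^ (r' - 2) * B ^ (r - 2) := by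
      rw [Real.div_rpow (by positivity) hBpos.le, ← Real.rpow_mul h0.le,
        show 3 - r - 1 = -(r - 2) by ring, Real.rpow_neg hBpos.le, div_inv_eq_mul]
      congr 2
      rw [hr'1, hr'e]; field_simp; ring
    have e3 : ‖f x‖ ^ 2 * ‖f x‖ ^ (r' - 2) = ‖f x‖ ^ r' := by
      rw [← Real.rpow_natCast, ← Real.rpow_add h0]; congr 1; push_cast; ring
    rw [e2, ← e3, show 1 - (3 - r) = r - 2 by ring]
    ring
  have hgm : Measurable (D.indicator
      (fun p : ℝ × X => ENNReal.ofReal (4 * |p.1| ^ (-(3 - r))) * ‖f p.2‖ₑ ^ 2)) := by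
    refine Measurable.indicator ?_ hDm
    fun_prop
  have hr2 : 0 < r - 2 := by linarith
  rw [lintegral_rpow_eq_lintegral_meas_lt_mul ν (Eventually.of_forall fun y => norm_nonneg _)
    (hmeas f hf).norm.aemeasurable (by linarith)]
  calc ENNReal.ofReal r * ∫⁻ t in Set.Ioi 0, ν {y | t < ‖T f y‖} * ENNReal.ofReal (t ^ (r - 1))
      ≤ ENNReal.ofReal r * ∫⁻ t in Set.Ioi 0, ∫⁻ x, D.indicator
          (fun p => ENNReal.ofReal (4 * |p.1| ^ (-(3 - r))) * ‖f p.2‖ₑ ^ 2) (t, x) ∂μ := by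
        refine mul_le_mul_right ?_ _
        exact setLIntegral_mono' measurableSet_Ioi fun t ht => hdist t ht
    _ ≤ ENNReal.ofReal r * ∫⁻ t, ∫⁻ x, D.indicator
          (fun p => ENNReal.ofReal (4 * |p.1| ^ (-(3 - r))) * ‖f p.2‖ₑ ^ 2) (t, x) ∂μ := by
        gcongr
        exact Measure.restrict_le_self
    _ = ENNReal.ofReal r * ∫⁻ x, (∫⁻ t : ℝ, D.indicator
          (fun p => ENNReal.ofReal (4 * |p.1| ^ (-(3 - r))) * ‖f p.2‖ₑ ^ 2) (t, x)) ∂μ := by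
        rw [lintegral_lintegral_swap (f := fun t x => D.indicator
          (fun p => ENNReal.ofReal (4 * |p.1| ^ (-(3 - r))) * ‖f p.2‖ₑ ^ 2) (t, x))
          hgm.aemeasurable]
    _ ≤ ENNReal.ofReal r * (ENNReal.ofReal (8 / (r - 2) * B ^ (r - 2)) *
          ENNReal.ofReal (N ^ r')) := by
        gcongr
        refine (lintegral_mono hDt).trans ?_
        rw [lintegral_const_mul' _ _ (by finiteness)]
        gcongr
    _ = _ := by
        rw [← ENNReal.ofReal_mul (by positivity), ← ENNReal.ofReal_mul (by linarith)]
        congr 1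
        have e0 : B ^ (r - 2) = (2 * A) ^ (r - 2) * N ^ (r' * (r - 2)) := by
          rw [hB, ← mul_assoc, Real.mul_rpow (by positivity) (by positivity),
            ← Real.rpow_mul hN.le]
        have e : N ^ r = N ^ (r' * (r - 2)) * N ^ r' := by
          rw [← Real.rpow_add hN]
          congr 1
          rw [hr'e]; field_simp; ring
        rw [e0, e]; ring

end Interpolation

section FourierBasics

variable {V : Type*} [NormedAddCommGroup V] [InnerProductSpace ℝ V] [FiniteDimensional ℝ V]
  [MeasurableSpace V] [BorelSpace V]

theorem norm_fourier_le (f : V → ℂ) (w : V) : ‖𝓕 f w‖ ≤ ∫ v, ‖f v‖ :=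
  VectorFourier.norm_fourierIntegral_le_integral_norm _ _ _ _ _

theorem continuous_fourier {f : V → ℂ} (hf : Integrable f) : Continuous (𝓕 f) :=
  VectorFourier.fourierIntegral_continuous Real.continuous_fourierChar
    continuous_inner hf

theorem continuous_fourierInv {f : V → ℂ} (hf : Integrable f) : Continuous (𝓕⁻ f) := by
  rw [Real.fourierInv_eq_fourier_comp_neg]
  exact continuous_fourier hf.comp_neg

theorem integral_fourier_mul_eq {f g : V → ℂ} (hf : Integrable f) (hg : Integrable g) :
    ∫ w, 𝓕 f w * g w = ∫ v, f v * 𝓕 g v := by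
  simpa using! VectorFourier.integral_fourierIntegral_smul_eq_flip (L := innerₗ V)
      Real.continuous_fourierChar continuous_inner hf hg

theorem integral_fourierInv_mul_eq {f g : V → ℂ} (hf : Integrable f) (hg : Integrable g) :
    ∫ w, 𝓕⁻ f w * g w = ∫ v, f v * 𝓕⁻ g v := by
  rw [Real.fourierInv_eq_fourier_comp_neg, integral_fourier_mul_eq hf.comp_neg hg,
    ← integral_neg_eq_self]
  simp [Real.fourierInv_eq_fourier_neg]

theorem fourierInv_conj (h : V → ℂ) (w : V) :
    𝓕⁻ (fun x => starRingEnd ℂ (h x)) w = starRingEnd ℂ (𝓕 h w) := by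
  rw [Real.fourierInv_eq', Real.fourier_eq', ← integral_conj]
  refine integral_congr_ae (Eventually.of_forall fun v => ?_)
  simp only [smul_eq_mul, map_mul, ← Complex.exp_conj, conj_I, conj_ofReal]
  congr 2
  push_cast; ring

end FourierBasics

section Dispersive

variable {n : ℕ}

/-- The regularised symbol of the propagator. -/
def regSymbol (ε : Fin n → ℝ) (δ τ : ℝ) (ξ : Eucl n) : ℂ :=
  cexp (-(δ : ℂ) * (‖ξ‖ : ℂ) ^ 2 + I * τ * quadSym ε ξ)

theorem regSymbol_eq (ε : Fin n → ℝ) (δ τ : ℝ) (ξ : Eucl n) :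
    regSymbol ε δ τ ξ = cexp (-∑ i, ((δ : ℂ) - I * τ * ε i) * (ξ i : ℂ) ^ 2) := by
  have h : (‖ξ‖ : ℂ) ^ 2 = ∑ i, (ξ i : ℂ) ^ 2 := by
    exact_mod_cast EuclideanSpace.real_norm_sq_eq ξ
  rw [regSymbol, h, quadSym, ofReal_sum, Finset.mul_sum, Finset.mul_sum, ← Finset.sum_add_distrib,
    ← Finset.sum_neg_distrib]
  congr 1
  refine Finset.sum_congr rfl fun i _ => ?_
  push_cast; ring

theorem norm_regSymbol (ε : Fin n → ℝ) (δ τ : ℝ) (ξ : Eucl n) :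
    ‖regSymbol ε δ τ ξ‖ = Real.exp (-δ * ‖ξ‖ ^ 2) := by
  rw [regSymbol, Complex.exp_add, norm_mul, norm_cexp_neg_mul_sq_norm,
    show I * (τ : ℂ) * (quadSym ε ξ : ℂ) = ((τ * quadSym ε ξ : ℝ) : ℂ) * I by push_cast; ring,
    norm_exp_ofReal_mul_I, mul_one]

theorem norm_regSymbol_le_one (ε : Fin n → ℝ) {δ : ℝ} (hδ : 0 < δ) (τ : ℝ) (ξ : Eucl n) :
    ‖regSymbol ε δ τ ξ‖ ≤ 1 := by
  rw [norm_regSymbol, Real.exp_le_one_iff]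
  have := mul_nonneg hδ.le (sq_nonneg ‖ξ‖)
  linarith

theorem continuous_regSymbol (ε : Fin n → ℝ) (δ τ : ℝ) : Continuous (regSymbol ε δ τ) := by
  have := continuous_quadSym (n := n) ε
  unfold regSymbol
  fun_prop

theorem integrable_regSymbol (ε : Fin n → ℝ) {δ : ℝ} (hδ : 0 < δ) (τ : ℝ) :
    Integrable (regSymbol ε δ τ) := by
  refine (integrable_cexp_neg_mul_sq_norm (V := Eucl n) hδ).mono
    (continuous_regSymbol ε δ τ).aestronglyMeasurable (Eventually.of_forall fun ξ => ?_)
  rw [norm_regSymbol, norm_cexp_neg_mul_sq_norm]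

theorem norm_integral_regSymbol_le {ε : Fin n → ℝ} (hε : ∀ i, ε i = 1 ∨ ε i = -1) {δ : ℝ}
    (hδ : 0 < δ) {τ : ℝ} (hτ : τ ≠ 0) (w : Eucl n) :
    ‖∫ ξ, regSymbol ε δ τ ξ * cexp (((2 * Real.pi * ⟪ξ, w⟫ : ℝ) : ℂ) * I)‖
      ≤ (Real.pi / |τ|) ^ ((n : ℝ) / 2) := by
  have hb : ∀ i, 0 < ((δ : ℂ) - I * τ * ε i).re := fun i => by simpa using hδ
  have habs : ∀ i, |ε i| = 1 := fun i => by rcases hε i with h | h <;> simp [h]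
  have key := GaussianFourier.integral_cexp_neg_sum_mul_add hb (fun i => 2 * Real.pi * I * w i)
  rw [← (PiLp.volume_preserving_toLp (Fin n)).integral_comp
    (MeasurableEquiv.toLp 2 (Fin n → ℝ)).measurableEmbedding]
  have e1 : ∀ v : Fin n → ℝ, regSymbol ε δ τ (WithLp.toLp 2 v) *
      cexp (((2 * Real.pi * ⟪(WithLp.toLp 2 v : Eucl n), w⟫ : ℝ) : ℂ) * I) =
      cexp (-∑ i, ((δ : ℂ) - I * τ * ε i) * (v i : ℂ) ^ 2 +
        ∑ i, 2 * Real.pi * I * w i * (v i : ℂ)) := fun v => by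
    rw [regSymbol_eq, ← Complex.exp_add]
    congr 2
    simp only [PiLp.inner_apply, RCLike.inner_apply, conj_trivial]
    push_cast
    rw [Finset.mul_sum, Finset.sum_mul]
    exact Finset.sum_congr rfl fun i _ => by ring
  simp_rw [e1]
  rw [key, norm_prod]
  have hπ := Real.pi_pos
  calc _ ≤ ∏ _i : Fin n, (Real.pi / |τ|) ^ (1 / 2 : ℝ) := by
        refine Finset.prod_le_prod (fun i _ => norm_nonneg _) fun i _ => ?_
        rw [norm_mul]
        have h1 : ‖((Real.pi : ℂ) / ((δ : ℂ) - I * τ * ε i)) ^ (1 / 2 : ℂ)‖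
            ≤ (Real.pi / |τ|) ^ (1 / 2 : ℝ) := by
          rw [show (1 / 2 : ℂ) = ((1 / 2 : ℝ) : ℂ) by push_cast; rfl, Complex.norm_cpow_real,
            norm_div, norm_real, Real.norm_of_nonneg hπ.le]
          refine Real.rpow_le_rpow (by positivity) ?_ (by norm_num)
          refine div_le_div_of_nonneg_left hπ.le (abs_pos.2 hτ) ?_
          have := Complex.abs_im_le_norm ((δ : ℂ) - I * τ * ε i)
          simpa [abs_mul, habs i] using this
        have h2 : ‖cexp ((2 * Real.pi * I * w i) ^ 2 / (4 * ((δ : ℂ) - I * τ * ε i)))‖ ≤ 1 := by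
          rw [Complex.norm_exp, Real.exp_le_one_iff]
          have : (2 * Real.pi * I * w i) ^ 2 / (4 * ((δ : ℂ) - I * τ * ε i)) =
              (((-(Real.pi * w i) ^ 2 : ℝ)) : ℂ) * ((δ : ℂ) - I * τ * ε i)⁻¹ := by
            have h3 : ((δ : ℂ) - I * τ * ε i) ≠ 0 := fun h => by
              have := hb i; rw [h] at this; simp at this
            field_simp
            push_cast
            rw [show I ^ 2 = -1 from I_sq]; ring
          rw [this, Complex.re_ofReal_mul, Complex.inv_re]
          have := div_nonneg (hb i).le (Complex.normSq_nonneg ((δ : ℂ) - I * τ * ε i))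
          nlinarith [sq_nonneg (Real.pi * w i)]
        exact (mul_le_mul h1 h2 (norm_nonneg _) (by positivity)).trans_eq (mul_one _)
    _ = (Real.pi / |τ|) ^ ((n : ℝ) / 2) := by
        rw [Finset.prod_const, Finset.card_univ, Fintype.card_fin, ← Real.rpow_natCast,
          ← Real.rpow_mul (by positivity)]
        congr 1; ring

/-- The regularised propagator. -/
def regProp (ε : Fin n → ℝ) (δ τ : ℝ) (f : Eucl n → ℂ) : Eucl n → ℂ :=
  𝓕⁻ (fun ξ => regSymbol ε δ τ ξ * 𝓕 f ξ)

theorem integrable_regSymbol_mul (ε : Fin n → ℝ) {δ : ℝ} (hδ : 0 < δ) (τ : ℝ) {f : Eucl n → ℂ}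
    (hf : Integrable f) : Integrable (fun ξ => regSymbol ε δ τ ξ * 𝓕 f ξ) :=
  (integrable_regSymbol ε hδ τ).mul_bdd
    (continuous_fourier hf).aestronglyMeasurable
    (Eventually.of_forall fun ξ => norm_fourier_le f ξ)

theorem regProp_add (ε : Fin n → ℝ) {δ : ℝ} (hδ : 0 < δ) (τ : ℝ) {f g : Eucl n → ℂ}
    (hf : Integrable f) (hg : Integrable g) :
    regProp ε δ τ (f + g) = regProp ε δ τ f + regProp ε δ τ g := by
  have h1 : 𝓕 (f + g) = 𝓕 f + 𝓕 g := by
    ext w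
    simp only [Real.fourier_eq, Pi.add_apply, smul_add]
    exact integral_add ((Real.fourierIntegral_convergent_iff w).2 hf)
      ((Real.fourierIntegral_convergent_iff w).2 hg)
  ext w
  have hF := integrable_regSymbol_mul ε hδ τ hf
  have hG := integrable_regSymbol_mul ε hδ τ hg
  rw [← Real.fourierIntegral_convergent_iff (-w)] at hF hG
  simp only [regProp, h1, Pi.add_apply, mul_add, Real.fourierInv_eq, smul_add]
  simp only [inner_neg_right, neg_neg] at hF hG
  exact integral_add hF hG

theorem norm_regProp_le {ε : Fin n → ℝ} (hε : ∀ i, ε i = 1 ∨ ε i = -1) {δ : ℝ}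
    (hδ : 0 < δ) {τ : ℝ} (hτ : τ ≠ 0) {f : Eucl n → ℂ} (hf : Integrable f) (x : Eucl n) :
    ‖regProp ε δ τ f x‖ ≤ (Real.pi / |τ|) ^ ((n : ℝ) / 2) * ∫ y, ‖f y‖ := by
  set G : Eucl n → ℂ := fun ξ =>
    regSymbol ε δ τ ξ * cexp (((2 * Real.pi * ⟪ξ, x⟫ : ℝ) : ℂ) * I) with hGdef
  have hG : Integrable G := by
    refine (integrable_regSymbol ε hδ τ).mul_bdd (c := 1) (by fun_prop)
      (Eventually.of_forall fun ξ => ?_)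
    exact (norm_exp_ofReal_mul_I _).le
  have h1 : regProp ε δ τ f x = ∫ ξ, 𝓕 f ξ * G ξ := by
    rw [regProp, Real.fourierInv_eq']
    refine integral_congr_ae (Eventually.of_forall fun ξ => ?_)
    simp only [smul_eq_mul, hGdef]; ring
  have h2 : ∀ y, ‖𝓕 G y‖ ≤ (Real.pi / |τ|) ^ ((n : ℝ) / 2) := fun y => by
    refine le_of_eq_of_le ?_ (norm_integral_regSymbol_le hε hδ hτ (x - y))
    rw [Real.fourier_eq']
    congr 1
    refine integral_congr_ae (Eventually.of_forall fun ξ => ?_)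
    simp only [smul_eq_mul, hGdef, inner_sub_right]
    rw [mul_left_comm, ← Complex.exp_add]
    congr 2
    push_cast; ring
  rw [h1, integral_fourier_mul_eq hf hG, ← integral_const_mul]
  refine norm_integral_le_of_norm_le (hf.norm.const_mul _) (Eventually.of_forall fun y => ?_)
  rw [norm_mul, mul_comm]
  exact mul_le_mul_of_nonneg_right (h2 y) (norm_nonneg _)

theorem lintegral_regProp_sq_le (ε : Fin n → ℝ) {δ : ℝ} (hδ : 0 < δ) (τ : ℝ) {f : Eucl n → ℂ}
    (hf : Integrable f) : ∫⁻ x, ‖regProp ε δ τ f x‖ₑ ^ 2 ≤ ∫⁻ x, ‖f x‖ₑ ^ 2 := by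
  refine (lintegral_fourierInv_sq_le (integrable_regSymbol_mul ε hδ τ hf)).trans
    (le_trans (lintegral_mono fun ξ => ?_) (lintegral_fourier_sq_le hf))
  gcongr
  rw [enorm_mul]
  refine (mul_le_mul_left ?_ _).trans_eq (one_mul _)
  rw [← ofReal_norm, ENNReal.ofReal_le_one]
  exact norm_regSymbol_le_one ε hδ τ ξ

theorem exists_regular_pairing_le {r r' : ℝ} (hr : 2 < r) (hr' : 1 / r + 1 / r' = 1) (n : ℕ) :
    ∃ C : ℝ, 0 < C ∧ ∀ {ε : Fin n → ℝ}, (∀ i, ε i = 1 ∨ ε i = -1) → ∀ {δ : ℝ}, 0 < δ →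
      ∀ {τ : ℝ}, τ ≠ 0 → ∀ {f h : Eucl n → ℂ}, Integrable f → Measurable f → Integrable h →
      Measurable h → ∀ {N M : ℝ}, 0 < N → 0 < M →
      ∫⁻ x, ENNReal.ofReal (‖f x‖ ^ r') ≤ ENNReal.ofReal (N ^ r') →
      ∫⁻ x, ENNReal.ofReal (‖h x‖ ^ r') ≤ ENNReal.ofReal (M ^ r') →
      ‖∫ ξ, regSymbol ε δ τ ξ * 𝓕 f ξ * starRingEnd ℂ (𝓕 h ξ)‖
        ≤ C * |τ| ^ (-((n : ℝ) * (1 / 2 - 1 / r))) * N * M := by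
  have hr0 : 0 < r := by linarith
  have hr2 : 0 < r - 2 := by linarith
  have hπ := Real.pi_pos
  have hconj : r.HolderConjugate r' := by
    rw [Real.holderConjugate_iff]
    exact ⟨by linarith, by simpa using hr'⟩
  set K : ℝ := r * (8 / (r - 2) * 2 ^ (r - 2)) with hK
  have hK0 : 0 < K := by positivity
  refine ⟨K ^ (1 / r) * Real.pi ^ ((n : ℝ) * (1 / 2 - 1 / r)), by positivity, ?_⟩
  intro ε hε δ hδ τ hτ f h hf hfm hh hhm N M hN hM hfN hhM
  have hτ' : 0 < |τ| := abs_pos.2 hτ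
  set A : ℝ := (Real.pi / |τ|) ^ ((n : ℝ) / 2) with hA
  have hA0 : 0 < A := by positivity
  have hT : ∫⁻ x, ENNReal.ofReal (‖regProp ε δ τ f x‖ ^ r)
      ≤ ENNReal.ofReal (r * (8 / (r - 2) * (2 * A) ^ (r - 2)) * N ^ r) := by
    refine lintegral_interpolation_le (T := regProp ε δ τ) hA0 hr hr' hN
      (fun f g hf hg => regProp_add ε hδ τ hf hg)
      (fun f hf => (continuous_fourierInv
        (integrable_regSymbol_mul ε hδ τ hf)).aestronglyMeasurable)
      (fun f hf y => ?_) (fun f hf => lintegral_regProp_sq_le ε hδ τ hf) hf hfm hfN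
    rw [← ofReal_norm, ← ofReal_integral_norm_eq_lintegral_enorm hf,
      ← ENNReal.ofReal_mul hA0.le]
    exact ENNReal.ofReal_le_ofReal (norm_regProp_le hε hδ hτ hf y)
  have hpair : ∫ ξ, regSymbol ε δ τ ξ * 𝓕 f ξ * starRingEnd ℂ (𝓕 h ξ)
      = ∫ x, regProp ε δ τ f x * starRingEnd ℂ (h x) := by
    have hh' : Integrable fun x => starRingEnd ℂ (h x) :=
      (LinearIsometryEquiv.integrable_comp_iff conjLIE).2 hh
    rw [regProp, integral_fourierInv_mul_eq (integrable_regSymbol_mul ε hδ τ hf) hh']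
    simp_rw [fourierInv_conj]
  rw [hpair]
  have hmT : Continuous (regProp ε δ τ f) := continuous_fourierInv
        (integrable_regSymbol_mul ε hδ τ hf)
  have hX : K ^ (1 / r) * Real.pi ^ ((n : ℝ) * (1 / 2 - 1 / r)) *
      |τ| ^ (-((n : ℝ) * (1 / 2 - 1 / r))) * N * M
      = (r * (8 / (r - 2) * (2 * A) ^ (r - 2)) * N ^ r) ^ (1 / r) * (M ^ r') ^ (1 / r') := by
    have e1 : r * (8 / (r - 2) * (2 * A) ^ (r - 2)) * N ^ r = K * A ^ (r - 2) * N ^ r := by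
      rw [Real.mul_rpow (by norm_num) hA0.le, hK]; ring
    rw [e1, Real.mul_rpow (x := K * A ^ (r - 2)) (by positivity) (by positivity),
      Real.mul_rpow (x := K) (by positivity) (by positivity), ← Real.rpow_mul hN.le,
      ← Real.rpow_mul hM.le, ← Real.rpow_mul hA0.le, hA, ← Real.rpow_mul (by positivity),
      mul_one_div_cancel hr0.ne', mul_one_div_cancel hconj.symm.pos.ne', Real.rpow_one,
      Real.rpow_one, Real.rpow_neg hτ'.le, ← div_eq_mul_inv, mul_div_assoc,
      ← Real.div_rpow hπ.le hτ'.le]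
    congr 4
    field_simp
  rw [hX]
  refine (norm_integral_le_lintegral_norm _).trans (ENNReal.toReal_le_of_le_ofReal
    (by positivity) ?_)
  have hH := ENNReal.lintegral_mul_le_Lp_mul_Lq (volume : Measure (Eucl n)) hconj
    (f := fun x => ‖regProp ε δ τ f x‖ₑ) (g := fun x => ‖h x‖ₑ)
    hmT.measurable.enorm.aemeasurable hhm.enorm.aemeasurable
  have e2 : ∀ {p : ℝ}, 0 < p → ∀ z : ℂ, ‖z‖ₑ ^ p = ENNReal.ofReal (‖z‖ ^ p) := fun hp z => by
    rw [← ofReal_norm, ENNReal.ofReal_rpow_of_nonneg (norm_nonneg _) hp.le]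
  simp_rw [e2 hr0, e2 hconj.symm.pos] at hH
  calc _ = ∫⁻ x, ((fun x => ‖regProp ε δ τ f x‖ₑ) * (fun x => ‖h x‖ₑ)) x := by
        refine lintegral_congr fun x => ?_
        rw [ofReal_norm, enorm_mul, RCLike.enorm_conj]; rfl
    _ ≤ _ := hH
    _ ≤ (ENNReal.ofReal (r * (8 / (r - 2) * (2 * A) ^ (r - 2)) * N ^ r)) ^ (1 / r) *
        (ENNReal.ofReal (M ^ r')) ^ (1 / r') := by
        have := hconj.symm.pos
        gcongr
    _ = _ := by
        have := hconj.symm.pos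
        rw [ENNReal.ofReal_rpow_of_nonneg (by positivity) (by positivity),
          ENNReal.ofReal_rpow_of_nonneg (by positivity) (by positivity),
          ENNReal.ofReal_mul (by positivity)]

theorem exists_dispersive_pairing_le {r r' : ℝ} (hr : 2 < r) (hr' : 1 / r + 1 / r' = 1) (n : ℕ) :
    ∃ C : ℝ, 0 < C ∧ ∀ {ε : Fin n → ℝ}, (∀ i, ε i = 1 ∨ ε i = -1) →
      ∀ {τ : ℝ}, τ ≠ 0 → ∀ {f h : Eucl n → ℂ}, Integrable f → Measurable f → Integrable h →
      Measurable h → Integrable (fun ξ => 𝓕 f ξ * starRingEnd ℂ (𝓕 h ξ)) →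
      ∀ {N M : ℝ}, 0 ≤ N → 0 ≤ M →
      ∫⁻ x, ENNReal.ofReal (‖f x‖ ^ r') ≤ ENNReal.ofReal (N ^ r') →
      ∫⁻ x, ENNReal.ofReal (‖h x‖ ^ r') ≤ ENNReal.ofReal (M ^ r') →
      ‖∫ ξ, cexp (I * τ * quadSym ε ξ) * (𝓕 f ξ * starRingEnd ℂ (𝓕 h ξ))‖
        ≤ C * |τ| ^ (-((n : ℝ) * (1 / 2 - 1 / r))) * N * M := by
  obtain ⟨C, hC, H⟩ := exists_regular_pairing_le hr hr' n
  refine ⟨C, hC, ?_⟩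
  intro ε hε τ hτ f h hf hfm hh hhm hInt N M hN hM hfN hhM
  have hr'0 : 0 < r' := by
    have h1 : 1 / r < 1 := by rw [div_lt_one (by linarith)]; linarith
    have : 0 < 1 / r' := by linarith
    exact one_div_pos.1 this
  have hlim : Tendsto (fun δ : ℝ => ∫ ξ, regSymbol ε δ τ ξ * 𝓕 f ξ * starRingEnd ℂ (𝓕 h ξ))
      (𝓝[>] 0) (𝓝 (∫ ξ, cexp (I * τ * quadSym ε ξ) * (𝓕 f ξ * starRingEnd ℂ (𝓕 h ξ)))) := by
    refine tendsto_integral_filter_of_dominated_convergence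
      (fun ξ => ‖𝓕 f ξ * starRingEnd ℂ (𝓕 h ξ)‖) ?_ ?_ hInt.norm ?_
    · refine Eventually.of_forall fun δ => ?_
      have h1 := continuous_fourier hf
      have h2 := continuous_fourier hh
      have h3 := continuous_regSymbol ε δ τ
      exact ((h3.mul h1).mul (Complex.continuous_conj.comp h2)).aestronglyMeasurable
    · filter_upwards [self_mem_nhdsWithin] with δ hδ
      refine Eventually.of_forall fun ξ => ?_
      rw [mul_assoc, norm_mul]
      exact mul_le_of_le_one_left (norm_nonneg _) (norm_regSymbol_le_one ε hδ τ ξ)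
    · refine Eventually.of_forall fun ξ => ?_
      have h1 : Continuous fun δ : ℝ => regSymbol ε δ τ ξ * 𝓕 f ξ * starRingEnd ℂ (𝓕 h ξ) := by
        unfold regSymbol; fun_prop
      have h2 := (h1.tendsto 0).mono_left (nhdsWithin_le_nhds (s := Set.Ioi 0))
      simpa [regSymbol, mul_assoc] using h2
  have hpos : ∀ η : ℝ, 0 < η →
      ‖∫ ξ, cexp (I * τ * quadSym ε ξ) * (𝓕 f ξ * starRingEnd ℂ (𝓕 h ξ))‖
        ≤ C * |τ| ^ (-((n : ℝ) * (1 / 2 - 1 / r))) * (N + η) * (M + η) := fun η hη => by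
    refine le_of_tendsto hlim.norm ?_
    filter_upwards [self_mem_nhdsWithin] with δ hδ
    refine H hε hδ hτ hf hfm hh hhm (by positivity) (by positivity) (hfN.trans ?_)
      (hhM.trans ?_)
    · exact ENNReal.ofReal_le_ofReal (Real.rpow_le_rpow hN (by linarith) hr'0.le)
    · exact ENNReal.ofReal_le_ofReal (Real.rpow_le_rpow hM (by linarith) hr'0.le)
  have hcont : Continuous fun η : ℝ =>
      C * |τ| ^ (-((n : ℝ) * (1 / 2 - 1 / r))) * (N + η) * (M + η) := by fun_prop
  have h2 := (hcont.tendsto 0).mono_left (nhdsWithin_le_nhds (s := Set.Ioi 0))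
  simp only [add_zero] at h2
  refine ge_of_tendsto h2 ?_
  filter_upwards [self_mem_nhdsWithin] with η hη using hpos η hη

end Dispersive

/-- Uniformly bounded and band-limited forcing terms `f s`, with Fourier transforms `g s` and with
`L^{r'}` norms controlled by `a s`. -/
structure BandlimitedSource {n : ℕ} (r' : ℝ) (f g : ℝ → Eucl n → ℂ) (a : ℝ → ℝ) (K R : ℝ) :
    Prop where
  integrable : ∀ s, Integrable (f s)
  measurable : ∀ s, Measurable (f s)
  fourier_eq : ∀ s, 𝓕 (f s) = g s
  measurable_fourier : Measurable fun p : ℝ × Eucl n => g p.1 p.2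
  bound : ∀ s ξ, ‖g s ξ‖ ≤ K
  supp : ∀ s ξ, R < ‖ξ‖ → g s ξ = 0
  measurable_size : Measurable a
  size_nonneg : ∀ s, 0 ≤ a s
  size : ∀ s, ∫⁻ x, ENNReal.ofReal (‖f s x‖ ^ r') ≤ ENNReal.ofReal (a s ^ r')

theorem holderConjugate_exponent {q q' : ℝ} (hq : 2 < q) (hq' : 1 / q + 1 / q' = 1) :
    2 / (2 - 2 / q) = q' ∧ 1 < q' ∧ q' < 2 := by
  have h1 : 0 < 1 / q := by positivity
  have h2 : 1 / q < 1 / 2 := by gcongr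
  have h3 : 1 / q' = 1 - 1 / q := by linarith
  have h4 : q' = 1 / (1 - 1 / q) := by rw [← h3, one_div_one_div]
  have h5 : 0 < 1 - 1 / q := by linarith
  refine ⟨?_, ?_, ?_⟩
  · rw [h4, show 2 - 2 / q = 2 * (1 - 1 / q) by ring]
    field_simp
  · rw [h4, lt_div_iff₀ h5]; linarith
  · rw [h4, div_lt_iff₀ h5]; linarith

set_option maxHeartbeats 1000000 in
theorem exists_dual_strichartz {n : ℕ} {q r q' r' : ℝ} (hq : 2 < q) (hr : 2 < r)
    (hadm : 2 / q = (n : ℝ) * (1 / 2 - 1 / r))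
    (hq' : 1 / q + 1 / q' = 1) (hr' : 1 / r + 1 / r' = 1) :
    ∃ C : ℝ, 0 < C ∧ ∀ {ε : Fin n → ℝ}, (∀ i, ε i = 1 ∨ ε i = -1) →
      ∀ {f g : ℝ → Eucl n → ℂ} {a : ℝ → ℝ} {K R : ℝ}, BandlimitedSource r' f g a K R →
      ∀ {b c A : ℝ}, 0 < A →
      ∫⁻ s in Set.Ioc b c, ENNReal.ofReal (a s ^ q') ≤ ENNReal.ofReal (A ^ q') →
      ∫⁻ ξ, ‖∫ s in Set.Ioc b c, cexp (I * s * quadSym ε ξ) * g s ξ‖ₑ ^ 2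
        ≤ ENNReal.ofReal (C * A ^ 2) := by
  obtain ⟨C, hC, H⟩ := exists_dispersive_pairing_le hr hr' n
  obtain ⟨hqq, hq1, hq2⟩ := holderConjugate_exponent hq hq'
  have hα0 : 0 < 2 / q := by positivity
  have hα1 : 2 / q < 1 := by rw [div_lt_one (by linarith)]; exact hq
  have h1α : 0 < 1 - 2 / q := by linarith
  refine ⟨C * (2 / (1 - 2 / q) + 4), by positivity, ?_⟩
  intro ε hε f g a K R hS b c A hA hAq
  set μ : Measure ℝ := volume.restrict (Set.Ioc b c) with hμ
  set ν : Measure (Eucl n) := volume.restrict (Metric.closedBall 0 R) with hν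
  have : IsFiniteMeasure μ := ⟨by simp [hμ]⟩
  have : IsFiniteMeasure ν := ⟨by simpa [hν] using measure_closedBall_lt_top⟩
  have hK : 0 ≤ K := (norm_nonneg _).trans (hS.bound 0 0)
  have hQ := measurable_quadSym (n := n) ε
  have hgm := hS.measurable_fourier
  set φ : Eucl n → ℝ → ℂ := fun ξ s => cexp (I * s * quadSym ε ξ) * g s ξ with hφ
  have hφm : Measurable fun p : Eucl n × ℝ => φ p.1 p.2 := by
    have : Measurable fun p : Eucl n × ℝ => g p.2 p.1 := hgm.comp measurable_swap
    simp only [hφ]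
    fun_prop
  have hexp : ∀ (s : ℝ) ξ, ‖cexp (I * s * quadSym ε ξ)‖ = 1 := fun s ξ => by
    rw [show I * (s : ℂ) * (quadSym ε ξ : ℂ) = ((s * quadSym ε ξ : ℝ) : ℂ) * I by push_cast; ring,
      norm_exp_ofReal_mul_I]
  have hφb : ∀ ξ s, ‖φ ξ s‖ ≤ K := fun ξ s => by
    simp only [hφ]
    rw [norm_mul, hexp, one_mul]
    exact hS.bound s ξ
  set S : Eucl n → ℂ := fun ξ => ∫ s, φ ξ s ∂μ with hSdef
  set G : Eucl n × (ℝ × ℝ) → ℂ := fun z => φ z.1 z.2.1 * starRingEnd ℂ (φ z.1 z.2.2) with hG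
  have hGm : Measurable G := by
    have m1 : Measurable fun z : Eucl n × (ℝ × ℝ) => (z.1, z.2.1) := by fun_prop
    have m2 : Measurable fun z : Eucl n × (ℝ × ℝ) => (z.1, z.2.2) := by fun_prop
    have h1 : Measurable ((fun p : Eucl n × ℝ => φ p.1 p.2) ∘
      fun z : Eucl n × (ℝ × ℝ) => (z.1, z.2.1)) := hφm.comp m1
    have h2 : Measurable ((fun p : Eucl n × ℝ => φ p.1 p.2) ∘
      fun z : Eucl n × (ℝ × ℝ) => (z.1, z.2.2)) := hφm.comp m2
    exact h1.mul (Complex.continuous_conj.measurable.comp h2)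
  have hGint : Integrable G (ν.prod (μ.prod μ)) := by
    refine Integrable.of_bound hGm.aestronglyMeasurable (K * K) (Eventually.of_forall fun z => ?_)
    simp only [hG]
    rw [norm_mul, RCLike.norm_conj]
    exact mul_le_mul (hφb _ _) (hφb _ _) (norm_nonneg _) hK
  have hSzero : ∀ ξ, ξ ∉ Metric.closedBall (0 : Eucl n) R → S ξ = 0 := fun ξ hξ => by
    have : R < ‖ξ‖ := by simpa using hξ
    simp [hSdef, hφ, hS.supp _ ξ this]
  have hSS : ∀ ξ, ((‖S ξ‖ ^ 2 : ℝ) : ℂ) = ∫ z, G (ξ, z) ∂(μ.prod μ) := fun ξ => by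
    rw [ofReal_pow, ← Complex.mul_conj', hSdef, ← integral_conj]
    simp only [hG]
    rw [integral_prod_mul (fun s => φ ξ s) (fun s => starRingEnd ℂ (φ ξ s))]
  set P : ℝ × ℝ → ℂ := fun z => ∫ ξ, G (ξ, z) ∂ν with hP
  have hPeq : ∀ z, P z = ∫ ξ, cexp (I * ((z.1 - z.2 : ℝ) : ℂ) * quadSym ε ξ) *
      (𝓕 (f z.1) ξ * starRingEnd ℂ (𝓕 (f z.2) ξ)) := fun z => by
    simp only [hP, hν]
    rw [setIntegral_eq_integral_of_forall_compl_eq_zero]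
    · refine integral_congr_ae (Eventually.of_forall fun ξ => ?_)
      simp only [hG, hφ, hS.fourier_eq, map_mul, ← Complex.exp_conj, conj_I, conj_ofReal]
      rw [show I * ((z.1 - z.2 : ℝ) : ℂ) * quadSym ε ξ = I * z.1 * quadSym ε ξ +
        -I * z.2 * quadSym ε ξ by push_cast; ring, Complex.exp_add]
      ring
    · intro ξ hξ
      have : R < ‖ξ‖ := by simpa using hξ
      simp [hG, hφ, hS.supp _ ξ this]
  have hPb : ∀ z : ℝ × ℝ, z.2 ≠ z.1 → ‖P z‖ₑ ≤ ENNReal.ofReal C * (ENNReal.ofReal (a z.1) *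
      ENNReal.ofReal (a z.2) * ENNReal.ofReal (|z.2 - z.1| ^ (-(2 / q)))) := fun z hz => by
    have hprod : Integrable (fun ξ => 𝓕 (f z.1) ξ * starRingEnd ℂ (𝓕 (f z.2) ξ)) := by
      have h1 : IntegrableOn (fun ξ => 𝓕 (f z.1) ξ * starRingEnd ℂ (𝓕 (f z.2) ξ))
          (Metric.closedBall 0 R) := by
        refine (Continuous.continuousOn ?_).integrableOn_compact (isCompact_closedBall 0 R)
        exact (continuous_fourier (hS.integrable _)).mul
          (Complex.continuous_conj.comp (continuous_fourier (hS.integrable _)))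
      refine (integrableOn_iff_integrable_of_support_subset fun ξ hξ => ?_).1 h1
      by_contra h
      refine hξ ?_
      have : R < ‖ξ‖ := by simpa using h
      simp [hS.fourier_eq, hS.supp _ ξ this]
    have h0 := hS.size_nonneg
    have := H hε (sub_ne_zero.2 hz.symm) (hS.integrable z.1) (hS.measurable z.1)
      (hS.integrable z.2) (hS.measurable z.2) hprod (h0 z.1) (h0 z.2) (hS.size z.1) (hS.size z.2)
    rw [← hPeq, ← hadm, abs_sub_comm] at this
    rw [← ofReal_norm, ← ENNReal.ofReal_mul (h0 _), ← ENNReal.ofReal_mul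
      (mul_nonneg (h0 _) (h0 _)), ← ENNReal.ofReal_mul hC.le]
    refine ENNReal.ofReal_le_ofReal (this.trans_eq ?_)
    ring
  have hmain : ∫⁻ ξ, ‖S ξ‖ₑ ^ 2 ≤ ∫⁻ z, ‖P z‖ₑ ∂(μ.prod μ) := by
    have hsq : Integrable (fun ξ => ‖S ξ‖ ^ 2) ν := by
      have := hGint.integral_prod_left
      have h2 := this.norm
      refine h2.congr (Eventually.of_forall fun ξ => ?_)
      simp only [← hSS]
      rw [norm_real, Real.norm_of_nonneg (sq_nonneg _)]
    have e1 : ∫⁻ ξ, ‖S ξ‖ₑ ^ 2 = ∫⁻ ξ, ENNReal.ofReal (‖S ξ‖ ^ 2) ∂ν := by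
      rw [hν, ← lintegral_indicator measurableSet_closedBall]
      refine lintegral_congr fun ξ => ?_
      by_cases h : ξ ∈ Metric.closedBall (0 : Eucl n) R
      · rw [Set.indicator_of_mem h, ENNReal.ofReal_pow (norm_nonneg _), ofReal_norm]
      · rw [Set.indicator_of_notMem h, hSzero ξ h]; simp
    rw [e1, ← ofReal_integral_eq_lintegral_ofReal hsq
      (Eventually.of_forall fun ξ => sq_nonneg _)]
    have e2 : ((∫ ξ, ‖S ξ‖ ^ 2 ∂ν : ℝ) : ℂ) = ∫ z, P z ∂(μ.prod μ) := by
      rw [← integral_complex_ofReal]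
      simp_rw [hSS]
      exact integral_integral_swap hGint
    have e3 : ∫ ξ, ‖S ξ‖ ^ 2 ∂ν = ‖∫ z, P z ∂(μ.prod μ)‖ := by
      rw [← e2, norm_real, Real.norm_of_nonneg (integral_nonneg fun ξ => sq_nonneg _)]
    rw [e3, ofReal_norm]
    exact enorm_integral_le_lintegral_enorm _
  refine hmain.trans ((lintegral_prod_le _).trans ?_)
  set a' : ℝ → ℝ := (Set.Ioc b c).indicator a with ha'
  have hhls := lintegral_hls_le hα0 hα1 (a := a')
    (hS.measurable_size.indicator measurableSet_Ioc)
    (fun s => Set.indicator_nonneg (fun s _ => hS.size_nonneg s) s) hA (by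
      rw [hqq]
      refine le_of_eq_of_le ?_ hAq
      rw [← lintegral_indicator measurableSet_Ioc]
      refine lintegral_congr fun s => ?_
      by_cases h : s ∈ Set.Ioc b c
      · simp only [ha', Set.indicator_of_mem h]
      · simp only [ha', Set.indicator_of_notMem h]
        rw [Real.zero_rpow (by linarith), ENNReal.ofReal_zero])
  rw [mul_assoc, ENNReal.ofReal_mul hC.le]
  refine le_trans ?_ (mul_le_mul_right hhls (ENNReal.ofReal C))
  rw [← lintegral_const_mul' _ _ ENNReal.ofReal_ne_top]
  refine le_trans (setLIntegral_mono_ae' measurableSet_Ioc ?_) (setLIntegral_le_lintegral _ _)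
  refine Eventually.of_forall fun s hs => ?_
  rw [← lintegral_const_mul' _ _ ENNReal.ofReal_ne_top]
  refine le_trans (setLIntegral_mono_ae' measurableSet_Ioc ?_) (setLIntegral_le_lintegral _ _)
  filter_upwards
    [measure_eq_zero_iff_ae_notMem.1 (measure_singleton (μ := volume) s)] with s' hs' hs2
  have := hPb (s, s') (by simpa using hs')
  simpa only [ha', Set.indicator_of_mem hs, Set.indicator_of_mem hs2] using this

/-- A quantity that is almost superadditive up to a `p`-th power (`p > 1`) of a mass is controlled
by the `p`-th power of the total mass, by iterated bisection of the mass. -/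
theorem exists_mass_bisection_le {p : ℝ} (hp : 1 < p) :
    ∃ C : ℝ, 0 < C ∧ ∀ {Φ : ℝ → ℝ → ℝ≥0∞} {W : ℝ → ℝ} {T B D : ℝ}, 0 ≤ T → 0 ≤ B → 0 ≤ D →
      ContinuousOn W (Set.Icc 0 T) → MonotoneOn W (Set.Icc 0 T) →
      (∀ a b, 0 ≤ a → a ≤ b → b ≤ T → Φ a b ≤ ENNReal.ofReal (B * (W b - W a) ^ p)) →
      (∀ η : ℝ, 0 < η → ∀ a c b, 0 ≤ a → a ≤ c → c ≤ b → b ≤ T → Φ a b ≤ Φ a c +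
        (ENNReal.ofReal (1 + η) * Φ c b +
          ENNReal.ofReal ((1 + 1 / η) * (D * (W c - W a) ^ p)))) →
      Φ 0 T ≤ ENNReal.ofReal (C * D * (W T - W 0) ^ p) := by
  have h2p : (2 : ℝ) < 2 ^ p := by
    simpa using Real.rpow_lt_rpow_of_exponent_lt (one_lt_two) hp
  set P : ℝ := 2 ^ p with hP
  set η : ℝ := (P - 2) / 2 with hη
  have hη0 : 0 < η := by rw [hη]; linarith
  have hP0 : 0 < P := by linarith
  set θ : ℝ := (2 + η) / P with hθ
  have hθ0 : 0 ≤ θ := by positivity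
  have hθ1 : θ < 1 := by rw [hθ, div_lt_one hP0, hη]; linarith
  have h1θ : 0 < 1 - θ := by linarith
  refine ⟨(1 + 1 / η) / P / (1 - θ), by positivity, ?_⟩
  intro Φ W T B D hT hB hD hWc hWm h0 hs
  set X : ℝ := (1 + 1 / η) / P / (1 - θ) * D with hX
  have hX0 : 0 ≤ X := by positivity
  have hXr : θ * X + (1 + 1 / η) / P * D = X := by
    rw [hX]; field_simp; ring
  have hind : ∀ k : ℕ, ∀ a b, 0 ≤ a → a ≤ b → b ≤ T →
      Φ a b ≤ ENNReal.ofReal ((θ ^ k * B + X) * (W b - W a) ^ p) := by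
    intro k
    induction k with
    | zero =>
      intro a b ha hab hb
      have hW : 0 ≤ W b - W a :=
        sub_nonneg.2 (hWm ⟨ha, hab.trans hb⟩ ⟨ha.trans hab, hb⟩ hab)
      refine (h0 a b ha hab hb).trans (ENNReal.ofReal_le_ofReal ?_)
      have := mul_nonneg hX0 (Real.rpow_nonneg hW p)
      rw [pow_zero, one_mul, add_mul]; linarith
    | succ k ih =>
      intro a b ha hab hb
      have hsub : Set.Icc a b ⊆ Set.Icc 0 T := Set.Icc_subset_Icc ha hb
      have hW : 0 ≤ W b - W a :=
        sub_nonneg.2 (hWm ⟨ha, hab.trans hb⟩ ⟨ha.trans hab, hb⟩ hab)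
      obtain ⟨c, hc, hWc'⟩ := intermediate_value_Icc hab (hWc.mono hsub)
        (show (W a + W b) / 2 ∈ Set.Icc (W a) (W b) from ⟨by linarith, by linarith⟩)
      have e1 : W c - W a = (W b - W a) / 2 := by rw [hWc']; ring
      have e2 : W b - W c = (W b - W a) / 2 := by rw [hWc']; ring
      have e3 : ((W b - W a) / 2) ^ p = (W b - W a) ^ p / P := by
        rw [Real.div_rpow hW (by norm_num), hP]
      set w := (W b - W a) ^ p with hw
      have hw0 : 0 ≤ w := Real.rpow_nonneg hW p
      have i1 := ih a c ha hc.1 (hc.2.trans hb)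
      have i2 := ih c b (ha.trans hc.1) hc.2 hb
      rw [e1, e3] at i1
      rw [e2, e3] at i2
      have i3 := hs η hη0 a c b ha hc.1 hc.2 hb
      rw [e1, e3] at i3
      refine i3.trans ((add_le_add i1 (add_le_add (mul_le_mul_right i2 _) le_rfl)).trans ?_)
      have hk : 0 ≤ θ ^ k * B + X := by positivity
      rw [← ENNReal.ofReal_mul (by positivity), ← ENNReal.ofReal_add (by positivity)
        (by positivity), ← ENNReal.ofReal_add (by positivity) (by positivity)]
      refine ENNReal.ofReal_le_ofReal (le_of_eq ?_)
      have : (θ ^ (k + 1) * B + X) = θ * (θ ^ k * B + X) + (1 + 1 / η) / P * D := by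
        rw [pow_succ]; linear_combination -hXr
      rw [this]
      rw [hθ]; field_simp; ring
  have hlim : Tendsto (fun k : ℕ => ENNReal.ofReal ((θ ^ k * B + X) * (W T - W 0) ^ p)) atTop
      (𝓝 (ENNReal.ofReal ((0 * B + X) * (W T - W 0) ^ p))) := by
    refine ENNReal.tendsto_ofReal ?_
    exact (((tendsto_pow_atTop_nhds_zero_of_lt_one hθ0 hθ1).mul_const B).add_const X).mul_const _
  rw [zero_mul, zero_add] at hlim
  exact ge_of_tendsto' hlim fun k => hind k 0 T le_rfl hT le_rfl

section RetardedEvolution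

variable {n : ℕ}

/-- The retarded evolution started at time `c`, localised by the multiplier `m`, on the Fourier
side. -/
def retarded (ε : Fin n → ℝ) (m : Eucl n → ℂ) (g : ℝ → Eucl n → ℂ) (c t : ℝ) (ξ : Eucl n) : ℂ :=
  m ξ * ∫ s in Set.Ioc c t, cexp (-I * ((t - s : ℝ) : ℂ) * quadSym ε ξ) * g s ξ

theorem norm_cexp_neg_I_mul (x y : ℝ) : ‖cexp (-I * (x : ℂ) * (y : ℂ))‖ = 1 := by
  rw [show -I * (x : ℂ) * (y : ℂ) = ((-(x * y) : ℝ) : ℂ) * I by push_cast; ring,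
    norm_exp_ofReal_mul_I]

theorem norm_cexp_I_mul (x y : ℝ) : ‖cexp (I * (x : ℂ) * (y : ℂ))‖ = 1 := by
  rw [show I * (x : ℂ) * (y : ℂ) = ((x * y : ℝ) : ℂ) * I by push_cast; ring,
    norm_exp_ofReal_mul_I]

theorem integrable_of_bandlimited {φ : Eucl n → ℂ} {M R : ℝ} (hφ : Measurable φ)
    (hM : ∀ ξ, ‖φ ξ‖ ≤ M) (hR : ∀ ξ, R < ‖ξ‖ → φ ξ = 0) : Integrable φ := by
  have h1 : IntegrableOn φ (Metric.closedBall 0 R) :=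
    Measure.integrableOn_of_bounded measure_closedBall_lt_top.ne hφ.aestronglyMeasurable
      (Eventually.of_forall hM)
  refine (integrableOn_iff_integrable_of_support_subset fun ξ hξ => ?_).1 h1
  by_contra h
  exact hξ (hR ξ (by simpa using h))

theorem lintegral_sq_le_of_bandlimited {φ : Eucl n → ℂ} {M R : ℝ}
    (hM : ∀ ξ, ‖φ ξ‖ ≤ M) (hR : ∀ ξ, R < ‖ξ‖ → φ ξ = 0) :
    ∫⁻ ξ, ‖φ ξ‖ₑ ^ 2 ≤
      ENNReal.ofReal (M ^ 2) * volume (Metric.closedBall (0 : Eucl n) R) := by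
  have hM0 : 0 ≤ M := (norm_nonneg _).trans (hM 0)
  rw [← setLIntegral_const, ← lintegral_indicator measurableSet_closedBall]
  refine lintegral_mono fun ξ => ?_
  by_cases h : ξ ∈ Metric.closedBall (0 : Eucl n) R
  · rw [Set.indicator_of_mem h, ← ofReal_norm, ← ENNReal.ofReal_pow (norm_nonneg _)]
    exact ENNReal.ofReal_le_ofReal (pow_le_pow_left₀ (norm_nonneg _) (hM ξ) 2)
  · rw [hR ξ (by simpa using h)]; simp

variable {ε : Fin n → ℝ} {r' : ℝ} {f g : ℝ → Eucl n → ℂ} {a : ℝ → ℝ} {K R : ℝ}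
  {m : Eucl n → ℂ} {B : ℝ}

theorem BandlimitedSource.measurable_integral (hS : BandlimitedSource r' f g a K R)
    {k : Eucl n → ℝ → ℂ} (hk : Measurable fun z : Eucl n × ℝ => k z.1 z.2) (b c : ℝ) :
    Measurable fun ξ => ∫ s in Set.Ioc b c, k ξ s * g s ξ := by
  have h1 : Measurable fun z : Eucl n × ℝ => g z.2 z.1 :=
    hS.measurable_fourier.comp measurable_swap
  exact (StronglyMeasurable.integral_prod_right (ν := volume.restrict (Set.Ioc b c))
    (f := fun ξ s => k ξ s * g s ξ) (hk.mul h1).stronglyMeasurable).measurable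

theorem BandlimitedSource.norm_integral_le (hS : BandlimitedSource r' f g a K R)
    {k : ℝ → ℂ} (hk : ∀ s, ‖k s‖ = 1) {b c : ℝ} (hbc : b ≤ c) (ξ : Eucl n) :
    ‖∫ s in Set.Ioc b c, k s * g s ξ‖ ≤ K * (c - b) := by
  have := norm_setIntegral_le_of_norm_le_const (μ := volume) (s := Set.Ioc b c)
    (f := fun s => k s * g s ξ) (C := K) (by simp) fun s _ => by
      rw [norm_mul, hk, one_mul]; exact hS.bound s ξ
  simpa [hbc] using this

theorem BandlimitedSource.integrableOn (hS : BandlimitedSource r' f g a K R)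
    {k : ℝ → ℂ} (hkm : Measurable k) (hk : ∀ s, ‖k s‖ = 1) (b c : ℝ) (ξ : Eucl n) :
    IntegrableOn (fun s => k s * g s ξ) (Set.Ioc b c) := by
  have h1 : Measurable fun s => g s ξ := hS.measurable_fourier.comp measurable_prodMk_right
  refine Measure.integrableOn_of_bounded (M := K) (by simp) (hkm.mul h1).aestronglyMeasurable
    (Eventually.of_forall fun s => ?_)
  rw [norm_mul, hk, one_mul]; exact hS.bound s ξ

theorem measurable_retarded (hS : BandlimitedSource r' f g a K R) (hm : Measurable m) (c t : ℝ) :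
    Measurable (retarded ε m g c t) := by
  have hQ := measurable_quadSym (n := n) ε
  refine hm.mul (hS.measurable_integral ?_ c t)
  fun_prop

theorem norm_retarded_le (hS : BandlimitedSource r' f g a K R) (hmB : ∀ ξ, ‖m ξ‖ ≤ B) {c t : ℝ}
    (hct : c ≤ t) (ξ : Eucl n) : ‖retarded ε m g c t ξ‖ ≤ B * (K * (t - c)) := by
  rw [retarded, norm_mul]
  exact mul_le_mul (hmB ξ) (hS.norm_integral_le (fun s => norm_cexp_neg_I_mul _ _) hct ξ)
    (norm_nonneg _) ((norm_nonneg _).trans (hmB ξ))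

theorem retarded_supp (hS : BandlimitedSource r' f g a K R) (c t : ℝ) (ξ : Eucl n)
    (hξ : R < ‖ξ‖) : retarded ε m g c t ξ = 0 := by
  simp [retarded, hS.supp _ ξ hξ]

theorem integrable_retarded (hS : BandlimitedSource r' f g a K R) (hm : Measurable m)
    (hmB : ∀ ξ, ‖m ξ‖ ≤ B) {c t : ℝ} (hct : c ≤ t) : Integrable (retarded ε m g c t) :=
  integrable_of_bandlimited (measurable_retarded hS hm c t) (norm_retarded_le hS hmB hct)
    (retarded_supp hS c t)

theorem retarded_split (hS : BandlimitedSource r' f g a K R) {b c t : ℝ} (hbc : b ≤ c)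
    (hct : c ≤ t) (ξ : Eucl n) :
    retarded ε m g b t ξ = cexp (-I * t * quadSym ε ξ) *
      (m ξ * ∫ s in Set.Ioc b c, cexp (I * s * quadSym ε ξ) * g s ξ) +
      retarded ε m g c t ξ := by
  have hInt : ∀ u v : ℝ, IntegrableOn
      (fun s : ℝ => cexp (-I * ((t - s : ℝ) : ℂ) * quadSym ε ξ) * g s ξ) (Set.Ioc u v) :=
    fun u v => hS.integrableOn (by fun_prop) (fun s => norm_cexp_neg_I_mul _ _) u v ξ
  rw [retarded, retarded, ← Set.Ioc_union_Ioc_eq_Ioc hbc hct,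
    setIntegral_union (Set.Ioc_disjoint_Ioc_of_le le_rfl) measurableSet_Ioc (hInt b c) (hInt c t),
    mul_add, mul_left_comm, ← integral_const_mul (cexp (-I * t * quadSym ε ξ))]
  congr 3
  ext s
  rw [← mul_assoc, ← Complex.exp_add]
  congr 2
  push_cast; ring

/-- The square of the local smoothing norm of the retarded evolution over a time interval. -/
def smoothingSq (ε : Fin n → ℝ) (m : Eucl n → ℂ) (g : ℝ → Eucl n → ℂ) (e : Eucl n) (ρ : ℝ)
    (b c : ℝ) : ℝ≥0∞ :=
  ∫⁻ p in Set.Ioc b c ×ˢ (Set.univ : Set (hyperplane e)),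
    ‖𝓕⁻ (retarded ε m g b p.1) (ρ • e + (p.2 : Eucl n))‖ₑ ^ 2

theorem smoothingSq_le (hS : BandlimitedSource r' f g a K R) (hm : Measurable m)
    (hmB : ∀ ξ, ‖m ξ‖ ≤ B) {e : Eucl n} (he : ‖e‖ = 1) (ρ b c : ℝ) :
    smoothingSq ε m g e ρ b c ≤ ENNReal.ofReal (c - b) * (ENNReal.ofReal (2 * R) *
      (ENNReal.ofReal ((B * (K * (c - b))) ^ 2) * volume (Metric.closedBall (0 : Eucl n) R))) := by
  have hK : 0 ≤ K := (norm_nonneg _).trans (hS.bound 0 0)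
  have hB : 0 ≤ B := (norm_nonneg _).trans (hmB 0)
  rw [smoothingSq, Measure.volume_eq_prod, ← Measure.prod_restrict, Measure.restrict_univ]
  refine (lintegral_prod_le _).trans ?_
  have : ∀ t ∈ Set.Ioc b c, ∫⁻ v : hyperplane e,
      ‖𝓕⁻ (retarded ε m g b t) (ρ • e + (v : Eucl n))‖ₑ ^ 2 ≤ ENNReal.ofReal (2 * R) *
      (ENNReal.ofReal ((B * (K * (c - b))) ^ 2) * volume (Metric.closedBall (0 : Eucl n) R)) :=
    fun t ht => by
      refine (lintegral_hyperplane_fourierInv_le he (integrable_retarded hS hm hmB ht.1.le)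
        (retarded_supp hS b t) ρ).trans (mul_le_mul_right ?_ _)
      refine lintegral_sq_le_of_bandlimited (fun ξ => ?_) (retarded_supp hS b t)
      refine (norm_retarded_le hS hmB ht.1.le ξ).trans ?_
      have := ht.2
      gcongr
  refine (setLIntegral_mono' measurableSet_Ioc this).trans ?_
  rw [setLIntegral_const, Real.volume_Ioc, mul_comm]

theorem enorm_add_sq_le (x y : ℂ) {η : ℝ} (hη : 0 < η) :
    ‖x + y‖ₑ ^ 2 ≤ ENNReal.ofReal (1 + 1 / η) * ‖x‖ₑ ^ 2 + ENNReal.ofReal (1 + η) * ‖y‖ₑ ^ 2 := by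
  simp only [← ofReal_norm]
  rw [← ENNReal.ofReal_pow (norm_nonneg _), ← ENNReal.ofReal_pow (norm_nonneg _),
    ← ENNReal.ofReal_pow (norm_nonneg _), ← ENNReal.ofReal_mul (by positivity),
    ← ENNReal.ofReal_mul (by positivity), ← ENNReal.ofReal_add (by positivity) (by positivity)]
  refine ENNReal.ofReal_le_ofReal ?_
  have h1 : ‖x + y‖ ^ 2 ≤ (‖x‖ + ‖y‖) ^ 2 :=
    pow_le_pow_left₀ (norm_nonneg _) (norm_add_le x y) 2
  refine h1.trans ?_
  have h2 : (1 + 1 / η) * ‖x‖ ^ 2 + (1 + η) * ‖y‖ ^ 2 - (‖x‖ + ‖y‖) ^ 2 =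
      (1 / η) * (‖x‖ - η * ‖y‖) ^ 2 := by field_simp; ring
  have h3 : 0 ≤ (1 / η) * (‖x‖ - η * ‖y‖) ^ 2 := by positivity
  linarith

theorem smoothingSq_split_le (hS : BandlimitedSource r' f g a K R) (hm : Measurable m)
    (hmB : ∀ ξ, ‖m ξ‖ ≤ B) {e : Eucl n} (he : ‖e‖ = 1) (ρ : ℝ) {κ : ℝ} (hκ : 0 < κ)
    (hmκ : ∀ ξ, |⟪ξ, epm ε e⟫| < κ → m ξ = 0) {η : ℝ} (hη : 0 < η) {b c d : ℝ} (hbc : b ≤ c)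
    (hcd : c ≤ d) :
    smoothingSq ε m g e ρ b d ≤ smoothingSq ε m g e ρ b c +
      (ENNReal.ofReal (1 + η) * smoothingSq ε m g e ρ c d +
        ENNReal.ofReal (1 + 1 / η) * (ENNReal.ofReal (2 * Real.pi / κ) * (ENNReal.ofReal (B ^ 2) *
          ∫⁻ ξ, ‖∫ s in Set.Ioc b c, cexp (I * s * quadSym ε ξ) * g s ξ‖ₑ ^ 2))) := by
  have hB : 0 ≤ B := (norm_nonneg _).trans (hmB 0)
  have hQ := measurable_quadSym (n := n) ε
  set S : Eucl n → ℂ := fun ξ => ∫ s in Set.Ioc b c, cexp (I * s * quadSym ε ξ) * g s ξ with hSd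
  have hSm : Measurable S := hS.measurable_integral (by fun_prop) b c
  have hφm : Measurable fun ξ => m ξ * S ξ := hm.mul hSm
  have hφb : ∀ ξ, ‖m ξ * S ξ‖ ≤ B * (K * (c - b)) := fun ξ => by
    rw [norm_mul]
    exact mul_le_mul (hmB ξ) (hS.norm_integral_le (fun s => norm_cexp_I_mul _ _) hbc ξ)
      (norm_nonneg _) hB
  have hφR : ∀ ξ, R < ‖ξ‖ → m ξ * S ξ = 0 := fun ξ hξ => by simp [hSd, hS.supp _ ξ hξ]
  have hφi : Integrable fun ξ => m ξ * S ξ := integrable_of_bandlimited hφm hφb hφR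
  have hφi' : ∀ t : ℝ, Integrable fun ξ => cexp (-I * t * quadSym ε ξ) * (m ξ * S ξ) := fun t =>
    integrable_of_bandlimited (by fun_prop) (fun ξ => by
      rw [norm_mul, norm_cexp_neg_I_mul, one_mul]; exact hφb ξ)
      (fun ξ hξ => by rw [hφR ξ hξ, mul_zero])
  set F : ℝ × hyperplane e → ℂ := fun p =>
    𝓕⁻ (fun ξ => cexp (-I * p.1 * quadSym ε ξ) * (m ξ * S ξ)) (ρ • e + (p.2 : Eucl n)) with hF
  have hFm : Measurable F := by
    have : F = fun p => ∫ ξ, cexp (((2 * Real.pi * ⟪ξ, ρ • e + (p.2 : Eucl n)⟫ : ℝ) : ℂ) * I) *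
        (cexp (-I * p.1 * quadSym ε ξ) * (m ξ * S ξ)) := by
      ext p; simp only [hF]; rw [Real.fourierInv_eq']; rfl
    rw [this]
    refine (StronglyMeasurable.integral_prod_right (ν := volume)
      (f := fun (p : ℝ × hyperplane e) (ξ : Eucl n) =>
        cexp (((2 * Real.pi * ⟪ξ, ρ • e + (p.2 : Eucl n)⟫ : ℝ) : ℂ) * I) *
        (cexp (-I * p.1 * quadSym ε ξ) * (m ξ * S ξ))) ?_).measurable
    refine Measurable.stronglyMeasurable ?_
    have h1 : Continuous fun z : (ℝ × hyperplane e) × Eucl n =>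
        ⟪z.2, ρ • e + (z.1.2 : Eucl n)⟫ := by fun_prop
    have h2 := h1.measurable
    have h3 : Measurable fun z : (ℝ × hyperplane e) × Eucl n => m z.2 * S z.2 :=
      hφm.comp measurable_snd
    have h4 : Measurable fun z : (ℝ × hyperplane e) × Eucl n => quadSym ε z.2 :=
      hQ.comp measurable_snd
    simp only [Function.uncurry_def]
    refine Measurable.mul ?_ (Measurable.mul ?_ h3)
    · exact Complex.measurable_exp.comp
        ((Complex.measurable_ofReal.comp (h2.const_mul (2 * Real.pi))).mul_const I)
    · refine Complex.measurable_exp.comp (Measurable.mul ?_ (Complex.measurable_ofReal.comp h4))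
      fun_prop
  have hsplit : ∀ p ∈ Set.Ioc c d ×ˢ (Set.univ : Set (hyperplane e)),
      ‖𝓕⁻ (retarded ε m g b p.1) (ρ • e + (p.2 : Eucl n))‖ₑ ^ 2 ≤
      ENNReal.ofReal (1 + 1 / η) * ‖F p‖ₑ ^ 2 + ENNReal.ofReal (1 + η) *
      ‖𝓕⁻ (retarded ε m g c p.1) (ρ • e + (p.2 : Eucl n))‖ₑ ^ 2 := fun p hp => by
    have hp1 : c ≤ p.1 := hp.1.1.le
    have : 𝓕⁻ (retarded ε m g b p.1) (ρ • e + (p.2 : Eucl n)) =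
        F p + 𝓕⁻ (retarded ε m g c p.1) (ρ • e + (p.2 : Eucl n)) := by
      have h1 : retarded ε m g b p.1 = fun ξ => cexp (-I * p.1 * quadSym ε ξ) * (m ξ * S ξ) +
          retarded ε m g c p.1 ξ := by
        ext ξ; exact retarded_split hS hbc hp1 ξ
      have i1 := (Real.fourierIntegral_convergent_iff (-(ρ • e + (p.2 : Eucl n)))).2 (hφi' p.1)
      have i2 := (Real.fourierIntegral_convergent_iff (-(ρ • e + (p.2 : Eucl n)))).2
        (integrable_retarded (ε := ε) hS hm hmB hp1)
      simp only [inner_neg_right, neg_neg] at i1 i2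
      rw [h1, hF]
      simp only [Real.fourierInv_eq, smul_add]
      exact integral_add i1 i2
    rw [this]
    exact enorm_add_sq_le _ _ hη
  have hunion : Set.Ioc b d ×ˢ (Set.univ : Set (hyperplane e)) =
      Set.Ioc b c ×ˢ Set.univ ∪ Set.Ioc c d ×ˢ Set.univ := by
    rw [← Set.union_prod, Set.Ioc_union_Ioc_eq_Ioc hbc hcd]
  unfold smoothingSq
  rw [hunion]
  refine (lintegral_union_le _ _ _).trans (add_le_add le_rfl ?_)
  refine (setLIntegral_mono' (measurableSet_Ioc.prod MeasurableSet.univ) hsplit).trans ?_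
  rw [lintegral_add_left ((hFm.enorm.pow_const 2).const_mul _), add_comm]
  rw [lintegral_const_mul' _ _ ENNReal.ofReal_ne_top,
    lintegral_const_mul' _ _ ENNReal.ofReal_ne_top]
  refine add_le_add le_rfl (mul_le_mul_right ?_ _)
  refine (setLIntegral_le_lintegral _ _).trans ?_
  refine (lintegral_hyperplane_evolution_le ε he hκ hφi
    (fun ξ hξ => by rw [hmκ ξ hξ, zero_mul]) ρ).trans (mul_le_mul_right ?_ _)
  rw [← lintegral_const_mul' _ _ ENNReal.ofReal_ne_top]
  refine lintegral_mono fun ξ => ?_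
  simp only
  rw [enorm_mul, mul_pow]
  refine mul_le_mul_left ?_ _
  rw [← ofReal_norm, ← ENNReal.ofReal_pow (norm_nonneg _)]
  exact ENNReal.ofReal_le_ofReal (pow_le_pow_left₀ (norm_nonneg _) (hmB ξ) 2)

end RetardedEvolution

section Smoothing

theorem mass_sub_eq {W : ℝ → ℝ} {k : ℝ → ℝ} (hk : LocallyIntegrable k)
    (hW : ∀ x, W x = ∫ s in (0 : ℝ)..x, k s) {b c : ℝ} (hbc : b ≤ c) :
    W c - W b = ∫ s in Set.Ioc b c, k s := by
  have hi : ∀ x y, IntervalIntegrable k volume x y := fun x y =>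
    (hk.integrableOn_isCompact isCompact_uIcc).intervalIntegrable
  rw [hW, hW, intervalIntegral.integral_interval_sub_left (hi _ _) (hi _ _),
    intervalIntegral.integral_of_le hbc]

theorem exists_smoothingSq_le {n : ℕ} {q r q' r' : ℝ} (hq : 2 < q) (hr : 2 < r)
    (hadm : 2 / q = (n : ℝ) * (1 / 2 - 1 / r))
    (hq' : 1 / q + 1 / q' = 1) (hr' : 1 / r + 1 / r' = 1) :
    ∃ C : ℝ, 0 < C ∧ ∀ {ε : Fin n → ℝ}, (∀ i, ε i = 1 ∨ ε i = -1) →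
      ∀ {f g : ℝ → Eucl n → ℂ} {a : ℝ → ℝ} {K R : ℝ}, BandlimitedSource r' f g a K R →
      ∀ {m : Eucl n → ℂ} {B : ℝ}, Measurable m → (∀ ξ, ‖m ξ‖ ≤ B) →
      ∀ {e : Eucl n}, ‖e‖ = 1 → ∀ {κ : ℝ}, 0 < κ →
      (∀ ξ, |⟪ξ, epm ε e⟫| < κ → m ξ = 0) →
      ∀ {A : ℝ}, 0 < A → ∫⁻ s, ENNReal.ofReal (a s ^ q') ≤ ENNReal.ofReal (A ^ q') →
      ∀ (ρ : ℝ) {T : ℝ}, 0 ≤ T →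
        smoothingSq ε m g e ρ 0 T ≤ ENNReal.ofReal (C / κ * B ^ 2 * A ^ 2) := by
  obtain ⟨-, hq1, hq2⟩ := holderConjugate_exponent hq hq'
  have hq0 : 0 < q' := by linarith
  set p : ℝ := 2 / q' with hp
  have hp1 : 1 < p := by rw [hp, one_lt_div hq0]; exact hq2
  have hp2 : p < 2 := by rw [hp, div_lt_iff₀ hq0]; linarith
  have hp0 : 0 < p := by linarith
  obtain ⟨C₁, hC₁, H₁⟩ := exists_dual_strichartz hq hr hadm hq' hr'
  obtain ⟨C₂, hC₂, H₂⟩ := exists_mass_bisection_le hp1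
  have hπ := Real.pi_pos
  refine ⟨C₂ * C₁ * (2 * Real.pi), by positivity, ?_⟩
  intro ε hε f g a K R hS m B hm hmB e he κ hκ hmκ A hA hAq ρ T hT
  have hK : 0 ≤ K := (norm_nonneg _).trans (hS.bound 0 0)
  have hB : 0 ≤ B := (norm_nonneg _).trans (hmB 0)
  have haq0 : ∀ s, 0 ≤ a s ^ q' := fun s => Real.rpow_nonneg (hS.size_nonneg s) _
  have haqm : Measurable fun s => a s ^ q' := hS.measurable_size.pow_const q'
  have haqi : Integrable fun s => a s ^ q' :=
    (lintegral_ofReal_ne_top_iff_integrable haqm.aestronglyMeasurable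
      (Eventually.of_forall haq0)).1 (hAq.trans_lt ENNReal.ofReal_lt_top).ne
  have hδ : ∀ δ : ℝ, 0 < δ → smoothingSq ε m g e ρ 0 T ≤
      ENNReal.ofReal (C₂ * (2 * Real.pi / κ * (B ^ 2 * C₁)) * (A ^ q' + δ * T) ^ p) := by
    intro δ hδ
    set k : ℝ → ℝ := fun s => a s ^ q' + δ with hk
    have hki : LocallyIntegrable k :=
      haqi.locallyIntegrable.add (locallyIntegrable_const δ)
    set W : ℝ → ℝ := fun x => ∫ s in (0 : ℝ)..x, k s with hW
    have hWe : ∀ {b c : ℝ}, b ≤ c → W c - W b = (∫ s in Set.Ioc b c, a s ^ q') + δ * (c - b) :=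
      fun {b c} hbc => by
        rw [mass_sub_eq hki (fun x => rfl) hbc, hk,
          integral_add haqi.integrableOn (integrable_const δ), setIntegral_const, smul_eq_mul]
        simp [hbc, mul_comm]
    have hint0 : ∀ b c : ℝ, 0 ≤ ∫ s in Set.Ioc b c, a s ^ q' := fun b c =>
      setIntegral_nonneg measurableSet_Ioc fun s _ => haq0 s
    have hWδ : ∀ {b c : ℝ}, b ≤ c → δ * (c - b) ≤ W c - W b := fun {b c} hbc => by
      rw [hWe hbc]; linarith [hint0 b c]
    have hW0 : ∀ {b c : ℝ}, b ≤ c → 0 ≤ W c - W b := fun {b c} hbc =>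
      (mul_nonneg hδ.le (sub_nonneg.2 hbc)).trans (hWδ hbc)
    set L : ℝ := 2 * |R| * ((B * K) ^ 2 * (volume (Metric.closedBall (0 : Eucl n) R)).toReal)
      with hL
    have hL0 : 0 ≤ L := by positivity
    have key := H₂ (Φ := smoothingSq ε m g e ρ) (W := W) (T := T)
      (B := T ^ (3 - p) * L * (δ ^ p)⁻¹) (D := 2 * Real.pi / κ * (B ^ 2 * C₁)) hT
      (by positivity) (by positivity)
      (intervalIntegral.continuous_primitive (fun x y =>
        (hki.integrableOn_isCompact isCompact_uIcc).intervalIntegrable) 0).continuousOn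
      (fun x _ y _ hxy => sub_nonneg.1 (hW0 hxy)) ?_ ?_
    · refine key.trans (ENNReal.ofReal_le_ofReal ?_)
      have h1 : W T - W 0 ≤ A ^ q' + δ * T := by
        rw [hWe hT, sub_zero]
        have h2 : ∫ s in Set.Ioc 0 T, a s ^ q' ≤ A ^ q' := by
          refine (setIntegral_le_integral haqi (Eventually.of_forall haq0)).trans ?_
          rw [integral_eq_lintegral_of_nonneg_ae (Eventually.of_forall haq0)
            haqm.aestronglyMeasurable]
          exact ENNReal.toReal_le_of_le_ofReal (by positivity) hAq
        linarith
      have := hW0 hT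
      gcongr
    · intro b c hb hbc hcT
      rcases hbc.eq_or_lt with rfl | hlt
      · simp [smoothingSq]
      have hcb : 0 < c - b := sub_pos.2 hlt
      refine (smoothingSq_le hS hm hmB he ρ b c).trans ?_
      have hR : ENNReal.ofReal (2 * R) ≤ ENNReal.ofReal (2 * |R|) :=
        ENNReal.ofReal_le_ofReal (by linarith [le_abs_self R])
      refine (mul_le_mul_right (mul_le_mul_left hR _) _).trans ?_
      rw [← ENNReal.ofReal_toReal (measure_closedBall_lt_top (μ := volume) (x := (0 : Eucl n))
        (r := R)).ne, ← ENNReal.ofReal_mul (by positivity), ← ENNReal.ofReal_mul (by positivity),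
        ← ENNReal.ofReal_mul hcb.le]
      refine ENNReal.ofReal_le_ofReal ?_
      have e1 : (c - b) * (2 * |R| * ((B * (K * (c - b))) ^ 2 *
          (volume (Metric.closedBall (0 : Eucl n) R)).toReal)) = (c - b) ^ (3 : ℕ) * L := by
        rw [hL]; ring
      have e2 : (c - b) ^ (3 : ℕ) = (c - b) ^ (3 - p) * (c - b) ^ p := by
        rw [← Real.rpow_add hcb, ← Real.rpow_natCast]; congr 1; push_cast; ring
      have e3 : (c - b) ^ (3 - p) ≤ T ^ (3 - p) :=
        Real.rpow_le_rpow hcb.le (by linarith) (by linarith)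
      have e4 : (c - b) ^ p ≤ (δ ^ p)⁻¹ * (W c - W b) ^ p := by
        rw [← div_eq_inv_mul, le_div_iff₀ (by positivity), ← Real.mul_rpow hcb.le hδ.le, mul_comm]
        exact Real.rpow_le_rpow (by positivity) (hWδ hbc) hp0.le
      rw [e1, e2]
      calc (c - b) ^ (3 - p) * (c - b) ^ p * L
          ≤ T ^ (3 - p) * ((δ ^ p)⁻¹ * (W c - W b) ^ p) * L := by gcongr
        _ = _ := by ring
    · intro η hη b c d hb hbc hcd hdT
      refine (smoothingSq_split_le hS hm hmB he ρ hκ hmκ hη hbc hcd).trans ?_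
      refine add_le_add le_rfl (add_le_add le_rfl ?_)
      have hX : ∫⁻ ξ, ‖∫ s in Set.Ioc b c, cexp (I * s * quadSym ε ξ) * g s ξ‖ₑ ^ 2 ≤
          ENNReal.ofReal (C₁ * (W c - W b) ^ p) := by
        rcases hbc.eq_or_lt with rfl | hlt
        · simp
        have hpos : 0 < W c - W b := (mul_pos hδ (sub_pos.2 hlt)).trans_le (hWδ hbc)
        have := H₁ hε hS (b := b) (c := c) (A := (W c - W b) ^ (1 / q')) (by positivity) (by
          rw [← Real.rpow_mul hpos.le, one_div_mul_cancel hq0.ne', Real.rpow_one,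
            ← ofReal_integral_eq_lintegral_ofReal haqi.integrableOn (Eventually.of_forall haq0)]
          refine ENNReal.ofReal_le_ofReal ?_
          rw [hWe hbc]
          have := mul_nonneg hδ.le (sub_nonneg.2 hbc)
          linarith)
        rwa [← Real.rpow_natCast, ← Real.rpow_mul hpos.le, Nat.cast_ofNat,
          show 1 / q' * 2 = p by rw [hp]; ring] at this
      refine (mul_le_mul_right (mul_le_mul_right (mul_le_mul_right hX _) _) _).trans ?_
      have := hW0 hbc
      rw [← ENNReal.ofReal_mul (by positivity), ← ENNReal.ofReal_mul (by positivity),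
        ← ENNReal.ofReal_mul (by positivity)]
      exact ENNReal.ofReal_le_ofReal (le_of_eq (by ring))
  have hcont : Continuous fun δ : ℝ => C₂ * (2 * Real.pi / κ * (B ^ 2 * C₁)) *
      (A ^ q' + δ * T) ^ p :=
    continuous_const.mul ((by fun_prop : Continuous fun δ : ℝ => A ^ q' + δ * T).rpow_const
      fun _ => Or.inr hp0.le)
  have hlim := ENNReal.tendsto_ofReal
    ((hcont.tendsto 0).mono_left (nhdsWithin_le_nhds (s := Set.Ioi 0)))
  refine (ge_of_tendsto hlim ?_).trans (le_of_eq ?_)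
  · filter_upwards [self_mem_nhdsWithin] with δ hδ' using hδ δ hδ'
  · congr 1
    rw [zero_mul, add_zero, ← Real.rpow_mul hA.le, hp, mul_div_cancel₀ _ hq0.ne',
      show (2 : ℝ) = ((2 : ℕ) : ℝ) by norm_num, Real.rpow_natCast]
    ring

theorem exists_retarded_smoothing {n : ℕ} {q r q' r' : ℝ} (hq : 2 < q) (hr : 2 < r)
    (hadm : 2 / q = (n : ℝ) * (1 / 2 - 1 / r))
    (hq' : 1 / q + 1 / q' = 1) (hr' : 1 / r + 1 / r' = 1) :
    ∃ C : ℝ, 0 < C ∧ ∀ {ε : Fin n → ℝ}, (∀ i, ε i = 1 ∨ ε i = -1) →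
      ∀ {f g : ℝ → Eucl n → ℂ} {a : ℝ → ℝ} {K R : ℝ}, BandlimitedSource r' f g a K R →
      ∀ {m : Eucl n → ℂ} {B : ℝ}, Measurable m → (∀ ξ, ‖m ξ‖ ≤ B) →
      ∀ {e : Eucl n}, ‖e‖ = 1 → ∀ {κ : ℝ}, 0 < κ →
      (∀ ξ, |⟪ξ, epm ε e⟫| < κ → m ξ = 0) →
      ∀ {A : ℝ}, 0 < A → ∫⁻ s, ENNReal.ofReal (a s ^ q') ≤ ENNReal.ofReal (A ^ q') →
      ∀ ρ : ℝ, ∫⁻ p in Set.Ioi 0 ×ˢ (Set.univ : Set (hyperplane e)),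
          ‖𝓕⁻ (retarded ε m g 0 p.1) (ρ • e + (p.2 : Eucl n))‖ₑ ^ 2
        ≤ ENNReal.ofReal (C / κ * B ^ 2 * A ^ 2) := by
  obtain ⟨C, hC, H⟩ := exists_smoothingSq_le hq hr hadm hq' hr'
  refine ⟨C, hC, ?_⟩
  intro ε hε f g a K R hS m B hm hmB e he κ hκ hmκ A hA hAq ρ
  have hU : Set.Ioi (0 : ℝ) ×ˢ (Set.univ : Set (hyperplane e)) =
      ⋃ k : ℕ, Set.Ioc (0 : ℝ) k ×ˢ (Set.univ : Set (hyperplane e)) := by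
    ext p
    simp only [Set.mem_prod, Set.mem_Ioi, Set.mem_univ, and_true, Set.mem_iUnion, Set.mem_Ioc]
    exact ⟨fun h => (exists_nat_ge p.1).imp fun k hk => ⟨h, hk⟩, fun ⟨k, hk⟩ => hk.1⟩
  have hdir : Directed (· ⊆ ·) fun k : ℕ =>
      Set.Ioc (0 : ℝ) k ×ˢ (Set.univ : Set (hyperplane e)) := by
    refine Monotone.directed_le fun k l hkl => ?_
    exact Set.prod_mono (Set.Ioc_subset_Ioc_right (by exact_mod_cast hkl)) le_rfl
  rw [hU, setLIntegral_iUnion_of_directed _ hdir]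
  exact iSup_le fun k => H hε hS hm hmB he hκ hmκ hA hAq ρ (Nat.cast_nonneg k)

end Smoothing

section TwoSided

variable {n : ℕ}

theorem BandlimitedSource.reflect {r' : ℝ} {f g : ℝ → Eucl n → ℂ} {a : ℝ → ℝ} {K R : ℝ}
    (hS : BandlimitedSource r' f g a K R) :
    BandlimitedSource r' (fun s => f (-s)) (fun s => g (-s)) (fun s => a (-s)) K R where
  integrable s := hS.integrable _
  measurable s := hS.measurable _
  fourier_eq s := hS.fourier_eq _
  measurable_fourier := by
    have h : Measurable fun p : ℝ × Eucl n => (-p.1, p.2) := by fun_prop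
    exact hS.measurable_fourier.comp h
  bound s := hS.bound _
  supp s := hS.supp _
  measurable_size := hS.measurable_size.comp measurable_neg
  size_nonneg s := hS.size_nonneg _
  size s := hS.size _

theorem epm_neg (ε : Fin n → ℝ) (e : Eucl n) : epm (-ε) e = -epm ε e := by
  ext i; simp [epm]

theorem quadSym_neg (ε : Fin n → ℝ) (ξ : Eucl n) : quadSym (-ε) ξ = -quadSym ε ξ := by
  simp [quadSym]

/-- The Fourier transform of the Duhamel integral with forcing `g` on the Fourier side. -/
def duhamelFourier (ε : Fin n → ℝ) (g : ℝ → Eucl n → ℂ) (t : ℝ) (ξ : Eucl n) : ℂ :=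
  ∫ s in (0 : ℝ)..t, cexp (-I * ((t - s : ℝ) : ℂ) * quadSym ε ξ) * g s ξ

theorem mul_duhamelFourier_of_nonneg (ε : Fin n → ℝ) (m : Eucl n → ℂ) (g : ℝ → Eucl n → ℂ)
    {t : ℝ} (ht : 0 ≤ t) :
    (fun ξ => m ξ * duhamelFourier ε g t ξ) = retarded ε m g 0 t := by
  ext ξ
  rw [duhamelFourier, retarded, intervalIntegral.integral_of_le ht]

theorem mul_duhamelFourier_of_nonpos (ε : Fin n → ℝ) (m : Eucl n → ℂ) (g : ℝ → Eucl n → ℂ)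
    {t : ℝ} (ht : t ≤ 0) :
    (fun ξ => m ξ * duhamelFourier ε g t ξ) =
      fun ξ => -retarded (-ε) m (fun s => g (-s)) 0 (-t) ξ := by
  ext ξ
  rw [duhamelFourier, retarded, ← intervalIntegral.integral_of_le (neg_nonneg.2 ht), ← mul_neg]
  congr 1
  have := intervalIntegral.integral_comp_neg (a := 0) (b := -t)
    (fun s : ℝ => cexp (-I * ((t - s : ℝ) : ℂ) * quadSym ε ξ) * g s ξ)
  rw [neg_neg, neg_zero] at this
  rw [intervalIntegral.integral_symm t 0, ← this]
  congr 2
  ext s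
  rw [quadSym_neg]
  congr 2
  push_cast; ring

theorem exists_duhamel_smoothing {q r q' r' : ℝ} (hq : 2 < q) (hr : 2 < r)
    (hadm : 2 / q = (n : ℝ) * (1 / 2 - 1 / r))
    (hq' : 1 / q + 1 / q' = 1) (hr' : 1 / r + 1 / r' = 1) :
    ∃ C : ℝ, 0 < C ∧ ∀ {ε : Fin n → ℝ}, (∀ i, ε i = 1 ∨ ε i = -1) →
      ∀ {f g : ℝ → Eucl n → ℂ} {a : ℝ → ℝ} {K R : ℝ}, BandlimitedSource r' f g a K R →
      ∀ {m : Eucl n → ℂ} {B : ℝ}, Measurable m → (∀ ξ, ‖m ξ‖ ≤ B) →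
      ∀ {e : Eucl n}, ‖e‖ = 1 → ∀ {κ : ℝ}, 0 < κ →
      (∀ ξ, |⟪ξ, epm ε e⟫| < κ → m ξ = 0) →
      ∀ {A : ℝ}, 0 < A → ∫⁻ s, ENNReal.ofReal (a s ^ q') ≤ ENNReal.ofReal (A ^ q') →
      ∀ ρ : ℝ, ∫⁻ p : ℝ × hyperplane e,
          ‖𝓕⁻ (fun ξ => m ξ * duhamelFourier ε g p.1 ξ) (ρ • e + (p.2 : Eucl n))‖ₑ ^ 2
        ≤ ENNReal.ofReal (C / κ * B ^ 2 * A ^ 2) := by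
  obtain ⟨C, hC, H⟩ := exists_retarded_smoothing hq hr hadm hq' hr'
  refine ⟨2 * C, by positivity, ?_⟩
  intro ε hε f g a K R hS m B hm hmB e he κ hκ hmκ A hA hAq ρ
  set G : ℝ × hyperplane e → ℝ≥0∞ := fun p =>
    ‖𝓕⁻ (fun ξ => m ξ * duhamelFourier ε g p.1 ξ) (ρ • e + (p.2 : Eucl n))‖ₑ ^ 2 with hG
  have hpos : ∫⁻ p in Set.Ioi 0 ×ˢ (Set.univ : Set (hyperplane e)), G p ≤
      ENNReal.ofReal (C / κ * B ^ 2 * A ^ 2) := by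
    refine le_trans (setLIntegral_mono' (measurableSet_Ioi.prod MeasurableSet.univ) ?_)
      (H hε hS hm hmB he hκ hmκ hA hAq ρ)
    intro p hp
    simp only [hG]
    rw [mul_duhamelFourier_of_nonneg ε m g (le_of_lt hp.1)]
  have hneg : ∫⁻ p in Set.Iio 0 ×ˢ (Set.univ : Set (hyperplane e)), G p ≤
      ENNReal.ofReal (C / κ * B ^ 2 * A ^ 2) := by
    have h1 := H (ε := -ε) (fun i => by rcases hε i with h | h <;> simp [h]) hS.reflect hm hmB he
      hκ (fun ξ hξ => hmκ ξ (by rwa [epm_neg, inner_neg_right, abs_neg] at hξ)) hA (by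
        refine le_of_eq_of_le ?_ hAq
        exact lintegral_neg_eq_self (fun s => ENNReal.ofReal (a s ^ q'))) ρ
    let E : (ℝ × hyperplane e) ≃ᵐ (ℝ × hyperplane e) :=
      (MeasurableEquiv.neg ℝ).prodCongr (MeasurableEquiv.refl _)
    have hE : MeasurePreserving E :=
      (Measure.measurePreserving_neg volume).prod (MeasurePreserving.id volume)
    rw [← hE.setLIntegral_comp_preimage_emb E.measurableEmbedding] at h1
    have hpre : E ⁻¹' (Set.Ioi 0 ×ˢ (Set.univ : Set (hyperplane e))) = Set.Iio 0 ×ˢ Set.univ := by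
      ext p
      change (0 < -p.1 ∧ True) ↔ (p.1 < 0 ∧ True)
      simp
    rw [hpre] at h1
    refine le_trans (setLIntegral_mono' (measurableSet_Iio.prod MeasurableSet.univ) ?_) h1
    intro p hp
    simp only [hG]
    rw [mul_duhamelFourier_of_nonpos ε m g (le_of_lt hp.1)]
    have : 𝓕⁻ (fun ξ => -retarded (-ε) m (fun s => g (-s)) 0 (-p.1) ξ) (ρ • e + (p.2 : Eucl n)) =
        -𝓕⁻ (retarded (-ε) m (fun s => g (-s)) 0 (-p.1)) (ρ • e + (p.2 : Eucl n)) := by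
      simp only [Real.fourierInv_eq, smul_neg, integral_neg]
    rw [this, enorm_neg]
    exact le_rfl
  have hzero : ∫⁻ p in {0} ×ˢ (Set.univ : Set (hyperplane e)), G p = 0 := by
    refine setLIntegral_measure_zero _ _ ?_
    rw [Measure.volume_eq_prod, Measure.prod_prod, Real.volume_singleton, zero_mul]
  have huniv : (Set.univ : Set (ℝ × hyperplane e)) = (Set.Ioi 0 ×ˢ Set.univ ∪
      Set.Iio 0 ×ˢ Set.univ) ∪ {0} ×ˢ Set.univ := by
    ext p
    rcases lt_trichotomy p.1 0 with h | h | h <;> simp [h]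
  rw [← setLIntegral_univ, huniv]
  refine (lintegral_union_le _ _ _).trans ?_
  rw [hzero, add_zero]
  refine (lintegral_union_le _ _ _).trans ((add_le_add hpos hneg).trans_eq ?_)
  rw [← ENNReal.ofReal_add (by positivity) (by positivity)]
  congr 1; ring

end TwoSided

section Multipliers

variable {χ : ℝ → ℝ}

theorem IsBump.exists_bound (hχ : IsBump χ) : ∃ M : ℝ, 0 ≤ M ∧ ∀ s, |χ s| ≤ M := by
  have hc : Continuous χ := (hχ.smooth 0).continuous
  obtain ⟨M, hM⟩ := (isCompact_Icc (a := (-2 : ℝ)) (b := 2)).exists_bound_of_continuousOn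
    hc.continuousOn
  refine ⟨|M|, abs_nonneg _, fun s => ?_⟩
  by_cases hs : s ∈ Set.Icc (-2 : ℝ) 2
  · exact (hM s hs).trans (le_abs_self M)
  · have : 2 ≤ |s| := by
      by_contra h
      exact hs (abs_le.1 (not_le.1 h).le)
    rw [hχ.supp s this, abs_zero]; exact abs_nonneg _

theorem IsBump.apply_abs (hχ : IsBump χ) (s : ℝ) : χ |s| = χ s := by
  rcases abs_choice s with h | h <;> rw [h]
  exact hχ.even s

theorem IsBump.psiGe_eq (hχ : IsBump χ) (k : ℤ) (s : ℝ) :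
    psiGe χ k s = 1 - χ ((2 : ℝ) ^ (1 - k) * s) := by
  have hpsi : ∀ m : ℤ, psiR χ ((2 : ℝ) ^ (-m) * s) =
      χ ((2 : ℝ) ^ (-m) * s) - χ ((2 : ℝ) ^ (-(m - 1)) * s) := fun m => by
    rw [psiR, hχ.apply_abs, ← abs_two, ← abs_mul, hχ.apply_abs, ← mul_assoc]
    congr 3
    rw [abs_two, show -(m - 1) = 1 + -m by ring, zpow_add₀ (two_ne_zero), zpow_one]
  obtain ⟨N, hN⟩ := pow_unbounded_of_one_lt ((2 : ℝ) ^ (1 - k) * |s|) one_lt_two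
  have hone : ∀ m : ℤ, k + N - 1 ≤ m → χ ((2 : ℝ) ^ (-m) * s) = 1 := fun m hm => by
    refine hχ.one _ ?_
    rw [abs_mul, abs_of_pos (by positivity)]
    have h1 : (2 : ℝ) ^ (-m) ≤ (2 : ℝ) ^ (1 - k) * ((2 : ℝ) ^ N)⁻¹ := by
      rw [← zpow_natCast, ← zpow_neg, ← zpow_add₀ two_ne_zero]
      exact zpow_le_zpow_right₀ one_le_two (by omega)
    calc (2 : ℝ) ^ (-m) * |s| ≤ (2 : ℝ) ^ (1 - k) * ((2 : ℝ) ^ N)⁻¹ * |s| := by gcongr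
      _ = ((2 : ℝ) ^ (1 - k) * |s|) / 2 ^ N := by ring
      _ ≤ 1 := by rw [div_le_one (by positivity)]; exact hN.le
  rw [psiGe, tsum_eq_sum (s := (Finset.range N).image fun i : ℕ => k + (i : ℤ))]
  · rw [Finset.sum_image (fun i _ j _ h => by
      have : k + (i : ℤ) = k + (j : ℤ) := h
      omega)]
    have hterm : ∀ i ∈ Finset.range N,
        (if k ≤ k + (i : ℤ) then psiR χ ((2 : ℝ) ^ (-(k + (i : ℤ))) * s) else 0) =
        χ ((2 : ℝ) ^ (-(k + ((i + 1 : ℕ) : ℤ) - 1)) * s) - χ ((2 : ℝ) ^ (-(k + (i : ℤ) - 1)) * s) :=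
      fun i _ => by
        rw [if_pos (by omega), hpsi]
        congr 4
        push_cast; ring
    rw [Finset.sum_congr rfl hterm,
      Finset.sum_range_sub (fun i : ℕ => χ ((2 : ℝ) ^ (-(k + (i : ℤ) - 1)) * s)) N,
      hone _ le_rfl]
    congr 4
    push_cast; ring
  · intro m hm
    split_ifs with hkm
    · rw [hpsi]
      have : k + N ≤ m := by
        by_contra h
        refine hm ?_
        simp only [Finset.mem_image, Finset.mem_range]
        exact ⟨(m - k).toNat, by omega, by omega⟩
      rw [hone m (by omega), hone (m - 1) (by omega), sub_self]
    · rfl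

theorem IsBump.psiGe_eq_zero (hχ : IsBump χ) {k : ℤ} {s : ℝ} (hs : |s| < (2 : ℝ) ^ (k - 1)) :
    psiGe χ k s = 0 := by
  rw [hχ.psiGe_eq, hχ.one, sub_self]
  rw [abs_mul, abs_of_pos (by positivity)]
  calc (2 : ℝ) ^ (1 - k) * |s| ≤ (2 : ℝ) ^ (1 - k) * (2 : ℝ) ^ (k - 1) := by gcongr
    _ = 1 := by rw [← zpow_add₀ two_ne_zero]; simp

theorem IsBump.continuous_psiGe (hχ : IsBump χ) (k : ℤ) : Continuous (psiGe χ k) := by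
  have hc : Continuous χ := (hχ.smooth 0).continuous
  have : psiGe χ k = fun s => 1 - χ ((2 : ℝ) ^ (1 - k) * s) := funext (hχ.psiGe_eq k)
  rw [this]; fun_prop

theorem IsBump.psiR_eq_zero (hχ : IsBump χ) {s : ℝ} (hs : 2 ≤ |s|) : psiR χ s = 0 := by
  rw [psiR, hχ.supp _ (by rwa [abs_abs]), hχ.supp _ (by rw [abs_mul, abs_abs, abs_two]; linarith),
    sub_self]

theorem IsBump.contDiff_comp_norm {n : ℕ} (hχ : IsBump χ) {c : ℝ} (hc : 0 < c) (k : ℕ) :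
    ContDiff ℝ k fun ξ : Eucl n => χ (c * ‖ξ‖) := by
  rw [contDiff_iff_contDiffAt]
  intro ξ
  by_cases hξ : ξ = 0
  · have : (fun ξ : Eucl n => χ (c * ‖ξ‖)) =ᶠ[𝓝 ξ] fun _ => 1 := by
      have h1 : ∀ᶠ η : Eucl n in 𝓝 ξ, c * ‖η‖ < 1 := by
        have : Continuous fun η : Eucl n => c * ‖η‖ := by fun_prop
        exact this.continuousAt.eventually_lt continuousAt_const (by simp [hξ])
      filter_upwards [h1] with η hη
      exact hχ.one _ (by rw [abs_of_nonneg (by positivity)]; exact hη.le)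
    exact contDiffAt_const.congr_of_eventuallyEq this
  · exact (hχ.smooth k).contDiffAt.comp ξ (contDiffAt_const.mul (contDiffAt_norm ℝ hξ))

theorem IsBump.contDiff_psiR_norm {n : ℕ} (hχ : IsBump χ) {c : ℝ} (hc : 0 < c) (k : ℕ) :
    ContDiff ℝ k fun ξ : Eucl n => psiR χ (c * ‖ξ‖) := by
  have : (fun ξ : Eucl n => psiR χ (c * ‖ξ‖)) =
      fun ξ => χ (c * ‖ξ‖) - χ ((2 * c) * ‖ξ‖) := by
    ext ξ
    rw [psiR, abs_of_nonneg (by positivity), mul_assoc]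
  rw [this]
  exact (hχ.contDiff_comp_norm hc k).sub (hχ.contDiff_comp_norm (by positivity) k)

end Multipliers

section Slices

variable {n : ℕ}

theorem exists_slice_decay (F : SchwartzMap (ℝ × Eucl n) ℂ) (k l : ℕ) :
    ∃ C, ∀ s x, ‖x‖ ^ k * ‖iteratedFDeriv ℝ l (fun y => F (s, y)) x‖ ≤ C := by
  obtain ⟨C, hC⟩ := F.decay' k l
  refine ⟨C, fun s x => le_trans ?_ (hC (s, x))⟩
  have h1 : (fun y : Eucl n => F (s, y)) =
      (fun p => F (p + ((s, 0) : ℝ × Eucl n))) ∘ ContinuousLinearMap.inr ℝ ℝ (Eucl n) := by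
    ext y; simp
  have h2 : ContDiff ℝ l fun p => F (p + ((s, 0) : ℝ × Eucl n)) :=
    (F.smooth l).comp (contDiff_id.add contDiff_const)
  rw [h1, (ContinuousLinearMap.inr ℝ ℝ (Eucl n)).iteratedFDeriv_comp_right h2 x le_rfl,
    iteratedFDeriv_comp_add_right]
  have h3 : (ContinuousLinearMap.inr ℝ ℝ (Eucl n)) x + ((s, 0) : ℝ × Eucl n) = (s, x) := by simp
  rw [h3]
  have h4 : ‖x‖ ≤ ‖((s, x) : ℝ × Eucl n)‖ := le_max_right _ _
  refine mul_le_mul (pow_le_pow_left₀ (norm_nonneg _) h4 k) ?_ (norm_nonneg _) (by positivity)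
  refine (ContinuousMultilinearMap.norm_compContinuousLinearMap_le _ _).trans ?_
  refine mul_le_of_le_one_right (norm_nonneg _) (Finset.prod_le_one (fun _ _ => norm_nonneg _) ?_)
  exact fun _ _ => ContinuousLinearMap.norm_inr_le_one ℝ ℝ (Eucl n)

/-- The restriction of a Schwartz function on space-time to the time `s`. -/
def slice (F : SchwartzMap (ℝ × Eucl n) ℂ) (s : ℝ) : SchwartzMap (Eucl n) ℂ where
  toFun x := F (s, x)
  smooth' := (F.smooth _).comp (contDiff_const.prodMk contDiff_id)
  decay' k l := (exists_slice_decay F k l).imp fun _ h => h s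

theorem exists_seminorm_slice_le (F : SchwartzMap (ℝ × Eucl n) ℂ) (k l : ℕ) :
    ∃ C, 0 ≤ C ∧ ∀ s, SchwartzMap.seminorm ℂ k l (slice F s) ≤ C := by
  obtain ⟨C, hC⟩ := exists_slice_decay F k l
  refine ⟨|C|, abs_nonneg C, fun s => SchwartzMap.seminorm_le_bound ℂ k l _ (abs_nonneg C) ?_⟩
  exact fun x => (hC s x).trans (le_abs_self C)

theorem exists_sup_seminorm_slice_le (F : SchwartzMap (ℝ × Eucl n) ℂ) (S : Finset (ℕ × ℕ)) :
    ∃ C, 0 ≤ C ∧ ∀ s, (S.sup (schwartzSeminormFamily ℂ (Eucl n) ℂ)) (slice F s) ≤ C := by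
  choose C hC0 hC using exists_seminorm_slice_le F
  refine ⟨∑ p ∈ S, C p.1 p.2, Finset.sum_nonneg fun p _ => hC0 _ _, fun s => ?_⟩
  refine Seminorm.finset_sup_apply_le (Finset.sum_nonneg fun p _ => hC0 _ _) fun p hp => ?_
  exact (hC p.1 p.2 s).trans
    (Finset.single_le_sum (f := fun p : ℕ × ℕ => C p.1 p.2) (fun p _ => hC0 _ _) hp)

/-- Any continuous linear image of the time slices of a Schwartz function decays rapidly, uniformly
in time. -/
theorem exists_slice_image_le (T : SchwartzMap (Eucl n) ℂ →L[ℂ] SchwartzMap (Eucl n) ℂ)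
    (F : SchwartzMap (ℝ × Eucl n) ℂ) (k : ℕ) :
    ∃ C, 0 ≤ C ∧ ∀ s ξ, ‖T (slice F s) ξ‖ ≤ C * (1 + ‖ξ‖) ^ (-(k : ℝ)) := by
  set p : Seminorm ℂ (SchwartzMap (Eucl n) ℂ) :=
    (Finset.Iic (k, 0)).sup fun m => SchwartzMap.seminorm ℂ m.1 m.2
  have hp : Continuous p := by
    exact Seminorm.continuous_finsetSup fun m _ =>
      (schwartz_withSeminorms ℂ (Eucl n) ℂ).continuous_seminorm m
  obtain ⟨S, C, -, hS⟩ := Seminorm.bound_of_continuous (schwartz_withSeminorms ℂ (Eucl n) ℂ)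
    (p.comp T.toLinearMap) (hp.comp T.continuous)
  obtain ⟨M, hM0, hM⟩ := exists_sup_seminorm_slice_le F S
  refine ⟨2 ^ k * (C * M), by positivity, fun s ξ => ?_⟩
  have h1 := SchwartzMap.one_add_le_sup_seminorm_apply (𝕜 := ℂ) (m := (k, 0)) le_rfl le_rfl
    (T (slice F s)) ξ
  rw [norm_iteratedFDeriv_zero] at h1
  have h2 : p (T (slice F s)) ≤ C * M := (hS (slice F s)).trans <| by
    have := hM s
    rw [smul_apply]
    exact mul_le_mul_of_nonneg_left this C.2
  rw [Real.rpow_neg (by positivity), Real.rpow_natCast, ← div_eq_mul_inv,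
    le_div_iff₀ (by positivity), mul_comm]
  exact h1.trans (by gcongr)

theorem exists_fourier_slice_le (F : SchwartzMap (ℝ × Eucl n) ℂ) (k : ℕ) :
    ∃ C, 0 ≤ C ∧ ∀ s ξ, ‖𝓕 (fun x => F (s, x)) ξ‖ ≤ C * (1 + ‖ξ‖) ^ (-(k : ℝ)) :=
  exists_slice_image_le (FourierTransform.fourierCLM ℂ (SchwartzMap (Eucl n) ℂ)) F k

theorem integrable_decay (n : ℕ) (C : ℝ) :
    Integrable fun ξ : Eucl n => C * (1 + ‖ξ‖) ^ (-((n + 1 : ℕ) : ℝ)) := by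
  refine (integrable_one_add_norm ?_).const_mul C
  rw [finrank_euclideanSpace_fin]; push_cast; linarith

theorem continuous_fourier_slice (F : SchwartzMap (ℝ × Eucl n) ℂ) :
    Continuous fun p : ℝ × Eucl n => 𝓕 (fun x => F (p.1, x)) p.2 := by
  obtain ⟨C, -, hC⟩ := exists_slice_image_le (ContinuousLinearMap.id ℂ _) F (n + 1)
  simp only [Real.fourier_eq']
  refine continuous_of_dominated (bound := fun x => C * (1 + ‖x‖) ^ (-((n + 1 : ℕ) : ℝ)))
    (fun p => ?_) (fun p => Eventually.of_forall fun x => ?_) (integrable_decay n C)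
    (Eventually.of_forall fun x => ?_)
  · have h1 : Continuous fun x : Eucl n => (p.1, x) := by fun_prop
    have : Continuous fun x => F (p.1, x) := F.continuous.comp h1
    have h2 : Continuous fun x : Eucl n =>
        cexp (((-2 * Real.pi * ⟪x, p.2⟫ : ℝ) : ℂ) * I) • F (p.1, x) := by fun_prop
    exact h2.aestronglyMeasurable
  · rw [norm_smul, norm_exp_ofReal_mul_I, one_mul]
    exact hC p.1 x
  · have h1 : Continuous fun p : ℝ × Eucl n => (p.1, x) := by fun_prop
    have : Continuous fun p : ℝ × Eucl n => F (p.1, x) := F.continuous.comp h1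
    fun_prop

end Slices

section Duhamel

variable {n : ℕ} {g : ℝ → Eucl n → ℂ} {C : ℝ}

theorem continuous_duhamelFourier_integrand (ε : Fin n → ℝ) (t : ℝ)
    (hg : Continuous fun p : ℝ × Eucl n => g p.1 p.2) :
    Continuous fun p : Eucl n × ℝ =>
      cexp (-I * ((t - p.2 : ℝ) : ℂ) * quadSym ε p.1) * g p.2 p.1 := by
  have h1 := continuous_quadSym ε
  have h2 : Continuous fun p : Eucl n × ℝ => g p.2 p.1 := hg.comp continuous_swap
  fun_prop

theorem continuous_duhamelFourier (ε : Fin n → ℝ) (t : ℝ)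
    (hg : Continuous fun p : ℝ × Eucl n => g p.1 p.2) : Continuous (duhamelFourier ε g t) :=
  intervalIntegral.continuous_parametric_intervalIntegral_of_continuous'
    (continuous_duhamelFourier_integrand ε t hg) 0 t

theorem integrable_duhamelFourier (ε : Fin n → ℝ) (t : ℝ)
    (hg : Continuous fun p : ℝ × Eucl n => g p.1 p.2)
    (hC : ∀ s ξ, ‖g s ξ‖ ≤ C * (1 + ‖ξ‖) ^ (-((n + 1 : ℕ) : ℝ))) :
    Integrable (duhamelFourier ε g t) := by
  refine (integrable_decay n (C * |t|)).mono'
    (continuous_duhamelFourier ε t hg).aestronglyMeasurable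
    (Eventually.of_forall fun ξ => ?_)
  have h := intervalIntegral.norm_integral_le_of_norm_le_const (a := 0) (b := t)
    (f := fun s => cexp (-I * ((t - s : ℝ) : ℂ) * quadSym ε ξ) * g s ξ) fun s _ => by
      rw [norm_mul, norm_cexp_neg_I_mul, one_mul]
      exact hC s ξ
  rw [sub_zero] at h
  exact h.trans_eq (by ring)

theorem duhamel_eq_fourierInv (ε : Fin n → ℝ) (G : ℝ × Eucl n → ℂ)
    (hGg : ∀ s, 𝓕 (fun x => G (s, x)) = g s)
    (hg : Continuous fun p : ℝ × Eucl n => g p.1 p.2)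
    (hC : ∀ s ξ, ‖g s ξ‖ ≤ C * (1 + ‖ξ‖) ^ (-((n + 1 : ℕ) : ℝ))) (t : ℝ) :
    (fun x => duhamel ε G (t, x)) = 𝓕⁻ (duhamelFourier ε g t) := by
  ext x
  simp only [duhamel, prop, mulOp, hGg, Real.fourierInv_eq']
  rw [intervalIntegral_integral_swap]
  · refine integral_congr_ae (Eventually.of_forall fun ξ => ?_)
    simp only [duhamelFourier, smul_eq_mul]
    rw [← intervalIntegral.integral_const_mul]
  · have hc : Continuous fun p : ℝ × Eucl n =>
        cexp (((2 * Real.pi * ⟪p.2, x⟫ : ℝ) : ℂ) * I) •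
          (cexp (-I * ((t - p.1 : ℝ) : ℂ) * quadSym ε p.2) * g p.1 p.2) := by
      have h1 := continuous_quadSym ε
      fun_prop
    have : IsFiniteMeasure (volume.restrict (Set.uIoc 0 t)) := by
      rw [Set.uIoc]; infer_instance
    have hdom : Integrable
        (fun p : ℝ × Eucl n => (1 : ℝ) * (C * (1 + ‖p.2‖) ^ (-((n + 1 : ℕ) : ℝ))))
        ((volume.restrict (Set.uIoc 0 t)).prod volume) :=
      Integrable.mul_prod (f := fun _ : ℝ => (1 : ℝ)) (integrable_const 1) (integrable_decay n C)
    refine hdom.mono' hc.aestronglyMeasurable (Eventually.of_forall fun p => ?_)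
    simp only [Function.uncurry]
    rw [norm_smul, norm_exp_ofReal_mul_I, norm_mul, norm_cexp_neg_I_mul]
    simpa using hC p.1 p.2

theorem fourier_fourierInv_eq_or {f : Eucl n → ℂ} (hc : Continuous f) (hf : Integrable f) :
    𝓕 (𝓕⁻ f) = f ∨ 𝓕 (𝓕⁻ f) = 0 := by
  by_cases h : Integrable (𝓕⁻ f)
  · refine Or.inl (hc.fourier_fourierInv_eq hf ?_)
    have h1 : 𝓕 f = fun w => 𝓕⁻ f (-w) := by
      ext w
      rw [Real.fourierInv_eq_fourier_neg, neg_neg]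
    rw [h1]
    exact h.comp_neg
  · refine Or.inr (funext fun w => ?_)
    rw [Real.fourier_eq, Pi.zero_apply]
    exact integral_undef fun h' => h ((Real.fourierIntegral_convergent_iff w).1 h')

theorem norm_mulOp_mulOp_fourierInv_le {m₁ m₂ f : Eucl n → ℂ} {B : ℝ} (hm : Continuous m₂)
    (hB : ∀ ξ, ‖m₂ ξ‖ ≤ B) (hc : Continuous f) (hf : Integrable f) (x : Eucl n) :
    ‖mulOp m₁ (mulOp m₂ (𝓕⁻ f)) x‖ ≤ ‖𝓕⁻ (fun ξ => m₂ ξ * (m₁ ξ * f ξ)) x‖ := by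
  have hzero : 𝓕⁻ (fun _ : Eucl n => (0 : ℂ)) = 0 := by
    ext w; simp [Real.fourierInv_eq]
  have hzero' : 𝓕 (0 : Eucl n → ℂ) = 0 := by
    ext w; simp [Real.fourier_eq]
  have hvanish : ∀ m : Eucl n → ℂ, 𝓕⁻ (fun ξ => m ξ * (0 : Eucl n → ℂ) ξ) = 0 := fun m => by
    simpa only [Pi.zero_apply, mul_zero] using hzero
  rw [mulOp, mulOp]
  rcases fourier_fourierInv_eq_or hc hf with h | h <;> rw [h]
  · have hm₂f : Integrable fun ξ => m₂ ξ * f ξ :=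
      hf.bdd_mul hm.aestronglyMeasurable (Eventually.of_forall hB)
    rcases fourier_fourierInv_eq_or (f := fun ξ => m₂ ξ * f ξ) (hm.mul hc) hm₂f with
      h2 | h2 <;> rw [h2]
    · simp only [mul_left_comm (m₁ _), le_refl]
    · rw [hvanish, Pi.zero_apply, norm_zero]
      exact norm_nonneg _
  · rw [hvanish, hzero', hvanish, Pi.zero_apply, norm_zero]
    exact norm_nonneg _

end Duhamel

section Localized

variable {n : ℕ}

theorem continuous_fourierInv_of_decay {g : ℝ → Eucl n → ℂ} {C : ℝ}
    (hg : Continuous fun p : ℝ × Eucl n => g p.1 p.2)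
    (hC : ∀ s ξ, ‖g s ξ‖ ≤ C * (1 + ‖ξ‖) ^ (-((n + 1 : ℕ) : ℝ))) :
    Continuous fun p : ℝ × Eucl n => 𝓕⁻ (g p.1) p.2 := by
  simp only [Real.fourierInv_eq']
  refine continuous_of_dominated (bound := fun ξ => C * (1 + ‖ξ‖) ^ (-((n + 1 : ℕ) : ℝ)))
    (fun p => ?_) (fun p => Eventually.of_forall fun ξ => ?_) (integrable_decay n C)
    (Eventually.of_forall fun ξ => ?_)
  · have h1 : Continuous fun ξ => g p.1 ξ := hg.comp (Continuous.prodMk_right p.1)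
    have h2 : Continuous fun ξ : Eucl n =>
        cexp (((2 * Real.pi * ⟪ξ, p.2⟫ : ℝ) : ℂ) * I) • g p.1 ξ := by fun_prop
    exact h2.aestronglyMeasurable
  · rw [norm_smul, norm_exp_ofReal_mul_I, one_mul]
    exact hC p.1 ξ
  · have h1 : Continuous fun p : ℝ × Eucl n => g p.1 ξ :=
      hg.comp (continuous_fst.prodMk continuous_const)
    fun_prop

/-- The Littlewood–Paley symbol at frequency `2 ^ j`. -/
def projSymbol (χ : ℝ → ℝ) (j : ℤ) (ξ : Eucl n) : ℂ := (psiR χ ((2 : ℝ) ^ (-j) * ‖ξ‖) : ℂ)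

theorem IsBump.contDiff_projSymbol {χ : ℝ → ℝ} (hχ : IsBump χ) (j : ℤ) :
    ContDiff ℝ ((⊤ : ℕ∞) : WithTop ℕ∞) (projSymbol (n := n) χ j) :=
  contDiff_infty.2 fun k =>
    Complex.ofRealCLM.contDiff.comp (hχ.contDiff_psiR_norm (c := (2 : ℝ) ^ (-j)) (by positivity) k)

theorem IsBump.projSymbol_eq_zero {χ : ℝ → ℝ} (hχ : IsBump χ) {j : ℤ} {ξ : Eucl n}
    (hξ : (2 : ℝ) ^ (j + 1) ≤ ‖ξ‖) : projSymbol χ j ξ = 0 := by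
  rw [projSymbol, hχ.psiR_eq_zero, ofReal_zero]
  rw [abs_of_nonneg (by positivity)]
  calc (2 : ℝ) = (2 : ℝ) ^ (-j) * (2 : ℝ) ^ (j + 1) := by
        rw [← zpow_add₀ two_ne_zero]; simp
    _ ≤ _ := by gcongr

theorem IsBump.hasCompactSupport_projSymbol {χ : ℝ → ℝ} (hχ : IsBump χ) (j : ℤ) :
    HasCompactSupport (projSymbol (n := n) χ j) := by
  refine HasCompactSupport.intro (isCompact_closedBall 0 ((2 : ℝ) ^ (j + 1))) fun ξ hξ => ?_
  refine hχ.projSymbol_eq_zero ?_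
  rw [mem_closedBall_zero_iff, not_le] at hξ
  exact hξ.le

theorem norm_projSymbol_le {χ : ℝ → ℝ} {M : ℝ} (hM : ∀ s, |χ s| ≤ M) (j : ℤ) (ξ : Eucl n) :
    ‖projSymbol χ j ξ‖ ≤ 2 * M := by
  rw [projSymbol, norm_real, psiR, Real.norm_eq_abs]
  refine (abs_sub _ _).trans ?_
  linarith [hM |(2 : ℝ) ^ (-j) * ‖ξ‖|, hM (2 * |(2 : ℝ) ^ (-j) * ‖ξ‖|)]

theorem exists_schwartz_proj {χ : ℝ → ℝ} (hχ : IsBump χ) (j : ℤ) (φ : SchwartzMap (Eucl n) ℂ) :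
    ∃ h : SchwartzMap (Eucl n) ℂ, ⇑h = proj χ j φ ∧
      𝓕 (h : Eucl n → ℂ) = fun ξ => projSymbol χ j ξ * 𝓕 (φ : Eucl n → ℂ) ξ := by
  have hs : ContDiff ℝ ((⊤ : ℕ∞) : WithTop ℕ∞) fun ξ => projSymbol χ j ξ * 𝓕 (φ : Eucl n → ℂ) ξ :=
    (hχ.contDiff_projSymbol j).mul (SchwartzMap.smooth (𝓕 φ) ⊤)
  set θ : SchwartzMap (Eucl n) ℂ :=
    ((hχ.hasCompactSupport_projSymbol j).mul_right (f' := 𝓕 (φ : Eucl n → ℂ))).toSchwartzMap hs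
    with hθ
  have hcoe : (θ : Eucl n → ℂ) = fun ξ => projSymbol χ j ξ * 𝓕 (φ : Eucl n → ℂ) ξ := rfl
  refine ⟨𝓕⁻ θ, ?_, ?_⟩
  · rw [SchwartzMap.fourierInv_coe, hcoe]; rfl
  · rw [← SchwartzMap.fourier_coe, FourierTransform.fourier_fourierInv_eq, hcoe]

theorem lintegral_ofReal_rpow_eq {f : Eucl n → ℂ} {p : ℝ} (hp : 0 < p)
    (hf : eLpNorm f (ENNReal.ofReal p) volume ≠ ∞) :
    ∫⁻ x, ENNReal.ofReal (‖f x‖ ^ p) =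
      ENNReal.ofReal ((eLpNorm f (ENNReal.ofReal p) volume).toReal ^ p) := by
  rw [← ENNReal.ofReal_rpow_of_nonneg ENNReal.toReal_nonneg hp.le, ENNReal.ofReal_toReal hf,
    eLpNorm_eq_lintegral_rpow_enorm_toReal (by simpa using hp) ENNReal.ofReal_ne_top,
    ENNReal.toReal_ofReal hp.le, ← ENNReal.rpow_mul, one_div_mul_cancel hp.ne', ENNReal.rpow_one]
  refine lintegral_congr fun x => ?_
  rw [← ENNReal.ofReal_rpow_of_nonneg (norm_nonneg _) hp.le, ofReal_norm]

theorem measurable_eLpNorm_slice {f : ℝ → Eucl n → ℂ} {p : ℝ} (hp : 0 < p)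
    (hf : Measurable fun z : ℝ × Eucl n => f z.1 z.2) :
    Measurable fun s => eLpNorm (f s) (ENNReal.ofReal p) volume := by
  simp only [eLpNorm_eq_lintegral_rpow_enorm_toReal (ENNReal.ofReal_pos.2 hp).ne'
    ENNReal.ofReal_ne_top, ENNReal.toReal_ofReal hp.le]
  exact (Measurable.lintegral_prod_right' (f := fun z : ℝ × Eucl n => ‖f z.1 z.2‖ₑ ^ p)
    (hf.enorm.pow_const p)).pow_const _

variable {χ : ℝ → ℝ}

theorem exists_decay_localized (hχ : IsBump χ) (j : ℤ) (F : SchwartzMap (ℝ × Eucl n) ℂ) :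
    ∃ C, 0 ≤ C ∧ ∀ s ξ, ‖projSymbol χ j ξ * 𝓕 (fun x => F (s, x)) ξ‖ ≤
      C * (1 + ‖ξ‖) ^ (-((n + 1 : ℕ) : ℝ)) := by
  obtain ⟨C, hC0, hC⟩ := exists_fourier_slice_le F (n + 1)
  obtain ⟨M, hM0, hM⟩ := hχ.exists_bound
  refine ⟨2 * M * C, by positivity, fun s ξ => ?_⟩
  rw [norm_mul, mul_assoc]
  exact mul_le_mul (norm_projSymbol_le hM j ξ) (hC s ξ) (norm_nonneg _) (by positivity)

theorem exists_bandlimitedSource (hχ : IsBump χ) (j : ℤ) (F : SchwartzMap (ℝ × Eucl n) ℂ)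
    {r' : ℝ} (hr' : 0 < r') :
    ∃ K R, BandlimitedSource r' (fun s => proj χ j fun x => F (s, x))
      (fun s ξ => projSymbol χ j ξ * 𝓕 (fun x => F (s, x)) ξ)
      (fun s => (eLpNorm (proj χ j fun x => F (s, x)) (ENNReal.ofReal r') volume).toReal) K R := by
  obtain ⟨C, hC0, hC⟩ := exists_decay_localized hχ j F
  have hg : Continuous fun p : ℝ × Eucl n =>
      projSymbol χ j p.2 * 𝓕 (fun x => F (p.1, x)) p.2 :=
    Continuous.mul ((hχ.contDiff_projSymbol j).continuous.comp continuous_snd)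
      (continuous_fourier_slice F)
  have hf : Continuous fun p : ℝ × Eucl n => proj χ j (fun x => F (p.1, x)) p.2 :=
    continuous_fourierInv_of_decay
      (g := fun s ξ => projSymbol χ j ξ * 𝓕 (fun x => F (s, x)) ξ) hg hC
  choose h hh hh' using fun s => exists_schwartz_proj hχ j (slice F s)
  have hcoe : ∀ s, (proj χ j fun x => F (s, x)) = h s := fun s => (hh s).symm
  refine ⟨C, (2 : ℝ) ^ (j + 1), ?_⟩
  refine ⟨fun s => ?_, fun s => ?_, fun s => ?_, hg.measurable, fun s ξ => ?_, fun s ξ hξ => ?_, ?_,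
    fun s => ENNReal.toReal_nonneg, fun s => ?_⟩
  · rw [hcoe]; exact (h s).integrable
  · rw [hcoe]; exact (h s).continuous.measurable
  · rw [hcoe]; exact hh' s
  · refine (hC s ξ).trans (mul_le_of_le_one_right hC0 ?_)
    exact Real.rpow_le_one_of_one_le_of_nonpos (by linarith [norm_nonneg ξ])
      (neg_nonpos.2 (Nat.cast_nonneg _))
  · rw [hχ.projSymbol_eq_zero hξ.le, zero_mul]
  · exact (measurable_eLpNorm_slice hr' hf.measurable).ennreal_toReal
  · refine (lintegral_ofReal_rpow_eq hr' ?_).le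
    rw [hcoe]
    have hmem : MemLp (h s) (ENNReal.ofReal r') volume := (h s).memLp (ENNReal.ofReal r') volume
    exact hmem.eLpNorm_ne_top

end Localized

section Smoothing

variable {n : ℕ} {χ : ℝ → ℝ}

theorem mixNorm_rpow_toReal_add_le {q' r' η : ℝ} (hq' : 0 < q') (hη : 0 ≤ η)
    {u : ℝ × Eucl n → ℂ} (hu : mixNorm (ENNReal.ofReal q') (ENNReal.ofReal r') u ≠ ∞)
    (hur : ∀ t, eLpNorm (fun x => u (t, x)) (ENNReal.ofReal r') volume ≠ ∞) :
    ∫⁻ t, ENNReal.ofReal ((eLpNorm (fun x => u (t, x)) (ENNReal.ofReal r') volume).toReal ^ q') ≤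
      ENNReal.ofReal
        (((mixNorm (ENNReal.ofReal q') (ENNReal.ofReal r') u).toReal + η) ^ q') := by
  set X := mixNorm (ENNReal.ofReal q') (ENNReal.ofReal r') u with hX
  have hXq : X ^ q' =
      ∫⁻ t, eLpNorm (fun x => u (t, x)) (ENNReal.ofReal r') volume ^ q' := by
    rw [hX, mixNorm, if_neg ENNReal.ofReal_ne_top, ENNReal.toReal_ofReal hq'.le,
      ← ENNReal.rpow_mul, one_div_mul_cancel hq'.ne', ENNReal.rpow_one]
  calc _ = X ^ q' := by
        rw [hXq]
        refine lintegral_congr fun t => ?_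
        rw [← ENNReal.ofReal_rpow_of_nonneg ENNReal.toReal_nonneg hq'.le,
          ENNReal.ofReal_toReal (hur t)]
    _ = ENNReal.ofReal (X.toReal ^ q') := by
        rw [← ENNReal.ofReal_rpow_of_nonneg ENNReal.toReal_nonneg hq'.le, ENNReal.ofReal_toReal hu]
    _ ≤ _ := ENNReal.ofReal_le_ofReal
        (Real.rpow_le_rpow ENNReal.toReal_nonneg (by linarith) hq'.le)

theorem eLpNorm_projT_ne_top (hχ : IsBump χ) (j : ℤ) (F : SchwartzMap (ℝ × Eucl n) ℂ)
    (p : ℝ≥0∞) (t : ℝ) :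
    eLpNorm (fun x => projT χ j (fun p => F p) (t, x)) p volume ≠ ∞ := by
  obtain ⟨h, hh, -⟩ := exists_schwartz_proj hχ j (slice F t)
  have hcoe : (fun x => projT χ j (fun p => F p) (t, x)) = h := hh.symm
  rw [hcoe]
  exact (h.memLp p volume).eLpNorm_ne_top

theorem aniNorm_top_two_le {e : Eucl n} {u v : ℝ × Eucl n → ℂ} {D : ℝ} (hD : 0 ≤ D)
    (huv : ∀ p, ‖u p‖ ≤ ‖v p‖)
    (hv : ∀ ρ : ℝ, ∫⁻ p : ℝ × hyperplane e, ‖v (p.1, ρ • e + (p.2 : Eucl n))‖ₑ ^ 2 ≤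
      ENNReal.ofReal (D ^ 2)) :
    aniNorm ∞ 2 e u ≤ ENNReal.ofReal D := by
  rw [aniNorm, if_pos rfl]
  refine essSup_le_of_ae_le _ (Eventually.of_forall fun ρ => ?_)
  refine (eLpNorm_mono (g := fun p : ℝ × hyperplane e => v (p.1, ρ • e + (p.2 : Eucl n)))
    fun p => huv _).trans ?_
  rw [eLpNorm_eq_lintegral_rpow_enorm_toReal two_ne_zero ENNReal.ofNat_ne_top,
    ENNReal.toReal_ofNat]
  simp only [ENNReal.rpow_ofNat]
  calc _ ≤ ENNReal.ofReal (D ^ 2) ^ (1 / (2 : ℝ)) := by gcongr; exact hv ρ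
    _ = ENNReal.ofReal D := by
        rw [ENNReal.ofReal_rpow_of_nonneg (by positivity) (by positivity), ← Real.sqrt_eq_rpow,
          Real.sqrt_sq hD]

theorem exists_duhamel_smoothing_of_bound {q r q' r' : ℝ} (hq : 2 < q) (hr : 2 < r)
    (hadm : 2 / q = (n : ℝ) * (1 / 2 - 1 / r))
    (hq' : 1 / q + 1 / q' = 1) (hr' : 1 / r + 1 / r' = 1) (hr'0 : 0 < r') (hχ : IsBump χ) :
    ∃ C : ℝ, 0 < C ∧ ∀ {ε : Fin n → ℝ}, (∀ i, ε i = 1 ∨ ε i = -1) →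
      ∀ (F : SchwartzMap (ℝ × Eucl n) ℂ) (j : ℤ) {e : Eucl n}, ‖e‖ = 1 → ∀ {A : ℝ}, 0 < A →
      ∫⁻ s, ENNReal.ofReal
          ((eLpNorm (proj χ j fun x => F (s, x)) (ENNReal.ofReal r') volume).toReal ^ q') ≤
        ENNReal.ofReal (A ^ q') →
      tp ((j : ℝ) / 2) *
        aniNorm ∞ 2 e (projT χ j (qprojT χ (epm ε e) j 20 (duhamel ε fun p => F p))) ≤
        ENNReal.ofReal (C * A) := by
  obtain ⟨C, hC, H⟩ := exists_duhamel_smoothing hq hr hadm hq' hr'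
  obtain ⟨M, hM0, hM⟩ := hχ.exists_bound
  refine ⟨√(C * 2 ^ 21) * (1 + M), by positivity, ?_⟩
  intro ε hε F j e he A hA hAq
  obtain ⟨K, R, hS⟩ := exists_bandlimitedSource hχ j F hr'0
  obtain ⟨C₁, -, hC₁⟩ := exists_fourier_slice_le F (n + 1)
  have hg := continuous_fourier_slice F
  set m : Eucl n → ℂ := fun ξ => ((psiGe χ (j - 20) ⟪ξ, epm ε e⟫ : ℝ) : ℂ) with hm
  have hmc : Continuous m := by
    have := hχ.continuous_psiGe (j - 20)
    fun_prop
  have hmB : ∀ ξ, ‖m ξ‖ ≤ 1 + M := fun ξ => by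
    rw [hm, norm_real, hχ.psiGe_eq, Real.norm_eq_abs]
    refine (abs_sub _ _).trans ?_
    rw [abs_one]
    gcongr
    exact hM _
  have hκ : (0 : ℝ) < 2 ^ (j - 21) := by positivity
  have hmκ : ∀ ξ, |⟪ξ, epm ε e⟫| < (2 : ℝ) ^ (j - 21) → m ξ = 0 := fun ξ hξ => by
    change ((psiGe χ (j - 20) ⟪ξ, epm ε e⟫ : ℝ) : ℂ) = 0
    rw [hχ.psiGe_eq_zero (by rwa [show j - 20 - 1 = j - 21 by ring]), ofReal_zero]
  have hlocal : ∀ t, (fun ξ => projSymbol χ j ξ *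
      duhamelFourier ε (fun s => 𝓕 fun x => F (s, x)) t ξ) =
      duhamelFourier ε (fun s ξ => projSymbol χ j ξ * 𝓕 (fun x => F (s, x)) ξ) t := fun t => by
    ext ξ
    rw [duhamelFourier, duhamelFourier, ← intervalIntegral.integral_const_mul]
    refine intervalIntegral.integral_congr fun s _ => ?_
    ring
  set D : ℝ := √(C / 2 ^ (j - 21)) * (1 + M) * A with hD
  have hani : aniNorm ∞ 2 e (projT χ j (qprojT χ (epm ε e) j 20 (duhamel ε fun p => F p))) ≤
      ENNReal.ofReal D := by
    refine aniNorm_top_two_le (v := fun p => 𝓕⁻ (fun ξ => m ξ * duhamelFourier ε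
      (fun s ξ => projSymbol χ j ξ * 𝓕 (fun x => F (s, x)) ξ) p.1 ξ) p.2) (by positivity) ?_ ?_
    · intro p
      have h := norm_mulOp_mulOp_fourierInv_le (m₁ := projSymbol χ j) hmc hmB
        (continuous_duhamelFourier ε p.1 hg) (integrable_duhamelFourier ε p.1 hg hC₁) p.2
      rw [← duhamel_eq_fourierInv ε (fun p => F p) (fun _ => rfl) hg hC₁ p.1] at h
      refine h.trans_eq ?_
      rw [← hlocal]
    · intro ρ
      refine (H hε hS hmc.measurable hmB he hκ hmκ hA hAq ρ).trans_eq ?_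
      rw [hD, mul_pow, mul_pow, Real.sq_sqrt (by positivity)]
  refine (mul_le_mul_right hani _).trans_eq ?_
  rw [tp, ← ENNReal.ofReal_mul (by positivity), hD]
  congr 1
  have h2 : (2 : ℝ) ^ ((j : ℝ) / 2) = √(2 ^ j) := by
    rw [Real.sqrt_eq_rpow, ← Real.rpow_intCast, ← Real.rpow_mul two_pos.le]
    congr 1; ring
  have h3 : √((2 : ℝ) ^ j) * √(C / 2 ^ (j - 21)) = √(C * 2 ^ 21) := by
    rw [← Real.sqrt_mul (by positivity)]
    congr 1
    rw [zpow_sub₀ two_ne_zero]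
    field_simp
  rw [h2, ← h3]
  ring

end Smoothing

end DNLS

/-- `2^{j/2}‖P_j Q^{e_±}_{j,20}∫_0^t W_±(t-s)F(s)ds‖_{L^{∞,2}_e}
≤ C‖P_j F‖_{L^{q'}_tL^{r'}_x}` for admissible `(q,r)` with `q,r > 2`. -/
theorem duhamel_smoothing_from_strichartz
    (n : ℕ) (hn : 2 ≤ n) (ε : Fin n → ℝ) (hε : ∀ i, ε i = 1 ∨ ε i = -1)
    (χ : ℝ → ℝ) (hχ : IsBump χ)
    (q r : ℝ) (hadm : Admissible n q r) (hq : 2 < q) (hr : 2 < r)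
    (q' r' : ℝ) (hq' : 1 / q + 1 / q' = 1) (hr' : 1 / r + 1 / r' = 1) :
    ∃ C : ℝ, 0 < C ∧ ∀ (F : SchwartzMap (ℝ × Eucl n) ℂ) (j : ℤ) (e : Eucl n), ‖e‖ = 1 →
      tp ((j : ℝ) / 2) *
        aniNorm ∞ 2 e
          (projT χ j (qprojT χ (epm ε e) j 20 (duhamel ε (fun p => F p))))
      ≤ ENNReal.ofReal C *
          mixNorm (ENNReal.ofReal q') (ENNReal.ofReal r') (projT χ j (fun p => F p)) := by
  have hr'0 : 0 < r' := one_pos.trans (DNLS.holderConjugate_exponent hr hr').2.1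
  have hq'0 : 0 < q' := one_pos.trans (DNLS.holderConjugate_exponent hq hq').2.1
  obtain ⟨C, hC, H⟩ := exists_duhamel_smoothing_of_bound hq hr hadm.1 hq' hr' hr'0 hχ
  refine ⟨C, hC, fun F j e he => ?_⟩
  set X := mixNorm (ENNReal.ofReal q') (ENNReal.ofReal r') (projT χ j fun p => F p) with hX
  by_cases hXtop : X = ∞
  · rw [hXtop, ENNReal.mul_top (ENNReal.ofReal_pos.2 hC).ne']
    exact le_top
  refine ENNReal.le_of_forall_pos_le_add fun η hη _ => ?_
  have hη' : 0 < (η : ℝ) / C := by positivity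
  have hX0 : (0 : ℝ) ≤ X.toReal := ENNReal.toReal_nonneg
  have hA := mixNorm_rpow_toReal_add_le hq'0 hη'.le hXtop (eLpNorm_projT_ne_top hχ j F _)
  refine (H hε F j he (A := X.toReal + η / C) (by linarith) hA).trans_eq ?_
  rw [mul_add, mul_div_cancel₀ _ hC.ne', ENNReal.ofReal_add (by positivity) η.coe_nonneg,
    ENNReal.ofReal_mul hC.le, ENNReal.ofReal_toReal hXtop, ENNReal.ofReal_coe_nnreal]
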